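/- For every integer t > 1 and every integer i with 0 ≤ i < t, there exists N such that for all n ≥ N, ex_3(n, F_t^3(i)) = C(n,3) − C(n−t,3). -/

import Mathlib

/-- `H` contains a copy of `F_t^3(i)`, the 3-expansion of the `t`-fan together with
`i` of the `t` triangles of the core fan added as hyperedges.
The center is `f (Sum.inl ())`; for each `j : Fin t`, the far-edge endpoints are
`f (Sum.inr (0, j))` and `f (Sum.inr (1, j))`, and the three expansion vertices are
`f (Sum.inr (2, j))`, `f (Sum.inr (3, j))`, `f (Sum.inr (4, j))`. -/
def ContainsFanExpTri {V : Type*} [DecidableEq V] (t i : ℕ) (H : Finset (Finset V)) : Prop :=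
  ∃ f : Unit ⊕ Fin 5 × Fin t → V, Function.Injective f ∧
    (∀ j : Fin t,
      ({f (Sum.inl ()), f (Sum.inr (0, j)), f (Sum.inr (2, j))} : Finset V) ∈ H ∧
      ({f (Sum.inl ()), f (Sum.inr (1, j)), f (Sum.inr (3, j))} : Finset V) ∈ H ∧
      ({f (Sum.inr (0, j)), f (Sum.inr (1, j)), f (Sum.inr (4, j))} : Finset V) ∈ H) ∧
    (∀ j : Fin t, (j : ℕ) < i →
      ({f (Sum.inl ()), f (Sum.inr (0, j)), f (Sum.inr (1, j))} : Finset V) ∈ H)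

/-- The Turán number `ex_3(n, F_t^3(i))`. -/
noncomputable def exFan3Tri (t i n : ℕ) : ℕ :=
  sSup {m | ∃ H : Finset (Finset (Fin n)),
    (∀ e ∈ H, e.card = 3) ∧ ¬ ContainsFanExpTri t i H ∧ H.card = m}

namespace FanTuran

open Finset

section Combinatorics

variable {V : Type} [DecidableEq V]

/-- Greedy packing: a property of bounded sets either has `m` pairwise disjoint members,
or all its members are hit by a small set. -/
theorem exists_disjoint_or_hitting (P : Finset V → Prop) (k m : ℕ)
    (hk : ∀ A, P A → A.card ≤ k) :
    (∃ A : Fin m → Finset V, (∀ j, P (A j)) ∧ ∀ i j, i ≠ j → Disjoint (A i) (A j)) ∨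
      ∃ K : Finset V, K.card ≤ k * m ∧ ∀ A, P A → ¬ Disjoint A K := by
  induction m with
  | zero => exact Or.inl ⟨fun _ => ∅, fun j => j.elim0, fun j => j.elim0⟩
  | succ m ih =>
    rcases ih with ⟨A, hA, hd⟩ | ⟨K, hK, hh⟩
    · by_cases hB : ∃ B, P B ∧ Disjoint B (univ.biUnion A)
      · obtain ⟨B, hPB, hB⟩ := hB
        rw [disjoint_biUnion_right] at hB
        refine Or.inl ⟨Fin.cons B A, ?_, ?_⟩
        · intro j
          refine Fin.cases ?_ ?_ j
          · simpa using hPB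
          · intro i; simpa using hA i
        · intro i j
          refine Fin.cases ?_ ?_ i
          · refine Fin.cases ?_ ?_ j
            · simp
            · intro j _; simpa using hB j (mem_univ _)
          · intro i
            refine Fin.cases ?_ ?_ j
            · intro _; simpa using (hB i (mem_univ _)).symm
            · intro j hij
              simpa using hd i j (fun h => hij (by rw [h]))
      · push Not at hB
        refine Or.inr ⟨univ.biUnion A, ?_, fun A' h => hB A' h⟩
        calc (univ.biUnion A).card ≤ ∑ j : Fin m, (A j).card := card_biUnion_le
          _ ≤ ∑ _j : Fin m, k := sum_le_sum fun j _ => hk _ (hA j)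
          _ = k * m := by simp [mul_comm]
          _ ≤ k * (m + 1) := Nat.mul_le_mul_left _ (Nat.le_succ _)
    · exact Or.inr ⟨K, hK.trans (Nat.mul_le_mul_left _ (Nat.le_succ _)), hh⟩

/-- Disjoint cores can be completed one after the other to pairwise disjoint sets. -/
theorem exists_disjoint_completion {k : ℕ} (core : Fin k → Finset V) (P : Fin k → Finset V → Prop)
    (hcore : ∀ i j, i ≠ j → Disjoint (core i) (core j)) (hc5 : ∀ i, (core i).card ≤ 5)
    (hP5 : ∀ i A, P i A → A.card ≤ 5)
    (hext : ∀ i (Q : Finset V), Q.card ≤ 10 * k → Disjoint (core i) Q →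
      ∃ A, P i A ∧ Disjoint A Q) :
    ∃ A : Fin k → Finset V, (∀ j, P j (A j)) ∧ ∀ i j, i ≠ j → Disjoint (A i) (A j) := by
  have key : ∀ s : Finset (Fin k), ∃ A : Fin k → Finset V, (∀ j ∈ s, P j (A j)) ∧
      (∀ i ∈ s, ∀ j ∈ s, i ≠ j → Disjoint (A i) (A j)) ∧
      (∀ i ∈ s, ∀ j, i ≠ j → Disjoint (A i) (core j)) := by
    intro s
    induction s using Finset.induction_on with
    | empty => exact ⟨fun _ => ∅, by simp, by simp, by simp⟩
    | insert j0 s hj0 ih =>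
      obtain ⟨A, hA, hd, hdc⟩ := ih
      set Q := s.biUnion A ∪ (univ.erase j0).biUnion core with hQ
      have hQc : Q.card ≤ 10 * k := by
        have h1 : (s.biUnion A).card ≤ s.card * 5 :=
          card_biUnion_le_card_mul _ _ _ fun j hj => hP5 j _ (hA j hj)
        have h2 : ((univ.erase j0).biUnion core).card ≤ (univ.erase j0).card * 5 :=
          card_biUnion_le_card_mul _ _ _ fun j _ => hc5 j
        have h3 : s.card ≤ k := by simpa using card_le_univ s
        have h4 : (univ.erase j0).card ≤ k := by simp
        have h5 := card_union_le (s.biUnion A) ((univ.erase j0).biUnion core)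
        rw [← hQ] at h5
        omega
      have hdis : Disjoint (core j0) Q := by
        rw [hQ, disjoint_union_right, disjoint_biUnion_right, disjoint_biUnion_right]
        refine ⟨fun i hi => (hdc i hi j0 ?_).symm, fun i hi => hcore _ _ ?_⟩
        · rintro rfl; exact hj0 hi
        · exact (ne_of_mem_erase hi).symm
      obtain ⟨B, hB, hBQ⟩ := hext j0 Q hQc hdis
      rw [hQ, disjoint_union_right, disjoint_biUnion_right, disjoint_biUnion_right] at hBQ
      have hne : ∀ i ∈ s, i ≠ j0 := by rintro i hi rfl; exact hj0 hi
      refine ⟨Function.update A j0 B, ?_, ?_, ?_⟩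
      · intro j hj
        rcases mem_insert.1 hj with rfl | hj
        · simpa using hB
        · simpa [Function.update_of_ne (hne j hj)] using hA j hj
      · intro i hi j hj hij
        rcases mem_insert.1 hi with rfl | hi'
        · rcases mem_insert.1 hj with hj' | hj
          · exact absurd hj'.symm hij
          · simpa [Function.update_of_ne (hne j hj)] using hBQ.1 j hj
        · rcases mem_insert.1 hj with hj' | hj
          · subst hj'
            simpa [Function.update_of_ne (hne i hi')] using (hBQ.1 i hi').symm
          · simpa [Function.update_of_ne (hne i hi'), Function.update_of_ne (hne j hj)]
              using hd i hi' j hj hij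
      · intro i hi j hij
        rcases mem_insert.1 hi with rfl | hi
        · simpa using hBQ.2 j (mem_erase.2 ⟨hij.symm, mem_univ _⟩)
        · simpa [Function.update_of_ne (hne i hi)] using hdc i hi j hij
  obtain ⟨A, h1, h2, -⟩ := key univ
  exact ⟨A, fun j => h1 j (mem_univ _), fun i j => h2 i (mem_univ _) j (mem_univ _)⟩

/-- A digraph with bounded out-degrees has a large independent set. -/
theorem exists_independent {ι : Type} [DecidableEq ι] (c : ι → ι → Prop) [DecidableRel c] (r k : ℕ)
    (J : Finset ι) (hJ : k * (2 * r + 1) ≤ J.card)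
    (hc : ∀ i ∈ J, (J.filter fun j => c i j).card ≤ r) :
    ∃ g : Fin k → ι, Function.Injective g ∧ (∀ i, g i ∈ J) ∧
      ∀ i j, i ≠ j → ¬ c (g i) (g j) := by
  induction k generalizing J with
  | zero => exact ⟨fun i => i.elim0, fun i => i.elim0, fun i => i.elim0, fun i => i.elim0⟩
  | succ k ih =>
    have hne : J.Nonempty := by
      rw [← card_pos]; refine lt_of_lt_of_le ?_ hJ; positivity
    have hsum : ∑ j ∈ J, (J.filter fun i => c i j).card ≤ ∑ _j ∈ J, r := by
      have : ∑ j ∈ J, (J.filter fun i => c i j).card = ∑ i ∈ J, (J.filter fun j => c i j).card :=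
        (sum_card_bipartiteAbove_eq_sum_card_bipartiteBelow c).symm
      rw [this]; exact sum_le_sum hc
    obtain ⟨j0, hj0, hin⟩ := exists_le_of_sum_le hne hsum
    set J' := J \ (insert j0 ((J.filter fun i => c i j0) ∪ (J.filter fun j => c j0 j))) with hJ'
    have hcard : k * (2 * r + 1) ≤ J'.card := by
      have h1 := le_card_sdiff (insert j0 ((J.filter fun i => c i j0) ∪ (J.filter fun j => c j0 j))) J
      have h2 := card_insert_le j0 ((J.filter fun i => c i j0) ∪ (J.filter fun j => c j0 j))
      have h3 := card_union_le (J.filter fun i => c i j0) (J.filter fun j => c j0 j)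
      have h4 := hc j0 hj0
      have h5 : (k + 1) * (2 * r + 1) = k * (2 * r + 1) + (2 * r + 1) := by ring
      rw [← hJ'] at h1
      omega
    have hsub : J' ⊆ J := sdiff_subset
    obtain ⟨g, hg, hgJ, hgc⟩ := ih J' hcard fun i hi =>
      (card_le_card (filter_subset_filter _ hsub)).trans (hc i (hsub hi))
    have hprop : ∀ i, g i ≠ j0 ∧ ¬ c (g i) j0 ∧ ¬ c j0 (g i) := by
      intro i
      have := hgJ i
      simp only [hJ', mem_sdiff, mem_insert, mem_union, mem_filter, not_or, not_and] at this
      exact ⟨this.2.1, this.2.2.1 this.1, this.2.2.2 this.1⟩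
    refine ⟨Fin.cons j0 g, ?_, ?_, ?_⟩
    · rw [Fin.cons_injective_iff]
      exact ⟨by rintro ⟨i, hi⟩; exact (hprop i).1 hi, hg⟩
    · intro i
      refine Fin.cases ?_ ?_ i
      · simpa using hj0
      · intro i; simpa using hsub (hgJ i)
    · intro i j
      refine Fin.cases ?_ ?_ i
      · refine Fin.cases ?_ ?_ j
        · simp
        · intro j _; simpa using (hprop j).2.2
      · intro i
        refine Fin.cases ?_ ?_ j
        · intro _; simpa using (hprop i).2.1
        · intro j hij
          simpa using hgc i j (fun h => hij (by rw [h]))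

/-- Among many disjoint sets `S j` with bounded companions `R j`, one finds `k` for which no
companion meets another set. -/
theorem exists_conflict_free {m r k : ℕ} (S R : Fin m → Finset V)
    (hS : ∀ i j, i ≠ j → Disjoint (S i) (S j)) (hR : ∀ i, (R i).card ≤ r)
    (hm : k * (2 * r + 1) ≤ m) :
    ∃ g : Fin k → Fin m, Function.Injective g ∧
      ∀ i j, i ≠ j → Disjoint (R (g i)) (S (g j)) := by
  classical
  obtain ⟨g, hg, -, hgc⟩ := exists_independent (fun i j => ¬ Disjoint (R i) (S j)) r k
    (univ : Finset (Fin m)) (by simpa using hm) (by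
      intro i _
      refine le_trans ?_ (hR i)
      have : ∀ j ∈ univ.filter (fun j => ¬ Disjoint (R i) (S j)), ∃ v, v ∈ R i ∧ v ∈ S j := by
        intro j hj
        exact not_disjoint_iff.1 (mem_filter.1 hj).2
      choose f hf using this
      refine card_le_card_of_injective (f := fun j => ⟨f j.1 j.2, (hf j.1 j.2).1⟩) ?_
      intro j l h
      have h' : f j.1 j.2 = f l.1 l.2 := congrArg Subtype.val h
      by_contra hjl
      exact disjoint_left.1 (hS j l fun e => hjl (Subtype.ext e)) (hf j.1 j.2).2
        (h' ▸ (hf l.1 l.2).2))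
  exact ⟨g, hg, fun i j hij => by simpa using hgc i j hij⟩

theorem exists_distinct_representatives {t : ℕ} (R : Fin t → Finset V) (hR : ∀ i, t ≤ (R i).card) :
    ∃ z : Fin t → V, Function.Injective z ∧ ∀ i, z i ∈ R i := by
  refine (Finset.all_card_le_biUnion_card_iff_exists_injective R).1 fun s => ?_
  rcases s.eq_empty_or_nonempty with rfl | ⟨i, hi⟩
  · simp
  · calc s.card ≤ t := by simpa using card_le_univ s
      _ ≤ (R i).card := hR i
      _ ≤ _ := card_le_card (subset_biUnion_of_mem R hi)

/-- Sets of size `t - 1` that are not all equal have distinct representatives. -/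
theorem exists_distinct_representatives_of_ne {t : ℕ} (R : Fin t → Finset V)
    (hR : ∀ i, (R i).card = t - 1) {i j : Fin t} (hij : R i ≠ R j) :
    ∃ z : Fin t → V, Function.Injective z ∧ ∀ i, z i ∈ R i := by
  refine (Finset.all_card_le_biUnion_card_iff_exists_injective R).1 fun s => ?_
  rcases s.eq_empty_or_nonempty with rfl | ⟨l, hl⟩
  · simp
  · by_cases hs : s = univ
    · subst hs
      have h1 : R i ∪ R j ⊆ univ.biUnion R :=
        union_subset (subset_biUnion_of_mem R (mem_univ i)) (subset_biUnion_of_mem R (mem_univ j))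
      have h2 : (R i).card < (R i ∪ R j).card := by
        refine card_lt_card (Finset.ssubset_iff_subset_ne.2 ⟨subset_union_left, fun h => hij ?_⟩)
        have : R j ⊆ R i := by rw [h]; exact subset_union_right
        exact (eq_of_subset_of_card_le this (by rw [hR, hR])).symm
      have h3 := card_le_card h1
      have h4 := hR i
      simp only [card_univ, Fintype.card_fin]
      omega
    · have h1 : s.card < t := by
        have := card_lt_card (ssubset_univ_iff.2 hs)
        simpa using this
      have h2 := card_le_card (subset_biUnion_of_mem R hl)
      rw [hR] at h2
      omega

end Combinatorics

end FanTuran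

namespace FanTuran

open Finset
open scoped Classical

section Counting

variable {V : Type} [Fintype V]

/-- The number of elements with a property, as a real number. -/
noncomputable def cnt1 (p : V → Prop) : ℝ := ((univ.filter p).card : ℝ)

/-- The number of ordered pairs with a property. -/
noncomputable def cnt2 (P : V → V → Prop) : ℝ := ∑ a, cnt1 (P a)

/-- The number of ordered triples with a property. -/
noncomputable def cnt3 (P : V → V → V → Prop) : ℝ := ∑ a, cnt2 (P a)

/-- Real-valued indicator of a proposition. -/
noncomputable def ind (p : Prop) : ℝ := if p then 1 else 0

theorem ind_true {p : Prop} (h : p) : ind p = 1 := if_pos h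

theorem ind_false {p : Prop} (h : ¬ p) : ind p = 0 := if_neg h

theorem ind_nonneg (p : Prop) : 0 ≤ ind p := by unfold ind; split_ifs <;> norm_num

theorem ind_le_one (p : Prop) : ind p ≤ 1 := by unfold ind; split_ifs <;> norm_num

theorem ind_mono {p q : Prop} (h : p → q) : ind p ≤ ind q := by
  by_cases hp : p
  · rw [ind_true hp, ind_true (h hp)]
  · rw [ind_false hp]; exact ind_nonneg q

theorem cnt1_eq_sum (p : V → Prop) : cnt1 p = ∑ a, ind (p a) := by
  simp [cnt1, ind, Finset.sum_boole]

theorem cnt2_eq_sum (P : V → V → Prop) : cnt2 P = ∑ a, ∑ b, ind (P a b) := by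
  simp [cnt2, cnt1_eq_sum]

theorem cnt3_eq_sum (P : V → V → V → Prop) : cnt3 P = ∑ a, ∑ b, ∑ c, ind (P a b c) := by
  simp [cnt3, cnt2_eq_sum]

theorem cnt1_mono {p q : V → Prop} (h : ∀ a, p a → q a) : cnt1 p ≤ cnt1 q := by
  unfold cnt1
  exact_mod_cast card_le_card (monotone_filter_right _ fun a _ => h a)

theorem cnt2_mono {P Q : V → V → Prop} (h : ∀ a b, P a b → Q a b) : cnt2 P ≤ cnt2 Q :=
  sum_le_sum fun a _ => cnt1_mono (h a)

theorem cnt3_mono {P Q : V → V → V → Prop} (h : ∀ a b c, P a b c → Q a b c) : cnt3 P ≤ cnt3 Q :=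
  sum_le_sum fun a _ => cnt2_mono (h a)

theorem cnt1_nonneg (p : V → Prop) : 0 ≤ cnt1 p := Nat.cast_nonneg _

theorem cnt2_nonneg (P : V → V → Prop) : 0 ≤ cnt2 P := sum_nonneg fun _ _ => cnt1_nonneg _

theorem cnt3_nonneg (P : V → V → V → Prop) : 0 ≤ cnt3 P := sum_nonneg fun _ _ => cnt2_nonneg _

theorem cnt1_or (p q : V → Prop) : cnt1 (fun a => p a ∨ q a) ≤ cnt1 p + cnt1 q := by
  simp only [cnt1_eq_sum]
  rw [← sum_add_distrib]
  refine sum_le_sum fun a _ => ?_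
  by_cases h1 : p a
  · rw [ind_true h1]; linarith [ind_le_one (p a ∨ q a), ind_nonneg (q a)]
  · rw [ind_false h1, zero_add]; exact ind_mono fun h => h.resolve_left h1

theorem cnt2_or (P Q : V → V → Prop) : cnt2 (fun a b => P a b ∨ Q a b) ≤ cnt2 P + cnt2 Q := by
  unfold cnt2
  rw [← sum_add_distrib]
  exact sum_le_sum fun a _ => cnt1_or _ _

theorem cnt3_or (P Q : V → V → V → Prop) :
    cnt3 (fun a b c => P a b c ∨ Q a b c) ≤ cnt3 P + cnt3 Q := by
  unfold cnt3
  rw [← sum_add_distrib]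
  exact sum_le_sum fun a _ => cnt2_or _ _

theorem cnt1_le_add {p q r : V → Prop} (h : ∀ a, p a → q a ∨ r a) : cnt1 p ≤ cnt1 q + cnt1 r :=
  (cnt1_mono h).trans (cnt1_or _ _)

theorem cnt2_le_add {P Q R : V → V → Prop} (h : ∀ a b, P a b → Q a b ∨ R a b) :
    cnt2 P ≤ cnt2 Q + cnt2 R :=
  (cnt2_mono h).trans (cnt2_or _ _)

theorem cnt3_le_add {P Q R : V → V → V → Prop} (h : ∀ a b c, P a b c → Q a b c ∨ R a b c) :
    cnt3 P ≤ cnt3 Q + cnt3 R :=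
  (cnt3_mono h).trans (cnt3_or _ _)

theorem cnt1_add_le {p q r : V → Prop} (hp : ∀ a, p a → r a) (hq : ∀ a, q a → r a)
    (h : ∀ a, p a → ¬ q a) : cnt1 p + cnt1 q ≤ cnt1 r := by
  simp only [cnt1_eq_sum]
  rw [← sum_add_distrib]
  refine sum_le_sum fun a _ => ?_
  by_cases h1 : p a
  · rw [ind_true h1, ind_false (h a h1), ind_true (hp a h1)]; norm_num
  · rw [ind_false h1, zero_add]; exact ind_mono (hq a)

theorem cnt2_add_le {P Q R : V → V → Prop} (hP : ∀ a b, P a b → R a b)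
    (hQ : ∀ a b, Q a b → R a b) (h : ∀ a b, P a b → ¬ Q a b) : cnt2 P + cnt2 Q ≤ cnt2 R := by
  unfold cnt2
  rw [← sum_add_distrib]
  exact sum_le_sum fun a _ => cnt1_add_le (hP a) (hQ a) (h a)

theorem cnt3_add_le {P Q R : V → V → V → Prop} (hP : ∀ a b c, P a b c → R a b c)
    (hQ : ∀ a b c, Q a b c → R a b c) (h : ∀ a b c, P a b c → ¬ Q a b c) :
    cnt3 P + cnt3 Q ≤ cnt3 R := by
  unfold cnt3
  rw [← sum_add_distrib]
  exact sum_le_sum fun a _ => cnt2_add_le (hP a) (hQ a) (h a)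

theorem cnt2_swap (P : V → V → Prop) : cnt2 (fun a b => P b a) = cnt2 P := by
  simp only [cnt2_eq_sum]; exact sum_comm

theorem cnt3_swap12 (P : V → V → V → Prop) : cnt3 (fun a b c => P b a c) = cnt3 P := by
  simp only [cnt3_eq_sum]; exact sum_comm

theorem cnt3_swap23 (P : V → V → V → Prop) : cnt3 (fun a b c => P a c b) = cnt3 P := by
  simp only [cnt3_eq_sum]; exact sum_congr rfl fun a _ => sum_comm

theorem cnt1_le_card (p : V → Prop) : cnt1 p ≤ Fintype.card V := by
  unfold cnt1; exact_mod_cast card_le_univ _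

theorem cnt1_le_of_mem {p : V → Prop} {K : Finset V} (h : ∀ a, p a → a ∈ K) :
    cnt1 p ≤ K.card := by
  unfold cnt1
  exact_mod_cast card_le_card fun a ha => h a (mem_filter.1 ha).2

theorem cnt1_mem (K : Finset V) : cnt1 (fun a => a ∈ K) = K.card := by
  unfold cnt1; congr 2; ext; simp

theorem cnt1_le_zero {p : V → Prop} (h : ∀ a, ¬ p a) : cnt1 p ≤ 0 := by
  simpa using cnt1_le_of_mem (p := p) (K := ∅) (by simpa using h)

theorem cnt2_le_of_mem {P : V → V → Prop} {K : V → Finset V} {C : ℝ}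
    (hK : ∀ a, ((K a).card : ℝ) ≤ C) (h : ∀ a b, P a b → b ∈ K a) :
    cnt2 P ≤ Fintype.card V * C := by
  calc cnt2 P ≤ ∑ _a : V, C := sum_le_sum fun a _ => (cnt1_le_of_mem (h a)).trans (hK a)
    _ = _ := by simp

theorem cnt2_le_mul {P : V → V → Prop} {p : V → Prop} {C : ℝ}
    (hp : ∀ a b, P a b → p a) (h : ∀ a, p a → cnt1 (P a) ≤ C) : cnt2 P ≤ C * cnt1 p := by
  rw [cnt1_eq_sum, mul_sum]
  refine sum_le_sum fun a _ => ?_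
  by_cases ha : p a
  · rw [ind_true ha, mul_one]; exact h a ha
  · rw [ind_false ha, mul_zero]; exact cnt1_le_zero fun b hb => ha (hp a b hb)

theorem cnt3_le_mul {P : V → V → V → Prop} {Q : V → V → Prop} {C : ℝ}
    (hp : ∀ a b c, P a b c → Q a b) (h : ∀ a b, Q a b → cnt1 (P a b) ≤ C) :
    cnt3 P ≤ C * cnt2 Q := by
  unfold cnt3
  rw [cnt2, mul_sum]
  exact sum_le_sum fun a _ => cnt2_le_mul (hp a) (h a)

theorem cnt3_le_mul1 {P : V → V → V → Prop} {p : V → Prop} {C : ℝ}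
    (hp : ∀ a b c, P a b c → p a) (h : ∀ a, p a → cnt2 (P a) ≤ C) : cnt3 P ≤ C * cnt1 p := by
  rw [cnt1_eq_sum, mul_sum]
  refine sum_le_sum fun a _ => ?_
  by_cases ha : p a
  · rw [ind_true ha, mul_one]; exact h a ha
  · rw [ind_false ha, mul_zero]
    exact le_of_le_of_eq (sum_le_sum fun b _ => cnt1_le_zero fun c hc => ha (hp a b c hc)) (by simp)

theorem cnt2_le_sq (P : V → V → Prop) : cnt2 P ≤ (Fintype.card V : ℝ) ^ 2 := by
  calc cnt2 P ≤ ∑ _a : V, (Fintype.card V : ℝ) := sum_le_sum fun a _ => cnt1_le_card _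
    _ = _ := by simp [sq]

theorem mul_cnt1_le_cnt2 {P : V → V → Prop} {p : V → Prop} {C : ℝ}
    (h : ∀ a, p a → C ≤ cnt1 (P a)) : C * cnt1 p ≤ cnt2 P := by
  rw [cnt1_eq_sum, mul_sum]
  refine sum_le_sum fun a _ => ?_
  by_cases ha : p a
  · rw [ind_true ha, mul_one]; exact h a ha
  · rw [ind_false ha, mul_zero]; exact cnt1_nonneg _

theorem mul_cnt2_le_cnt3 {P : V → V → V → Prop} {Q : V → V → Prop} {C : ℝ}
    (h : ∀ a b, Q a b → C ≤ cnt1 (P a b)) : C * cnt2 Q ≤ cnt3 P := by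
  unfold cnt3
  rw [cnt2, mul_sum]
  exact sum_le_sum fun a _ => mul_cnt1_le_cnt2 (h a)

theorem cnt1_eq_one (a : V) : cnt1 (fun x => x = a) = 1 := by
  simp [cnt1_eq_sum, ind]

theorem cnt1_false : cnt1 (fun _ : V => False) = 0 := by simp [cnt1]

end Counting

section Hypergraph

variable {V : Type}

/-- A 3-graph, as a symmetric irreflexive ternary relation. -/
structure Sym3 (E : V → V → V → Prop) : Prop where
  swap12 : ∀ {a b c}, E a b c → E b a c
  swap23 : ∀ {a b c}, E a b c → E a c b
  ne12 : ∀ {a b c}, E a b c → a ≠ b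

namespace Sym3

variable {E : V → V → V → Prop} {a b c : V} (hE : Sym3 E)

include hE

theorem rot (h : E a b c) : E b c a := hE.swap23 (hE.swap12 h)

theorem rot' (h : E a b c) : E c a b := hE.swap12 (hE.swap23 h)

theorem ne23 (h : E a b c) : b ≠ c := hE.ne12 (hE.rot h)

theorem ne13 (h : E a b c) : a ≠ c := hE.ne12 (hE.swap23 h)

end Sym3

section Petals

variable {E : V → V → V → Prop} {t : ℕ}

/-- The vertex set `A` carries an expanded triangle with center `c`. -/
def IsPetal (E : V → V → V → Prop) (c : V) (A : Finset V) : Prop :=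
  ∃ a b x y z, A = {a, b, x, y, z} ∧ A.card = 5 ∧ c ∉ A ∧ E c a x ∧ E c b y ∧ E a b z

/-- The vertex set `A` carries an expanded triangle with center `c` whose core is an edge. -/
def IsCPetal (E : V → V → V → Prop) (c : V) (A : Finset V) : Prop :=
  ∃ a b x y z, A = {a, b, x, y, z} ∧ A.card = 5 ∧ c ∉ A ∧ E c a x ∧ E c b y ∧ E a b z ∧ E c a b

/-- There is no `t`-fan expansion with all but one of the core triangles present. -/
def FanFree (E : V → V → V → Prop) (t : ℕ) : Prop :=
  ¬ ∃ (c : V) (A : Fin t → Finset V), (∀ i j, i ≠ j → Disjoint (A i) (A j)) ∧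
    (∀ j, IsPetal E c (A j)) ∧ ∀ j : Fin t, j.val + 1 < t → IsCPetal E c (A j)

theorem IsCPetal.isPetal {c : V} {A : Finset V} (h : IsCPetal E c A) : IsPetal E c A := by
  obtain ⟨a, b, x, y, z, h1, h2, h3, h4, h5, h6, -⟩ := h
  exact ⟨a, b, x, y, z, h1, h2, h3, h4, h5, h6⟩

theorem isPetal_mk (hE : Sym3 E) {c a b x y z : V} (h1 : E c a x) (h2 : E c b y)
    (h3 : E a b z) (hxb : x ≠ b) (hya : y ≠ a) (hxy : x ≠ y) (hzx : z ≠ x)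
    (hzy : z ≠ y) (hzc : z ≠ c) : IsPetal E c {a, b, x, y, z} := by
  have hab := hE.ne12 h3
  have haz := hE.ne13 h3
  have hbz := hE.ne23 h3
  have hax := hE.ne23 h1
  have hcx := hE.ne13 h1
  have hca := hE.ne12 h1
  have hby := hE.ne23 h2
  have hcb := hE.ne12 h2
  have hcy := hE.ne13 h2
  refine ⟨a, b, x, y, z, rfl, ?_, ?_, h1, h2, h3⟩
  · rw [card_insert_of_notMem, card_insert_of_notMem, card_insert_of_notMem,
      card_insert_of_notMem, card_singleton]
    · simpa using hzy.symm
    · simp only [mem_insert, mem_singleton, not_or]; exact ⟨hxy, hzx.symm⟩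
    · simp only [mem_insert, mem_singleton, not_or]; exact ⟨hxb.symm, hby, hbz⟩
    · simp only [mem_insert, mem_singleton, not_or]; exact ⟨hab, hax, hya.symm, haz⟩
  · simp only [mem_insert, mem_singleton, not_or]; exact ⟨hca, hcb, hcx, hcy, hzc.symm⟩

theorem isCPetal_mk (hE : Sym3 E) {c a b x y z : V} (h0 : E c a b) (h1 : E c a x) (h2 : E c b y)
    (h3 : E a b z) (hxb : x ≠ b) (hya : y ≠ a) (hxy : x ≠ y) (hzx : z ≠ x)
    (hzy : z ≠ y) (hzc : z ≠ c) : IsCPetal E c {a, b, x, y, z} := by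
  obtain ⟨a', b', x', y', z', h, h5, hc, -⟩ := isPetal_mk hE h1 h2 h3 hxb hya hxy hzx hzy hzc
  exact ⟨a, b, x, y, z, rfl, h5, hc, h1, h2, h3, h0⟩

theorem FanFree.not_centered (hF : FanFree E t) (c : V) (A : Fin t → Finset V)
    (hA : ∀ i j, i ≠ j → Disjoint (A i) (A j)) (h : ∀ j, IsCPetal E c (A j)) : False :=
  hF ⟨c, A, hA, fun j => (h j).isPetal, fun j _ => h j⟩

/-- A set larger than a forbidden one has an element outside it. -/
theorem exists_mem_notMem {S Q : Finset V} (h : Q.card < S.card) : ∃ v ∈ S, v ∉ Q := by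
  by_contra! hc
  exact absurd (card_le_card fun v hv => hc v hv) (by omega)

variable [Fintype V]

/-- The common link of a pair of vertices. -/
noncomputable def nb (E : V → V → V → Prop) (a b : V) : Finset V := univ.filter fun c => E a b c

@[simp] theorem mem_nb {a b c : V} : c ∈ nb E a b ↔ E a b c := by simp [nb]

theorem cnt1_eq_card_nb (a b : V) : cnt1 (E a b) = (nb E a b).card := rfl

theorem Sym3.nb_comm (hE : Sym3 E) (a b : V) : nb E a b = nb E b a := by
  ext c; simp only [mem_nb]; exact ⟨hE.swap12, hE.swap12⟩

/-- A path `x b c y` in the link of `a` whose middle pair has many further neighbours. -/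
def Quad (E : V → V → V → Prop) (t : ℕ) (a b c x y : V) : Prop :=
  E a b c ∧ E a b x ∧ E a c y ∧ x ≠ c ∧ y ≠ b ∧ x ≠ y ∧ t ≤ (nb E b c \ {a, x, y}).card

/-- `K` meets every `Quad` in the link of `a`. -/
def HitSet (E : V → V → V → Prop) (t : ℕ) (a : V) (K : Finset V) : Prop :=
  ∀ b c x y, Quad E t a b c x y → b ∈ K ∨ c ∈ K ∨ x ∈ K ∨ y ∈ K

theorem HitSet.mono {a : V} {K K' : Finset V} (h : HitSet E t a K) (hK : K ⊆ K') :
    HitSet E t a K' := fun b c x y hq => by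
  rcases h b c x y hq with h | h | h | h
  exacts [.inl (hK h), .inr (.inl (hK h)), .inr (.inr (.inl (hK h))), .inr (.inr (.inr (hK h)))]

/-- The size of the hitting sets. -/
def hitSize (t : ℕ) : ℕ := 4 * (t * (2 * t + 1))

theorem FanFree.exists_hitSet (hE : Sym3 E) (hF : FanFree E t) (a : V) :
    ∃ K : Finset V, K.card ≤ hitSize t ∧ HitSet E t a K := by
  rcases exists_disjoint_or_hitting
    (fun A : Finset V => ∃ b c x y, A = {b, c, x, y} ∧ Quad E t a b c x y) 4 (t * (2 * t + 1))
    (by rintro A ⟨b, c, x, y, rfl, -⟩; exact card_le_four) with ⟨A, hA, hd⟩ | ⟨K, hK, hh⟩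
  · exfalso
    choose b c x y hA hq using hA
    have hR : ∀ j, ∃ R ⊆ nb E (b j) (c j) \ {a, x j, y j}, R.card = t := fun j =>
      exists_subset_card_eq (hq j).2.2.2.2.2.2
    choose R hR hRc using hR
    obtain ⟨g, hg, hgd⟩ := exists_conflict_free A R hd (fun i => (hRc i).le) le_rfl
    obtain ⟨z, hz, hzR⟩ := exists_distinct_representatives (fun i => R (g i))
      (fun i => (hRc _).ge)
    refine hF.not_centered a (fun j => {b (g j), c (g j), x (g j), y (g j), z j}) ?_ ?_
    · intro i j hij
      have key : ∀ k, ({b (g k), c (g k), x (g k), y (g k), z k} : Finset V) = A (g k) ∪ {z k} := by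
        intro k; rw [hA]; ext v; simp
      simp only [key, disjoint_union_left, disjoint_union_right, disjoint_singleton_left,
        disjoint_singleton_right, mem_union, mem_singleton, not_or]
      exact ⟨⟨hd _ _ fun h => hij (hg h), disjoint_left.1 (hgd i j hij) (hzR i)⟩,
        disjoint_left.1 (hgd j i hij.symm) (hzR j), fun h => hij (hz h).symm⟩
    · intro j
      obtain ⟨h1, h2, h3, h4, h5, h6, -⟩ := hq (g j)
      have h7 := hR _ (hzR j)
      simp only [mem_sdiff, mem_nb, mem_insert, mem_singleton, not_or] at h7
      exact isCPetal_mk hE h1 h2 h3 h7.1 h4 h5 h6 h7.2.2.1 h7.2.2.2 h7.2.1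
  · refine Or.inr ⟨K, hK, fun b c x y hq => ?_⟩ |>.resolve_left id
    have := hh _ ⟨b, c, x, y, rfl, hq⟩
    rw [not_disjoint_iff] at this
    obtain ⟨v, hv, hvK⟩ := this
    simp only [mem_insert, mem_singleton] at hv
    rcases hv with rfl | rfl | rfl | rfl
    exacts [.inl hvK, .inr (.inl hvK), .inr (.inr (.inl hvK)), .inr (.inr (.inr hvK))]

theorem HitSet.mem_or_mem (hE : Sym3 E) {y u v : V} {K : Finset V} {C : ℕ} (hK : HitSet E t y K)
    (hKc : K.card ≤ C) (h : E y u v) (huv : t + 1 ≤ (nb E u v).card)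
    (hu : C + t + 3 ≤ (nb E y u).card) (hv : C + t + 3 ≤ (nb E y v).card) : u ∈ K ∨ v ∈ K := by
  by_contra! hc
  obtain ⟨R, hR, hRc⟩ : ∃ R ⊆ (nb E u v).erase y, R.card = t := by
    refine exists_subset_card_eq ?_
    rw [card_erase_of_mem (mem_nb.2 (hE.rot h))]; omega
  obtain ⟨x, hx, hxQ⟩ : ∃ x ∈ nb E y u, x ∉ K ∪ R ∪ {v} := by
    refine exists_mem_notMem (lt_of_le_of_lt (card_union_le _ _) ?_)
    have := card_union_le K R
    simp only [card_singleton]; omega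
  obtain ⟨x', hx', hxQ'⟩ : ∃ x' ∈ nb E y v, x' ∉ K ∪ R ∪ {u, x} := by
    refine exists_mem_notMem (lt_of_le_of_lt (card_union_le _ _) ?_)
    have := card_union_le K R
    have := card_le_two (a := u) (b := x)
    omega
  simp only [mem_union, mem_insert, mem_singleton, not_or] at hxQ hxQ'
  rw [mem_nb] at hx hx'
  have hq : Quad E t y u v x x' := by
    refine ⟨h, hx, hx', hxQ.2, hxQ'.2.1, Ne.symm hxQ'.2.2, ?_⟩
    rw [← hRc]
    refine card_le_card fun w hw => ?_
    have := mem_erase.1 (hR hw)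
    simp only [mem_sdiff, mem_insert, mem_singleton, not_or]
    refine ⟨this.2, this.1, ?_, ?_⟩
    · rintro rfl; exact hxQ.1.2 hw
    · rintro rfl; exact hxQ'.1.2 hw
  rcases hK u v x x' hq with h | h | h | h
  exacts [hc.1 h, hc.2 h, hxQ.1.1 h, hxQ'.1.1 h]

end Petals

section Peeling

variable [Fintype V] {E E' : V → V → V → Prop} {t : ℕ}

theorem cnt3_pair_le (hE : Sym3 E) {Q : V → V → Prop} :
    cnt3 (fun a b c => E a b c ∧ (Q a b ∨ Q a c ∨ Q b c)) ≤ 3 * cnt3 (fun a b c => E a b c ∧ Q a b) := by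
  have h1 : cnt3 (fun a b c => E a b c ∧ Q a c) ≤ cnt3 (fun a b c => E a b c ∧ Q a b) := by
    rw [← cnt3_swap23]; exact cnt3_mono fun a b c h => ⟨hE.swap23 h.1, h.2⟩
  have h2 : cnt3 (fun a b c => E a b c ∧ Q b c) ≤ cnt3 (fun a b c => E a b c ∧ Q a c) := by
    rw [← cnt3_swap12]; exact cnt3_mono fun a b c h => ⟨hE.swap12 h.1, h.2⟩
  have h3 : cnt3 (fun a b c => E a b c ∧ (Q a b ∨ Q a c ∨ Q b c)) ≤
      cnt3 (fun a b c => E a b c ∧ Q a b) +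
        cnt3 (fun a b c => (E a b c ∧ Q a c) ∨ (E a b c ∧ Q b c)) :=
    cnt3_le_add fun a b c h => by tauto
  have h4 := cnt3_or (fun a b c => E a b c ∧ Q a c) (fun a b c => E a b c ∧ Q b c)
  linarith

theorem cnt3_vertex_le (hE : Sym3 E) {q : V → Prop} :
    cnt3 (fun a b c => E a b c ∧ (q a ∨ q b ∨ q c)) ≤ 3 * cnt3 (fun a b c => E a b c ∧ q a) := by
  have h1 : cnt3 (fun a b c => E a b c ∧ q b) ≤ cnt3 (fun a b c => E a b c ∧ q a) := by
    rw [← cnt3_swap12]; exact cnt3_mono fun a b c h => ⟨hE.swap12 h.1, h.2⟩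
  have h2 : cnt3 (fun a b c => E a b c ∧ q c) ≤ cnt3 (fun a b c => E a b c ∧ q b) := by
    rw [← cnt3_swap23]; exact cnt3_mono fun a b c h => ⟨hE.swap23 h.1, h.2⟩
  have h3 : cnt3 (fun a b c => E a b c ∧ (q a ∨ q b ∨ q c)) ≤
      cnt3 (fun a b c => E a b c ∧ q a) +
        cnt3 (fun a b c => (E a b c ∧ q b) ∨ (E a b c ∧ q c)) :=
    cnt3_le_add fun a b c h => by tauto
  have h4 := cnt3_or (fun a b c => E a b c ∧ q b) (fun a b c => E a b c ∧ q c)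
  linarith

/-- The codegree bound in the degeneracy of fan-free hypergraphs. -/
def peelDeg (t : ℕ) : ℕ := hitSize t + t + 3

theorem FanFree.exists_shadow_pair (hE : Sym3 E) (hF : FanFree E t) (hE' : Sym3 E')
    (hsub : ∀ a b c, E' a b c → E a b c) {a b c : V} (h : E' a b c) :
    ∃ a b c, E' a b c ∧ (nb E' a b).card < peelDeg t := by
  by_contra! hc
  have hnb : ∀ a b, (nb E' a b).card ≤ (nb E a b).card := fun a b =>
    card_le_card fun c hc => mem_nb.2 (hsub _ _ _ (mem_nb.1 hc))
  obtain ⟨K, hKc, hK⟩ := hF.exists_hitSet hE a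
  unfold peelDeg at hc
  obtain ⟨v, hv, hvK⟩ : ∃ v ∈ nb E' a b, v ∉ K :=
    exists_mem_notMem (by have := hc a b c h; omega)
  have hv' := mem_nb.1 hv
  obtain ⟨w, hw, hwK⟩ : ∃ w ∈ nb E' a v, w ∉ K :=
    exists_mem_notMem (by have := hc a v b (hE'.swap23 hv'); omega)
  have hw' := mem_nb.1 hw
  have h1 := (hc a v w hw').trans (hnb _ _)
  have h2 := (hc a w v (hE'.swap23 hw')).trans (hnb _ _)
  have h3 := (hc v w a (hE'.rot hw')).trans (hnb _ _)
  rcases hK.mem_or_mem hE hKc (hsub _ _ _ hw') (by omega) h1 h2 with h | h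
  exacts [hvK h, hwK h]

theorem FanFree.cnt3_le_shadow (hE : Sym3 E) (hF : FanFree E t) (hE' : Sym3 E')
    (hsub : ∀ a b c, E' a b c → E a b c) :
    cnt3 E' ≤ 3 * peelDeg t * cnt2 (fun a b => ∃ c, E' a b c) := by
  obtain ⟨m, hm⟩ := exists_nat_ge (cnt2 fun a b => ∃ c, E' a b c)
  induction m using Nat.strong_induction_on generalizing E' with
  | _ m ih =>
  by_cases hne : ∃ a b c, E' a b c
  · obtain ⟨a, b, c, h⟩ := hne
    obtain ⟨a, b, c, h, hd⟩ := hF.exists_shadow_pair hE hE' hsub h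
    set Q : V → V → Prop := fun x y => (x = a ∧ y = b) ∨ (x = b ∧ y = a) with hQ
    have hQs : ∀ x y, Q x y → Q y x := fun x y h => by simp only [hQ] at h ⊢; tauto
    set E'' : V → V → V → Prop := fun x y z => E' x y z ∧ ¬ (Q x y ∨ Q x z ∨ Q y z) with hE''
    have hs : Sym3 E'' := by
      refine ⟨fun h => ⟨hE'.swap12 h.1, ?_⟩, fun h => ⟨hE'.swap23 h.1, ?_⟩, fun h => hE'.ne12 h.1⟩
      · have := h.2; have h1 := hQs; grind
      · have := h.2; have h1 := hQs; grind
    have h1 : cnt3 E' ≤ cnt3 (fun x y z => E' x y z ∧ (Q x y ∨ Q x z ∨ Q y z)) + cnt3 E'' :=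
      cnt3_le_add fun x y z h => by simp only [hE'']; tauto
    have h2 := cnt3_pair_le hE' (Q := Q)
    have h3 : cnt3 (fun x y z => E' x y z ∧ Q x y) ≤ peelDeg t * cnt2 Q := by
      refine cnt3_le_mul (fun x y z h => h.2) ?_
      rintro x y (⟨rfl, rfl⟩ | ⟨rfl, rfl⟩)
      · refine (cnt1_mono (q := E' x y) fun z h => h.1).trans ?_
        rw [cnt1_eq_card_nb]; exact_mod_cast hd.le
      · refine (cnt1_mono (q := E' x y) fun z h => h.1).trans ?_
        rw [cnt1_eq_card_nb, hE'.nb_comm]; exact_mod_cast hd.le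
    have h4 : cnt2 Q + cnt2 (fun x y => ∃ z, E'' x y z) ≤ cnt2 (fun x y => ∃ z, E' x y z) := by
      refine cnt2_add_le ?_ (fun x y ⟨z, hz⟩ => ⟨z, hz.1⟩) (fun x y hq ⟨z, hz⟩ => hz.2 (.inl hq))
      rintro x y (⟨rfl, rfl⟩ | ⟨rfl, rfl⟩)
      exacts [⟨c, h⟩, ⟨c, hE'.swap12 h⟩]
    have h5 : 1 ≤ cnt2 Q := by
      have e1 : 1 * cnt1 (fun x => x = a) ≤ cnt2 Q := by
        refine mul_cnt1_le_cnt2 ?_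
        rintro x rfl
        rw [← cnt1_eq_one b]
        exact cnt1_mono fun y hy => .inl ⟨rfl, hy⟩
      linarith [cnt1_eq_one a]
    have hm1 : 1 ≤ m := by
      have : (1 : ℝ) ≤ m := by linarith [cnt2_nonneg fun x y => ∃ z, E'' x y z]
      exact_mod_cast this
    have h6 := ih (m - 1) (by omega) hs (fun x y z h => hsub _ _ _ h.1)
      (by push_cast [hm1]; linarith)
    have h7 : (0 : ℝ) ≤ peelDeg t := Nat.cast_nonneg _
    nlinarith
  · push Not at hne
    have : cnt3 E' ≤ 0 := by
      have := cnt3_le_mul1 (P := E') (p := fun _ => False) (C := 0)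
        (fun a b c h => hne a b c h) (by simp)
      simpa using this
    refine this.trans ?_
    have := cnt2_nonneg fun a b => ∃ c, E' a b c
    positivity

end Peeling

end Hypergraph
end FanTuran

namespace FanTuran

open Finset
open scoped Classical

section Weights

variable {V : Type} [Fintype V] {L : V → V → V → Prop}

theorem one_le_inv_add_inv {a b c : V} (hL : ∀ {a b c}, L a b c → L a c b) (h : L a b c)
    (hmid : ∀ x y, L a b x → L a c y → x ≠ c → y ≠ b → x = y) :
    1 ≤ (cnt1 (L a b))⁻¹ + (cnt1 (L a c))⁻¹ := by
  have hb : L a c b := hL h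
  have e1 : cnt1 (L a b) = ((univ.filter (L a b)).erase c).card + 1 := by
    rw [cnt1, ← card_erase_add_one (mem_filter.2 ⟨mem_univ _, h⟩)]; push_cast; rfl
  have e2 : cnt1 (L a c) = ((univ.filter (L a c)).erase b).card + 1 := by
    rw [cnt1, ← card_erase_add_one (mem_filter.2 ⟨mem_univ _, hb⟩)]; push_cast; rfl
  set B := (univ.filter (L a b)).erase c
  set B' := (univ.filter (L a c)).erase b
  have hBB : ∀ x ∈ B, ∀ y ∈ B', x = y := by
    intro x hx y hy
    simp only [B, B', mem_erase, mem_filter, mem_univ, true_and] at hx hy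
    exact hmid x y hx.2 hy.2 hx.1 hy.1
  rw [e1, e2]
  rcases B.eq_empty_or_nonempty with h0 | ⟨x, hx⟩
  · rw [h0]; simp; positivity
  rcases B'.eq_empty_or_nonempty with h0 | ⟨y, hy⟩
  · rw [h0]; simp; positivity
  have h1 : B.card ≤ 1 := card_le_one.2 fun u hu v hv => (hBB u hu y hy).trans (hBB v hv y hy).symm
  have h2 : B'.card ≤ 1 := card_le_one.2 fun u hu v hv => (hBB x hx u hu).symm.trans (hBB x hx v hv)
  have h3 : (2 : ℝ)⁻¹ ≤ ((B.card : ℝ) + 1)⁻¹ := by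
    apply inv_anti₀ (by positivity);
    have : (B.card : ℝ) ≤ 1 := by exact_mod_cast h1
    linarith
  have h4 : (2 : ℝ)⁻¹ ≤ ((B'.card : ℝ) + 1)⁻¹ := by
    apply inv_anti₀ (by positivity);
    have : (B'.card : ℝ) ≤ 1 := by exact_mod_cast h2
    linarith
  linarith

/-- The charge given to the triple `a b c` from the link of `a`. -/
noncomputable def charge (L : V → V → V → Prop) (a b c : V) : ℝ :=
  ind (L a b c) * ((cnt1 (L a b))⁻¹ + (cnt1 (L a c))⁻¹)

theorem charge_nonneg (a b c : V) : 0 ≤ charge L a b c :=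
  mul_nonneg (ind_nonneg _) (add_nonneg (inv_nonneg.2 (cnt1_nonneg _)) (inv_nonneg.2 (cnt1_nonneg _)))

theorem charge_eq {a b c : V} (h : L a b c) :
    charge L a b c = (cnt1 (L a b))⁻¹ + (cnt1 (L a c))⁻¹ := by
  rw [charge, ind_true h, one_mul]

theorem sum_ind_mul_inv (a : V) :
    ∑ b, ∑ c, ind (L a b c) * (cnt1 (L a b))⁻¹ = cnt1 (fun b => ∃ c, L a b c) := by
  rw [cnt1_eq_sum]
  refine sum_congr rfl fun b _ => ?_
  rw [← sum_mul, ← cnt1_eq_sum]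
  by_cases h : ∃ c, L a b c
  · rw [ind_true h, mul_inv_cancel₀]
    obtain ⟨c, hc⟩ := h
    have hp : 0 < cnt1 (L a b) := by
      unfold cnt1; exact_mod_cast card_pos.2 ⟨c, mem_filter.2 ⟨mem_univ _, hc⟩⟩
    exact hp.ne'
  · rw [ind_false h]
    push Not at h
    rw [le_antisymm (cnt1_le_zero h) (cnt1_nonneg _)]; simp

theorem sum_charge (hL : ∀ {a b c}, L a b c → L a c b) :
    ∑ a, ∑ b, ∑ c, charge L a b c = 2 * cnt2 (fun a b => ∃ c, L a b c) := by
  have h1 := sum_ind_mul_inv (L := L)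
  have h2 : ∀ a, ∑ b, ∑ c, ind (L a b c) * (cnt1 (L a c))⁻¹ = cnt1 (fun b => ∃ c, L a b c) := by
    intro a
    rw [sum_comm, ← h1 a]
    refine sum_congr rfl fun b _ => sum_congr rfl fun c _ => ?_
    have : L a c b = L a b c := propext ⟨hL, hL⟩
    rw [this]
  simp only [charge, mul_add, sum_add_distrib, h1, h2]
  rw [cnt2]; ring

theorem cnt3_le_of_charge {J : V → V → V → Prop} (hL : ∀ {a b c}, L a b c → L a c b) {κ : ℝ}
    (hκ : 0 < κ)
    (h : ∀ a b c, J a b c → 6 / κ ≤ charge L a b c + charge L b c a + charge L c a b) :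
    cnt3 J ≤ κ * cnt2 (fun a b => ∃ c, L a b c) := by
  have h0 := sum_charge (L := L) hL
  have h1 : ∑ a, ∑ b, ∑ c, charge L b c a = ∑ a, ∑ b, ∑ c, charge L a b c := by
    rw [sum_comm]; exact sum_congr rfl fun a _ => sum_comm
  have h2 : ∑ a, ∑ b, ∑ c, charge L c a b = ∑ a, ∑ b, ∑ c, charge L a b c := by
    exact (sum_congr rfl fun a _ => sum_comm).trans sum_comm
  have h3 : 6 / κ * cnt3 J ≤
      ∑ a, ∑ b, ∑ c, (charge L a b c + charge L b c a + charge L c a b) := by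
    rw [cnt3_eq_sum]
    simp only [mul_sum]
    refine sum_le_sum fun a _ => sum_le_sum fun b _ => sum_le_sum fun c _ => ?_
    by_cases hj : J a b c
    · rw [ind_true hj, mul_one]; exact h a b c hj
    · rw [ind_false hj, mul_zero]
      linarith [charge_nonneg (L := L) a b c, charge_nonneg (L := L) b c a,
        charge_nonneg (L := L) c a b]
  simp only [sum_add_distrib, h1, h2, h0] at h3
  have h4 : 6 / κ * cnt3 J = 6 * (cnt3 J / κ) := by ring
  have h5 : cnt3 J / κ ≤ cnt2 (fun a b => ∃ c, L a b c) := by linarith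
  rw [div_le_iff₀ hκ] at h5
  linarith

end Weights

section Ratio

variable {V : Type} [Fintype V] {E J : V → V → V → Prop} {t C : ℕ} {K : V → Finset V} {s : ℝ}

/-- The link of `a` in `J` outside the hitting set and the pairs of large codegree. -/
def RedLink (E J : V → V → V → Prop) (K : V → Finset V) (s : ℝ) (a b c : V) : Prop :=
  J a b c ∧ b ∉ K a ∧ c ∉ K a ∧ ¬ s ≤ (nb E a b).card ∧ ¬ s ≤ (nb E a c).card

theorem RedLink.symm (hJ : Sym3 J) {a b c : V} (h : RedLink E J K s a b c) :
    RedLink E J K s a c b :=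
  ⟨hJ.swap23 h.1, h.2.2.1, h.2.1, h.2.2.2.2, h.2.2.2.1⟩

theorem cnt1_redLink_le (hsub : ∀ a b c, J a b c → E a b c) (a b : V) :
    cnt1 (RedLink E J K s a b) ≤ (nb E a b).card :=
  cnt1_le_of_mem fun _ hc => mem_nb.2 (hsub _ _ _ hc.1)

theorem redLink_pos {a b c : V} (h : RedLink E J K s a b c) :
    0 < cnt1 (RedLink E J K s a b) := by
  unfold cnt1; exact_mod_cast card_pos.2 ⟨c, mem_filter.2 ⟨mem_univ _, h⟩⟩

/-- The middle pair of a path in the reduced link has small codegree. -/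
theorem RedLink.card_nb_le (hK : ∀ a, HitSet E t a (K a)) (hsub : ∀ a b c, J a b c → E a b c)
    {a b c x y : V} (h : RedLink E J K s a b c) (hx : RedLink E J K s a b x)
    (hy : RedLink E J K s a c y) (hxc : x ≠ c) (hyb : y ≠ b) (hxy : x ≠ y) :
    (nb E b c).card ≤ t + 2 := by
  by_contra! hc
  have : Quad E t a b c x y := by
    refine ⟨hsub _ _ _ h.1, hsub _ _ _ hx.1, hsub _ _ _ hy.1, hxc, hyb, hxy, ?_⟩
    have h1 := le_card_sdiff {a, x, y} (nb E b c)
    have h2 : ({a, x, y} : Finset V).card ≤ 3 := card_le_three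
    omega
  rcases hK a b c x y this with h' | h' | h' | h'
  exacts [h.2.1 h', h.2.2.1 h', hx.2.2.1 h', hy.2.2.1 h']

theorem cnt3_exceptional_arc_le (hKc : ∀ a, (K a).card ≤ C) (hJ : Sym3 J)
    (hsub : ∀ a b c, J a b c → E a b c) (hs : 0 ≤ s) :
    cnt3 (fun a b c => J a b c ∧
      (((b ∈ K a ∨ a ∈ K b) ∧ ¬ s ≤ (nb E a b).card) ∨
       ((c ∈ K a ∨ a ∈ K c) ∧ ¬ s ≤ (nb E a c).card) ∨
       ((c ∈ K b ∨ b ∈ K c) ∧ ¬ s ≤ (nb E b c).card))) ≤ 6 * s * C * Fintype.card V := by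
  refine (cnt3_pair_le hJ (Q := fun a b => (b ∈ K a ∨ a ∈ K b) ∧ ¬ s ≤ (nb E a b).card)).trans ?_
  have h1 : cnt3 (fun a b c => J a b c ∧ (b ∈ K a ∨ a ∈ K b) ∧ ¬ s ≤ (nb E a b).card) ≤
      s * cnt2 (fun a b => (b ∈ K a ∨ a ∈ K b) ∧ ¬ s ≤ (nb E a b).card) := by
    refine cnt3_le_mul (fun a b c h => h.2) fun a b h => ?_
    refine (cnt1_le_of_mem (K := nb E a b) fun c hc => mem_nb.2 (hsub _ _ _ hc.1)).trans ?_
    exact (not_le.1 h.2).le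
  have h2 : cnt2 (fun a b => (b ∈ K a ∨ a ∈ K b) ∧ ¬ s ≤ (nb E a b).card) ≤
      cnt2 (fun a b => b ∈ K a) + cnt2 (fun a b => a ∈ K b) :=
    cnt2_le_add fun a b h => h.1
  have h3 : cnt2 (fun a b => a ∈ K b) = cnt2 (fun a b => b ∈ K a) :=
    cnt2_swap fun a b => b ∈ K a
  have h4 : cnt2 (fun a b => b ∈ K a) ≤ Fintype.card V * (C : ℝ) :=
    cnt2_le_of_mem (K := K) (fun a => by exact_mod_cast hKc a) fun a b h => h
  nlinarith

theorem cnt3_two_heavy_le (hE : Sym3 E) (hK : ∀ a, HitSet E t a (K a)) (hKc : ∀ a, (K a).card ≤ C)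
    (hJ : Sym3 J) (hsub : ∀ a b c, J a b c → E a b c)
    (hJd : ∀ a b c, J a b c → t + 1 ≤ (nb E a b).card) (hs : C + t + 3 ≤ s) :
    cnt3 (fun a b c => J a b c ∧ s ≤ (nb E a b).card ∧ s ≤ (nb E a c).card) ≤
      2 * C * cnt2 (fun a b => s ≤ (nb E a b).card) := by
  have h1 : cnt3 (fun a b c => J a b c ∧ s ≤ (nb E a b).card ∧ s ≤ (nb E a c).card) ≤
      cnt3 (fun a b c => s ≤ (nb E a b).card ∧ c ∈ K a) +
        cnt3 (fun a b c => s ≤ (nb E a c).card ∧ b ∈ K a) := by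
    refine cnt3_le_add fun a b c ⟨h, hb, hc⟩ => ?_
    have hb' : C + t + 3 ≤ (nb E a b).card := by exact_mod_cast hs.trans hb
    have hc' : C + t + 3 ≤ (nb E a c).card := by exact_mod_cast hs.trans hc
    rcases (hK a).mem_or_mem hE (hKc a) (hsub _ _ _ h) (hJd _ _ _ (hJ.rot h)) hb' hc' with h' | h'
    exacts [.inr ⟨hc, h'⟩, .inl ⟨hb, h'⟩]
  have h2 : cnt3 (fun a b c => s ≤ (nb E a c).card ∧ b ∈ K a) =
      cnt3 (fun a b c => s ≤ (nb E a b).card ∧ c ∈ K a) :=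
    cnt3_swap23 fun a b c => s ≤ (nb E a b).card ∧ c ∈ K a
  have h3 : cnt3 (fun a b c => s ≤ (nb E a b).card ∧ c ∈ K a) ≤
      C * cnt2 (fun a b => s ≤ (nb E a b).card) := by
    refine cnt3_le_mul (fun a b c h => h.1) fun a b h => ?_
    refine (cnt1_le_of_mem (K := K a) fun c hc => hc.2).trans ?_
    exact_mod_cast hKc a
  linarith

theorem cnt3_le_redLink (hE : Sym3 E) (hK : ∀ a, HitSet E t a (K a)) (hKc : ∀ a, (K a).card ≤ C)
    (hJ : Sym3 J) (hsub : ∀ a b c, J a b c → E a b c)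
    (hJd : ∀ a b c, J a b c → t + 1 ≤ (nb E a b).card) (hs : C + t + 3 ≤ s)
    {κ : ℝ} (hκ : 6 ≤ κ) (hκt : t + 2 ≤ κ) :
    cnt3 J ≤ κ * cnt2 (fun a b => ∃ c, RedLink E J K s a b c) + 6 * s * C * Fintype.card V
      + 6 * C * cnt2 (fun a b => s ≤ (nb E a b).card) := by
  have hs0 : 0 ≤ s := le_trans (by positivity) hs
  have e1 := cnt3_exceptional_arc_le hKc hJ hsub hs0
  have e2 := cnt3_two_heavy_le hE hK hKc hJ hsub hJd hs
  have nbc := hE.nb_comm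
  set Γ : V → V → Prop := fun a b => s ≤ (nb E a b).card with hΓ
  have Γs : ∀ {a b}, Γ a b → Γ b a := fun {a b} h => by simp only [hΓ] at h ⊢; rwa [nbc]
  set X : V → V → V → Prop := fun a b c => J a b c ∧
      (((b ∈ K a ∨ a ∈ K b) ∧ ¬ Γ a b) ∨
       ((c ∈ K a ∨ a ∈ K c) ∧ ¬ Γ a c) ∨
       ((c ∈ K b ∨ b ∈ K c) ∧ ¬ Γ b c)) with hX
  set Y : V → V → V → Prop := fun a b c => J a b c ∧ Γ a b ∧ Γ a c with hY
  have hY1 : cnt3 (fun a b c => Y b a c) = cnt3 Y := cnt3_swap12 Y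
  have hY2 : cnt3 (fun a b c => Y c a b) = cnt3 Y := by
    rw [← hY1, ← cnt3_swap23]
  set J' : V → V → V → Prop := fun a b c =>
    J a b c ∧ ¬ X a b c ∧ ¬ Y a b c ∧ ¬ Y b a c ∧ ¬ Y c a b with hJ'
  have hsum : cnt3 J ≤ cnt3 J' + (cnt3 X + (cnt3 Y + (cnt3 Y + cnt3 Y))) := by
    have a1 : cnt3 J ≤ cnt3 J' + cnt3 (fun a b c => X a b c ∨ (Y a b c ∨ (Y b a c ∨ Y c a b))) :=
      cnt3_le_add fun a b c h => by
        by_cases h1 : X a b c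
        · exact .inr (.inl h1)
        by_cases h2 : Y a b c
        · exact .inr (.inr (.inl h2))
        by_cases h3 : Y b a c
        · exact .inr (.inr (.inr (.inl h3)))
        by_cases h4 : Y c a b
        · exact .inr (.inr (.inr (.inr h4)))
        exact .inl ⟨h, h1, h2, h3, h4⟩
    have a2 := cnt3_or X (fun a b c => Y a b c ∨ (Y b a c ∨ Y c a b))
    have a3 := cnt3_or Y (fun a b c => Y b a c ∨ Y c a b)
    have a4 := cnt3_or (fun a b c => Y b a c) (fun a b c => Y c a b)
    linarith
  have hL : ∀ {a b c}, RedLink E J K s a b c → RedLink E J K s a c b := RedLink.symm hJ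
  have hκ0 : 0 < κ := by linarith
  have h6 : 6 / κ ≤ 1 := by rw [div_le_one hκ0]; exact hκ
  have main : cnt3 J' ≤ κ * cnt2 (fun a b => ∃ c, RedLink E J K s a b c) := by
    refine cnt3_le_of_charge (L := RedLink E J K s) hL hκ0 ?_
    rintro a b c ⟨h, hx, hy1, hy2, hy3⟩
    have hx' : ∀ {a b c}, J a b c → ¬ X a b c → ¬ Γ a b → ¬ Γ a c → RedLink E J K s a b c := by
      intro a b c h hx h1 h2
      exact ⟨h, fun h' => hx ⟨h, .inl ⟨.inl h', h1⟩⟩, fun h' => hx ⟨h, .inr (.inl ⟨.inl h', h2⟩)⟩,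
        h1, h2⟩
    have Xrot : ∀ {a b c}, X b c a → X a b c := by
      intro a b c hh
      refine ⟨hJ.rot' hh.1, ?_⟩
      rcases hh.2 with ⟨h1, h2⟩ | ⟨h1, h2⟩ | ⟨h1, h2⟩
      · exact .inr (.inr ⟨h1, h2⟩)
      · exact .inl ⟨h1.symm, fun g => h2 (Γs g)⟩
      · exact .inr (.inl ⟨h1.symm, fun g => h2 (Γs g)⟩)
    have hJ2 : J b c a := hJ.rot h
    have hJ3 : J c a b := hJ.rot' h
    have hx2 : ¬ X b c a := fun h' => hx (Xrot h')
    have hx3 : ¬ X c a b := fun h' => hx2 (Xrot h')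
    have p1 := charge_nonneg (L := RedLink E J K s) a b c
    have p2 := charge_nonneg (L := RedLink E J K s) b c a
    have p3 := charge_nonneg (L := RedLink E J K s) c a b
    -- a pair of large codegree is not the middle of a path
    have heavy : ∀ {a b c}, RedLink E J K s a b c → Γ b c → 1 ≤ charge (RedLink E J K s) a b c := by
      intro a b c hl hg
      rw [charge_eq hl]
      refine one_le_inv_add_inv (L := RedLink E J K s) hL hl fun x y hx hy h1 h2 => ?_
      by_contra hxy
      have := hl.card_nb_le hK hsub hx hy h1 h2 hxy
      have h3 : (C : ℝ) + t + 3 ≤ (nb E b c).card := hs.trans hg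
      have h4 : C + t + 3 ≤ (nb E b c).card := by exact_mod_cast h3
      omega
    have mid : ∀ {a b c}, RedLink E J K s a b c →
        1 ≤ charge (RedLink E J K s) a b c ∨ (nb E b c).card ≤ t + 2 := by
      intro a b c hl
      by_cases hm : ∀ x y, RedLink E J K s a b x → RedLink E J K s a c y → x ≠ c → y ≠ b → x = y
      · left; rw [charge_eq hl]; exact one_le_inv_add_inv (L := RedLink E J K s) hL hl hm
      · right; push Not at hm
        obtain ⟨x, y, h1, h2, h3, h4, h5⟩ := hm
        exact hl.card_nb_le hK hsub h1 h2 h3 h4 h5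
    by_cases gab : Γ a b
    · have gac : ¬ Γ a c := fun g => hy1 ⟨h, gab, g⟩
      have gbc : ¬ Γ b c := fun g => hy2 ⟨hJ.swap12 h, Γs gab, g⟩
      have := heavy (hx' hJ3 hx3 (fun g => gac (Γs g)) (fun g => gbc (Γs g))) gab
      linarith
    by_cases gac : Γ a c
    · have gbc : ¬ Γ b c := fun g => hy3 ⟨hJ3, Γs gac, Γs g⟩
      have := heavy (hx' hJ2 hx2 gbc (fun g => gab (Γs g))) (Γs gac)
      linarith
    by_cases gbc : Γ b c
    · have := heavy (hx' h hx gab gac) gbc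
      linarith
    have l1 := hx' h hx gab gac
    have l2 := hx' hJ2 hx2 gbc (fun g => gab (Γs g))
    have l3 := hx' hJ3 hx3 (fun g => gac (Γs g)) (fun g => gbc (Γs g))
    rcases mid l1 with m1 | m1
    · linarith
    rcases mid l2 with m2 | m2
    · linarith
    rcases mid l3 with m3 | m3
    · linarith
    have inv : ∀ {a b c}, RedLink E J K s a b c → (nb E a b).card ≤ t + 2 →
        1 / κ ≤ (cnt1 (RedLink E J K s a b))⁻¹ := by
      intro a b c hl hd
      rw [one_div]
      refine inv_anti₀ (redLink_pos hl) ((cnt1_redLink_le hsub a b).trans (le_trans ?_ hκt))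
      exact_mod_cast hd
    rw [charge_eq l1, charge_eq l2, charge_eq l3]
    have i1 := inv l1 m3
    have i2 := inv (hL l1) (by rw [nbc]; exact m2)
    have i3 := inv l2 m1
    have i4 := inv (hL l2) (by rw [nbc]; exact m3)
    have i5 := inv l3 m2
    have i6 := inv (hL l3) (by rw [nbc]; exact m1)
    have : 6 / κ = 6 * (1 / κ) := by ring
    linarith
  linarith

theorem FanFree.mul_cnt2_le (hE : Sym3 E) (hF : FanFree E t) :
    s * cnt2 (fun a b => s ≤ (nb E a b).card) ≤ 3 * peelDeg t * (Fintype.card V : ℝ) ^ 2 := by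
  have h1 : s * cnt2 (fun a b => s ≤ (nb E a b).card) ≤ cnt3 E := by
    refine mul_cnt2_le_cnt3 fun a b h => ?_
    rw [cnt1_eq_card_nb]; exact h
  have h2 := hF.cnt3_le_shadow hE hE fun _ _ _ h => h
  have h3 := cnt2_le_sq fun a b => ∃ c, E a b c
  have : (0 : ℝ) ≤ peelDeg t := Nat.cast_nonneg _
  nlinarith

end Ratio

theorem exists_ratio (t C : ℕ) {κ ε : ℝ} (hκ : 6 ≤ κ) (hκt : t + 2 ≤ κ) (hε : 0 < ε) :
    ∃ η > 0, η ≤ ε ∧ ∃ N : ℝ, ∀ (V : Type) [Fintype V] (E J : V → V → V → Prop) (K : V → Finset V),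
      N ≤ (Fintype.card V : ℝ) → Sym3 E → FanFree E t → (∀ a, HitSet E t a (K a)) →
      (∀ a, (K a).card ≤ C) → Sym3 J → (∀ a b c, J a b c → E a b c) →
      (∀ a b c, J a b c → t + 1 ≤ (nb E a b).card) →
      cnt3 J ≤ κ * cnt2 (fun a b => ∃ c, RedLink E J K (η * Fintype.card V) a b c)
        + ε * (Fintype.card V : ℝ) ^ 2 := by
  set η : ℝ := ε / (12 * C + 12) with hη
  have hη0 : 0 < η := by positivity
  refine ⟨η, hη0, ?_, max 1 (max ((C + t + 3) / η) (36 * C * peelDeg t / (ε * η))), ?_⟩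
  · rw [hη]; exact div_le_self hε.le (by linarith [(Nat.cast_nonneg C : (0 : ℝ) ≤ C)])
  intro V _ E J K hn hE hF hK hKc hJ hsub hJd
  obtain ⟨hn1, hn2⟩ := max_le_iff.1 hn
  obtain ⟨hn2, hn3⟩ := max_le_iff.1 hn2
  set n : ℝ := (Fintype.card V : ℝ) with hnn
  have hn0 : 0 < n := by linarith
  rw [div_le_iff₀ hη0] at hn2
  rw [div_le_iff₀ (by positivity)] at hn3
  have h1 := cnt3_le_redLink (s := η * n) hE hK hKc hJ hsub hJd (by linarith) hκ hκt
  have h2 := hF.mul_cnt2_le hE (s := η * n)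
  rw [← hnn] at h1 h2
  set G := cnt2 (fun a b => η * n ≤ (nb E a b).card)
  have h3 : 6 * (η * n) * C * n ≤ ε / 2 * n ^ 2 := by
    have : 6 * η * C ≤ ε / 2 := by
      rw [hη, mul_div_assoc', div_mul_eq_mul_div, div_le_div_iff₀ (by positivity) (by norm_num)]
      nlinarith
    nlinarith [mul_le_mul_of_nonneg_right this (sq_nonneg n)]
  have h4 : 6 * C * G ≤ ε / 2 * n ^ 2 := by
    have h5 : η * G ≤ 3 * peelDeg t * n := by nlinarith
    have hC0 : (0 : ℝ) ≤ C := Nat.cast_nonneg _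
    have h6 : η * (6 * C * G) ≤ η * (ε / 2 * n ^ 2) := by
      calc η * (6 * C * G) = 6 * C * (η * G) := by ring
        _ ≤ 6 * C * (3 * peelDeg t * n) := by gcongr
        _ = (36 * C * peelDeg t) * n / 2 := by ring
        _ ≤ (n * (ε * η)) * n / 2 := by gcongr
        _ = _ := by ring
    exact le_of_mul_le_mul_left h6 hη0
  linarith

end FanTuran

namespace FanTuran

open Finset
open scoped Classical

section PairCounting

variable {V : Type} [Fintype V] {F : V → V → V → Prop} {R : V → V → Prop}

/-- At least two of the three pairs satisfy `R`. -/
def Multi (R : V → V → Prop) (a b c : V) : Prop :=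
  (R a b ∧ R a c) ∨ (R a b ∧ R b c) ∨ (R a c ∧ R b c)

theorem cnt3_some_add_multi_le (hF : Sym3 F) :
    cnt3 (fun a b c => F a b c ∧ (R a b ∨ R a c ∨ R b c)) +
      cnt3 (fun a b c => F a b c ∧ Multi R a b c) ≤ 3 * cnt3 (fun a b c => F a b c ∧ R a b) := by
  have h1 : cnt3 (fun a b c => F a b c ∧ R a c) = cnt3 (fun a b c => F a b c ∧ R a b) := by
    rw [← cnt3_swap23]; congr; ext a b c; exact ⟨fun h => ⟨hF.swap23 h.1, h.2⟩, fun h => ⟨hF.swap23 h.1, h.2⟩⟩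
  have h2 : cnt3 (fun a b c => F a b c ∧ R b c) = cnt3 (fun a b c => F a b c ∧ R a b) := by
    rw [← h1, ← cnt3_swap12]; congr; ext a b c; exact ⟨fun h => ⟨hF.swap12 h.1, h.2⟩, fun h => ⟨hF.swap12 h.1, h.2⟩⟩
  have h3 : cnt3 (fun a b c => F a b c ∧ (R a b ∨ R a c ∨ R b c)) +
      cnt3 (fun a b c => F a b c ∧ Multi R a b c) ≤ cnt3 (fun a b c => F a b c ∧ R a b) +
      cnt3 (fun a b c => F a b c ∧ R a c) + cnt3 (fun a b c => F a b c ∧ R b c) := by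
    simp only [cnt3_eq_sum, ← sum_add_distrib]
    refine sum_le_sum fun a _ => sum_le_sum fun b _ => sum_le_sum fun c _ => ?_
    unfold ind Multi
    by_cases h : F a b c <;> by_cases h1 : R a b <;> by_cases h2 : R a c <;>
      by_cases h3 : R b c <;> simp [h, h1, h2, h3]
  linarith

end PairCounting

section VertexBound

variable {V : Type} [Fintype V] {E J : V → V → V → Prop} {t C : ℕ} {K : V → Finset V}

theorem cnt2_link_le (hE : Sym3 E) (hK : ∀ a, HitSet E t a (K a)) (hKc : ∀ a, (K a).card ≤ C)
    (hJ : Sym3 J) (hsub : ∀ a b c, J a b c → E a b c)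
    (hJd : ∀ a b c, J a b c → t + 1 ≤ (nb E a b).card) (u : V) :
    cnt2 (J u) ≤ (4 * C + 2 * t + 6) * Fintype.card V := by
  set D : ℝ := C + t + 3 with hD
  have h1 : cnt2 (J u) ≤ cnt2 (fun a b => J u a b ∧ ((nb E u a).card < D ∨ b ∈ K u)) +
      cnt2 (fun a b => J u a b ∧ ((nb E u b).card < D ∨ a ∈ K u)) := by
    refine cnt2_le_add fun a b h => ?_
    by_cases ha : ((nb E u a).card : ℝ) < D
    · exact .inl ⟨h, .inl ha⟩
    by_cases hb : ((nb E u b).card : ℝ) < D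
    · exact .inr ⟨h, .inl hb⟩
    rw [not_lt, hD] at ha hb
    rcases (hK u).mem_or_mem hE (hKc u) (hsub _ _ _ h) (hJd _ _ _ (hJ.rot h))
      (by exact_mod_cast ha) (by exact_mod_cast hb) with h' | h'
    exacts [.inr ⟨h, .inr h'⟩, .inl ⟨h, .inr h'⟩]
  have h2 : cnt2 (fun a b => J u a b ∧ ((nb E u b).card < D ∨ a ∈ K u)) ≤
      cnt2 (fun a b => J u a b ∧ ((nb E u a).card < D ∨ b ∈ K u)) := by
    rw [← cnt2_swap]; exact cnt2_mono fun a b h => ⟨hJ.swap23 h.1, h.2⟩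
  have h3 : cnt2 (fun a b => J u a b ∧ ((nb E u a).card < D ∨ b ∈ K u)) ≤
      ∑ _a : V, (D + C) := by
    refine sum_le_sum fun a _ => ?_
    refine (cnt1_le_add (q := fun b => J u a b ∧ (nb E u a).card < D) (r := fun b => b ∈ K u)
      fun b h => by tauto).trans (add_le_add ?_ ?_)
    · by_cases ha : ((nb E u a).card : ℝ) < D
      · exact (cnt1_le_of_mem fun b hb => mem_nb.2 (hsub _ _ _ hb.1)).trans ha.le
      · exact (cnt1_le_zero fun b hb => ha hb.2).trans (by positivity)
    · rw [cnt1_mem]; exact_mod_cast hKc u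
  simp only [sum_const, card_univ, nsmul_eq_mul] at h3
  rw [hD] at h3
  linarith

end VertexBound

section Bad

variable {V : Type}

theorem exists_representatives_or_sum {k : ℕ} (S : Fin k → Finset V) :
    (∃ f : Fin k → V, Function.Injective f ∧ ∀ i, f i ∈ S i) ∨
      1 ≤ ∑ i, (((S i).card : ℝ) + 1)⁻¹ := by
  by_contra! hc
  obtain ⟨h1, h2⟩ := hc
  have h3 : ¬ ∀ s : Finset (Fin k), s.card ≤ (s.biUnion S).card := fun h =>
    let ⟨f, hf, hfS⟩ := (Finset.all_card_le_biUnion_card_iff_exists_injective S).1 h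
    let ⟨i, hi⟩ := h1 f hf
    hi (hfS i)
  push Not at h3
  obtain ⟨s, hs⟩ := h3
  have hs0 : (0 : ℝ) < s.card := by exact_mod_cast (Nat.zero_le _).trans_lt hs
  have h4 : ∑ _i ∈ s, (s.card : ℝ)⁻¹ ≤ ∑ i ∈ s, (((S i).card : ℝ) + 1)⁻¹ := by
    refine sum_le_sum fun i hi => inv_anti₀ (by positivity) ?_
    have := card_le_card (subset_biUnion_of_mem S hi)
    exact_mod_cast (by omega : (S i).card + 1 ≤ s.card)
  have h5 : ∑ i ∈ s, (((S i).card : ℝ) + 1)⁻¹ ≤ ∑ i, (((S i).card : ℝ) + 1)⁻¹ :=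
    sum_le_univ_sum_of_nonneg fun i => by positivity
  rw [sum_const, nsmul_eq_mul, mul_inv_cancel₀ hs0.ne'] at h4
  linarith

/-- The three pairs of `a b c` extend to distinct further edges. -/
def Extends (J : V → V → V → Prop) (a b c : V) : Prop :=
  ∃ x y z, J a b z ∧ J a c y ∧ J b c x ∧ z ≠ c ∧ y ≠ b ∧ x ≠ a ∧ x ≠ y ∧ x ≠ z ∧ y ≠ z

theorem Extends.swap12 {J : V → V → V → Prop} (hJ : Sym3 J) {a b c : V} (h : Extends J a b c) :
    Extends J b a c := by
  obtain ⟨x, y, z, h1, h2, h3, h4, h5, h6, h7, h8, h9⟩ := h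
  exact ⟨y, x, z, hJ.swap12 h1, h3, h2, h4, h6, h5, h7.symm, h9, h8⟩

theorem Extends.swap23 {J : V → V → V → Prop} (hJ : Sym3 J) {a b c : V} (h : Extends J a b c) :
    Extends J a c b := by
  obtain ⟨x, y, z, h1, h2, h3, h4, h5, h6, h7, h8, h9⟩ := h
  exact ⟨x, z, y, h2, h1, hJ.swap12 h3, h5, h4, h6, h8, h7, h9.symm⟩

theorem cnt3_not_extends_le [Fintype V] {J : V → V → V → Prop} (hJ : Sym3 J) :
    cnt3 (fun a b c => J a b c ∧ ¬ Extends J a b c) ≤ 3 * cnt2 (fun a b => ∃ c, J a b c) := by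
  have h0 : ∑ a, ∑ b, ∑ c, ind (J a b c) * (cnt1 (J a b))⁻¹ = cnt2 (fun a b => ∃ c, J a b c) :=
    sum_congr rfl fun a _ => sum_ind_mul_inv (L := J) a
  have h1 : ∑ a, ∑ b, ∑ c, ind (J a b c) * (cnt1 (J a c))⁻¹ = cnt2 (fun a b => ∃ c, J a b c) := by
    rw [← h0]
    refine sum_congr rfl fun a _ => ?_
    rw [sum_comm]
    refine sum_congr rfl fun b _ => sum_congr rfl fun c _ => ?_
    have : J a c b = J a b c := propext ⟨hJ.swap23, hJ.swap23⟩
    rw [this]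
  have h2 : ∑ a, ∑ b, ∑ c, ind (J a b c) * (cnt1 (J b c))⁻¹ = cnt2 (fun a b => ∃ c, J a b c) := by
    rw [← h1, sum_comm]
    refine sum_congr rfl fun b _ => sum_congr rfl fun a _ => sum_congr rfl fun c _ => ?_
    have : J a b c = J b a c := propext ⟨hJ.swap12, hJ.swap12⟩
    rw [this]
  have h3 : cnt3 (fun a b c => J a b c ∧ ¬ Extends J a b c) ≤
      ∑ a, ∑ b, ∑ c, (ind (J a b c) * (cnt1 (J a b))⁻¹ + ind (J a b c) * (cnt1 (J a c))⁻¹ +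
        ind (J a b c) * (cnt1 (J b c))⁻¹) := by
    rw [cnt3_eq_sum]
    refine sum_le_sum fun a _ => sum_le_sum fun b _ => sum_le_sum fun c _ => ?_
    have p : ∀ a b, 0 ≤ (cnt1 (J a b))⁻¹ := fun a b => inv_nonneg.2 (cnt1_nonneg _)
    by_cases h : J a b c ∧ ¬ Extends J a b c
    · obtain ⟨h, hn⟩ := h
      rw [ind_true ⟨h, hn⟩, ind_true h, one_mul, one_mul, one_mul]
      have e : ∀ {a b c}, J a b c → cnt1 (J a b) = (((nb J a b).erase c).card : ℝ) + 1 := by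
        intro a b c h
        rw [cnt1_eq_card_nb, ← card_erase_add_one (mem_nb.2 h)]; push_cast; rfl
      rw [e h, e (hJ.swap23 h), e (hJ.rot h)]
      rcases exists_representatives_or_sum
        ![(nb J a b).erase c, (nb J a c).erase b, (nb J b c).erase a] with ⟨f, hf, hfS⟩ | hs
      · refine absurd ⟨f 2, f 1, f 0, ?_⟩ hn
        have f0 := hfS 0
        have f1 := hfS 1
        have f2 := hfS 2
        simp only [Matrix.cons_val, mem_erase, mem_nb] at f0 f1 f2
        exact ⟨f0.2, f1.2, f2.2, f0.1, f1.1, f2.1, hf.ne (by decide), hf.ne (by decide),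
          hf.ne (by decide)⟩
      · simpa [Fin.sum_univ_three] using hs
    · rw [ind_false h]
      have := ind_nonneg (J a b c)
      have p1 := p a b
      have p2 := p a c
      have p3 := p b c
      positivity
  simp only [sum_add_distrib, h0, h1, h2] at h3
  linarith

end Bad

section GenericPairs

variable {V : Type} {E : V → V → V → Prop} {L : V → V → Prop} {a : V} {Q : Finset V} {s : ℝ}

theorem FanFree.mem_of_petal (hE : Sym3 E) (hF : FanFree E 2) (hQ : IsCPetal E a Q)
    {b c x y z : V} (h1 : E a b x) (h2 : E a c y) (h3 : E b c z) (hxc : x ≠ c) (hyb : y ≠ b)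
    (hxy : x ≠ y) (hb : b ∉ Q) (hc : c ∉ Q) (hx : x ∉ Q) (hy : y ∉ Q) :
    z ∈ Q ∨ z = a ∨ z = x ∨ z = y := by
  by_contra! hz
  have hp := isPetal_mk hE h1 h2 h3 hxc hyb hxy hz.2.2.1 hz.2.2.2 hz.2.1
  have hd : Disjoint Q {b, c, x, y, z} := by
    simp [disjoint_right, hb, hc, hx, hy, hz.1]
  refine hF ⟨a, ![Q, {b, c, x, y, z}], ?_, ?_, ?_⟩
  · intro i j hij
    fin_cases i <;> fin_cases j
    · exact absurd rfl hij
    · exact hd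
    · exact hd.symm
    · exact absurd rfl hij
  · intro j
    fin_cases j
    exacts [hQ.isPetal, hp]
  · intro j hj
    fin_cases j
    · exact hQ
    · norm_num at hj

theorem exists_generic_pairs [Fintype V] (hE : Sym3 E) (hF : FanFree E 2) (hQ : IsCPetal E a Q)
    (hLs : ∀ b c, L b c → L c b) (hL : ∀ b c, L b c → E a b c ∧ b ∉ Q)
    (hs : ∀ b, cnt1 (L b) ≤ s) :
    ∃ R : V → V → Prop, (∀ b c, R b c → R c b) ∧
      cnt1 (fun b => ∃ c, L b c) ^ 2 ≤
        cnt2 R + 3 * Fintype.card V + Fintype.card V * s ∧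
      cnt3 (fun b c z => E b c z ∧ (R b c ∨ R b z ∨ R c z)) ≤
        3 * cnt2 R + 3 * Fintype.card V * (1 + s) +
          3 * cnt3 (fun b c z => E b c z ∧ b ∈ insert a Q) := by
  have : ∀ b, ∃ x, (∃ c, L b c) → L b x := fun b => by
    by_cases h : ∃ c, L b c
    · exact ⟨h.choose, fun _ => h.choose_spec⟩
    · exact ⟨a, fun h' => absurd h' h⟩
  choose x hx using this
  set P : V → Prop := fun b => ∃ c, L b c with hP
  set n : ℝ := (Fintype.card V : ℝ) with hn
  set R : V → V → Prop := fun b c => P b ∧ P c ∧ b ≠ c ∧ x b ≠ c ∧ x c ≠ b ∧ x b ≠ x c with hR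
  have hRs : ∀ b c, R b c → R c b := fun b c ⟨h1, h2, h3, h4, h5, h6⟩ =>
    ⟨h2, h1, h3.symm, h5, h4, h6.symm⟩
  have hLx : ∀ b, P b → ∀ c, P c → x b = x c → L (x b) c := fun b hb c hc h => by
    rw [h]; exact hLs _ _ (hx c hc)
  have hconst : ∀ C : ℝ, ∑ _b : V, C = n * C := fun C => by simp [hn]
  refine ⟨R, hRs, ?_, ?_⟩
  · have e1 : cnt1 P ^ 2 = cnt2 (fun b c => P b ∧ P c) := by
      have : ∀ b, cnt1 (fun c => P b ∧ P c) = ind (P b) * cnt1 P := by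
        intro b
        by_cases h : P b
        · rw [ind_true h, one_mul]; simp [h]
        · rw [ind_false h, zero_mul]; simp [h, cnt1_false]
      simp only [cnt2, this]
      rw [← sum_mul, ← cnt1_eq_sum, sq]
    have e2 : cnt2 (fun b c => P b ∧ P c) ≤ cnt2 R + cnt2 (fun b c => b = c ∨ (x b = c ∨
        (x c = b ∨ (P b ∧ P c ∧ x b = x c)))) :=
      cnt2_le_add fun b c h => by simp only [hR]; tauto
    have f0 := cnt2_or (fun b c : V => b = c) (fun b c => x b = c ∨
        (x c = b ∨ (P b ∧ P c ∧ x b = x c)))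
    have f1 := cnt2_or (fun b c : V => x b = c) (fun b c =>
        (x c = b ∨ (P b ∧ P c ∧ x b = x c)))
    have f2 := cnt2_or (fun b c : V => x c = b) (fun b c => (P b ∧ P c ∧ x b = x c))
    have g0 : cnt2 (fun b c : V => b = c) ≤ n * 1 := by
      rw [← hconst]; exact sum_le_sum fun b _ => (cnt1_mono fun c h => h.symm).trans (cnt1_eq_one b).le
    have g1 : cnt2 (fun b c : V => x b = c) ≤ n * 1 := by
      rw [← hconst]; exact sum_le_sum fun b _ => (cnt1_mono fun c h => h.symm).trans (cnt1_eq_one (x b)).le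
    have g2 : cnt2 (fun b c : V => x c = b) = cnt2 (fun b c : V => x b = c) :=
      cnt2_swap (fun b c : V => x b = c)
    have g3 : cnt2 (fun b c => (P b ∧ P c ∧ x b = x c)) ≤ n * s := by
      rw [← hconst]
      refine sum_le_sum fun b _ => (cnt1_mono fun c h => ?_).trans (hs (x b))
      exact hLx b h.1 c h.2.1 h.2.2
    linarith
  · set F : V → V → V → Prop := fun b c z =>
      E b c z ∧ b ∉ insert a Q ∧ c ∉ insert a Q ∧ z ∉ insert a Q with hFd
    have hFs : Sym3 F := by
      refine ⟨fun h => ⟨hE.swap12 h.1, h.2.2.1, h.2.1, h.2.2.2⟩,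
        fun h => ⟨hE.swap23 h.1, h.2.1, h.2.2.2, h.2.2.1⟩, fun h => hE.ne12 h.1⟩
    have hFx : ∀ b c z, F b c z → R b c → z = x b ∨ z = x c := by
      intro b c z h ⟨h1, h2, h3, h4, h5, h6⟩
      have l1 := hL _ _ (hx b h1)
      have l2 := hL _ _ (hx c h2)
      have l3 := hL _ _ (hLs _ _ (hx b h1))
      have l4 := hL _ _ (hLs _ _ (hx c h2))
      have h7 := h.2.2.2
      rw [mem_insert, not_or] at h7
      have := hF.mem_of_petal hE hQ l1.1 l2.1 h.1 h4 h5 h6 l1.2 l2.2 l3.2 l4.2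
      tauto
    have c1 : cnt3 (fun b c z => E b c z ∧ (R b c ∨ R b z ∨ R c z)) ≤
        cnt3 (fun b c z => F b c z ∧ (R b c ∨ R b z ∨ R c z)) +
        cnt3 (fun b c z => E b c z ∧ (b ∈ insert a Q ∨ c ∈ insert a Q ∨ z ∈ insert a Q)) :=
      cnt3_le_add fun b c z h => by
        by_cases hq : b ∈ insert a Q ∨ c ∈ insert a Q ∨ z ∈ insert a Q
        · exact .inr ⟨h.1, hq⟩
        · simp only [not_or] at hq
          exact .inl ⟨⟨h.1, hq⟩, h.2⟩
    have c2 := cnt3_vertex_le hE (q := fun b => b ∈ insert a Q)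
    have c3 := cnt3_some_add_multi_le hFs (R := R)
    have c4 : cnt3 (fun b c z => F b c z ∧ R b c) ≤ 2 * cnt2 R := by
      refine cnt3_le_mul (fun b c z h => h.2) fun b c h => ?_
      refine (cnt1_le_of_mem (K := {x b, x c}) fun z hz => ?_).trans ?_
      · simpa using hFx b c z hz.1 hz.2
      · exact_mod_cast card_le_two
    set O : V → V → V → Prop := fun b c z => F b c z ∧ R b c ∧ ¬ R b z ∧ ¬ R c z with hO
    have c5 : cnt3 (fun b c z => F b c z ∧ (R b c ∨ R b z ∨ R c z)) ≤
        cnt3 (fun b c z => F b c z ∧ Multi R b c z) +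
        (cnt3 O + (cnt3 (fun b c z => O b z c) + cnt3 (fun b c z => O c z b))) := by
      have d1 := cnt3_or (fun b c z => O b z c) (fun b c z => O c z b)
      have d2 := cnt3_or O (fun b c z => O b z c ∨ O c z b)
      refine (cnt3_le_add (R := fun b c z => O b c z ∨ (O b z c ∨ O c z b)) ?_).trans
        (add_le_add le_rfl (d2.trans (add_le_add le_rfl d1)))
      rintro b c z ⟨h, hr⟩
      have s1 : R b c ↔ R c b := ⟨hRs _ _, hRs _ _⟩
      have s2 : R b z ↔ R z b := ⟨hRs _ _, hRs _ _⟩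
      have s3 : R c z ↔ R z c := ⟨hRs _ _, hRs _ _⟩
      have t1 := hFs.swap23 h
      have t2 := hFs.rot h
      simp only [hO, Multi]
      clear_value R F
      tauto
    have c6 : cnt3 (fun b c z => O b z c) = cnt3 O := cnt3_swap23 O
    have c7 : cnt3 (fun b c z => O c z b) = cnt3 O := by
      rw [← c6, ← cnt3_swap12]
    have c8 : cnt3 O ≤ 2 * (n * (1 + s)) := by
      have d1 : cnt3 O ≤ cnt3 (fun b c z => O b c z ∧ z = x b) + cnt3 (fun b c z => O b c z ∧ z = x c) :=
        cnt3_le_add fun b c z h => by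
          rcases hFx b c z h.1 h.2.1 with h' | h'
          exacts [.inl ⟨h, h'⟩, .inr ⟨h, h'⟩]
      have d2 : cnt3 (fun b c z => O b c z ∧ z = x c) ≤ cnt3 (fun b c z => O b c z ∧ z = x b) := by
        rw [← cnt3_swap12]
        exact cnt3_mono fun b c z ⟨⟨h1, h2, h3, h4⟩, h5⟩ => ⟨⟨hFs.swap12 h1, hRs _ _ h2, h4, h3⟩, h5⟩
      have d3 : cnt3 (fun b c z => O b c z ∧ z = x b) ≤
          1 * cnt2 (fun b c => c = x (x b) ∨ L (x (x b)) c) := by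
        refine cnt3_le_mul ?_ fun b c _ => ?_
        · rintro b c z ⟨⟨h1, h2, h3, h4⟩, rfl⟩
          obtain ⟨p1, p2, p3, p4, p5, p6⟩ := h2
          have pz : P (x b) := ⟨b, hLs _ _ (hx b p1)⟩
          have : x (x b) = c ∨ x (x b) = x c := by
            by_contra! hcon
            exact h4 ⟨p2, pz, p4.symm, p6.symm, hcon.1, hcon.2.symm⟩
          rcases this with h | h
          · exact .inl h.symm
          · exact .inr (hLx _ pz c p2 h)
        · exact (cnt1_mono fun z h => h.2).trans (cnt1_eq_one (x b)).le
      have d4 : cnt2 (fun b c => c = x (x b) ∨ L (x (x b)) c) ≤ n * (1 + s) := by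
        rw [← hconst]
        exact sum_le_sum fun b _ => (cnt1_or _ _).trans
          (add_le_add (cnt1_eq_one _).le (hs _))
      linarith
    linarith

end GenericPairs

end FanTuran

namespace FanTuran

open Finset
open scoped Classical

section TwoFan

theorem FanFree.cnt1_redLink_le {V : Type} [Fintype V] {E J : V → V → V → Prop} {Q K : V → Finset V}
    {η σ ρ : ℝ} (hE : Sym3 E) (hF : FanFree E 2) (hJ : Sym3 J)
    (hsub : ∀ a b c, J a b c → E a b c)
    (hn : 12 ≤ 12 * σ * (Fintype.card V : ℝ)) (hη : 0 ≤ η) (hησ : η ≤ σ)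
    (hσ : 38 * σ < 3 * ρ ^ 2) (hρ : 0 ≤ ρ)
    (hcnt : (6 - σ) * (Fintype.card V : ℝ) ^ 2 ≤ cnt3 E)
    (hratio : ∀ J' : V → V → V → Prop, Sym3 J' → (∀ a b c, J' a b c → E a b c) →
      (∀ a b c, J' a b c → 3 ≤ (nb E a b).card) →
      cnt3 J' ≤ 6 * cnt2 (fun a b => ∃ c, RedLink E J' K (η * Fintype.card V) a b c)
        + σ * (Fintype.card V : ℝ) ^ 2)
    (hQc : ∀ a, (Q a).card ≤ 5) (hQK : ∀ a, Q a ⊆ K a)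
    (hQ : ∀ a b c, J a b c → IsCPetal E a (Q a) ∧
      ∀ v ∈ insert a (Q a), cnt2 (E v) ≤ σ * (Fintype.card V : ℝ) ^ 2) (a : V) :
    cnt1 (fun b => ∃ c, RedLink E J K (η * Fintype.card V) a b c) ≤ ρ * Fintype.card V := by
  by_contra! hp
  set n : ℝ := (Fintype.card V : ℝ) with hnn
  have hn0 : 0 ≤ n := Nat.cast_nonneg _
  obtain ⟨b, c, hbc⟩ : ∃ b c, RedLink E J K (η * n) a b c := by
    by_contra! hne
    have := cnt1_le_zero (p := fun b => ∃ c, RedLink E J K (η * n) a b c)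
      fun b ⟨c, hc⟩ => hne b c hc
    have : 0 ≤ ρ * n := by positivity
    linarith
  obtain ⟨hQa, hQU⟩ := hQ _ _ _ hbc.1
  obtain ⟨R, hRs, hR1, hR2⟩ := exists_generic_pairs (L := fun b c => RedLink E J K (η * n) a b c)
    (s := η * n) hE hF hQa (fun b c h => h.symm hJ)
    (fun b c h => ⟨hsub _ _ _ h.1, fun h' => h.2.1 (hQK a h')⟩) (fun b => by
      by_cases h : ∃ c, RedLink E J K (η * n) a b c
      · obtain ⟨c, hc⟩ := h
        refine (FanTuran.cnt1_redLink_le hsub a b).trans (not_le.1 hc.2.2.2.1).le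
      · push Not at h
        exact (cnt1_le_zero h).trans (by positivity))
  rw [← hnn] at hR1 hR2
  have e1 : cnt3 (fun b c z => E b c z ∧ b ∈ insert a (Q a)) ≤ 6 * (σ * n ^ 2) := by
    have h1 : cnt3 (fun b c z => E b c z ∧ b ∈ insert a (Q a)) ≤
        (σ * n ^ 2) * cnt1 (fun b => b ∈ insert a (Q a)) :=
      cnt3_le_mul1 (fun b c z h => h.2) fun v hv =>
        (cnt2_mono fun c z h => h.1).trans (hQU v hv)
    have h2 : cnt1 (fun b => b ∈ insert a (Q a)) ≤ 6 := by
      rw [cnt1_mem]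
      have := (card_insert_le a (Q a)).trans (Nat.add_le_add_right (hQc a) 1)
      exact_mod_cast this
    have h3 : 0 ≤ σ * n ^ 2 := mul_nonneg (by linarith) (sq_nonneg n)
    nlinarith
  set lo : V → V → Prop := fun a b => ¬ 3 ≤ (nb E a b).card with hlo
  have hlos : ∀ a b, lo a b → lo b a := fun a b h => by
    simp only [hlo] at h ⊢; rwa [hE.nb_comm]
  set J' : V → V → V → Prop := fun a b c =>
    E a b c ∧ ¬ (R a b ∨ R a c ∨ R b c) ∧ ¬ (lo a b ∨ lo a c ∨ lo b c) with hJ'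
  have hJ's : Sym3 J' := by
    refine ⟨fun {a b c} h => ⟨hE.swap12 h.1, fun h' => h.2.1 ?_, fun h' => h.2.2 ?_⟩,
      fun {a b c} h => ⟨hE.swap23 h.1, fun h' => h.2.1 ?_, fun h' => h.2.2 ?_⟩,
      fun h => hE.ne12 h.1⟩
    · have := hRs b a; tauto
    · have := hlos b a; tauto
    · have := hRs c b; tauto
    · have := hlos c b; tauto
  have e2 := hratio J' hJ's (fun a b c h => h.1) fun a b c h => by
    by_contra hc; exact h.2.2 (.inl hc)
  have e3 : cnt2 (fun a b => ∃ c, RedLink E J' K (η * n) a b c) ≤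
      cnt2 (fun a b => ¬ lo a b ∧ ¬ R a b) :=
    cnt2_mono fun a b ⟨c, hc⟩ => ⟨fun h => hc.1.2.2 (.inl h), fun h => hc.1.2.1 (.inl h)⟩
  have e4 : cnt3 (fun a b c => E a b c ∧ ((lo a b ∧ ¬ R a b) ∨ (lo a c ∧ ¬ R a c) ∨
      (lo b c ∧ ¬ R b c))) ≤ 3 * (2 * cnt2 (fun a b => lo a b ∧ ¬ R a b)) := by
    refine (cnt3_pair_le hE (Q := fun a b => lo a b ∧ ¬ R a b)).trans
      (mul_le_mul_of_nonneg_left ?_ (by norm_num))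
    refine cnt3_le_mul (fun a b c h => h.2) fun a b h => ?_
    refine (cnt1_mono fun c h => h.1).trans ?_
    rw [cnt1_eq_card_nb]
    have : (nb E a b).card ≤ 2 := by have := h.1; simp only [hlo] at this; omega
    exact_mod_cast this
  have e5 : cnt3 E ≤ cnt3 (fun a b c => E a b c ∧ (R a b ∨ R a c ∨ R b c)) +
      cnt3 (fun a b c => (E a b c ∧ ((lo a b ∧ ¬ R a b) ∨ (lo a c ∧ ¬ R a c) ∨
      (lo b c ∧ ¬ R b c))) ∨ J' a b c) := by
    refine cnt3_le_add fun a b c h => ?_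
    by_cases h1 : R a b ∨ R a c ∨ R b c
    · exact .inl ⟨h, h1⟩
    by_cases h2 : lo a b ∨ lo a c ∨ lo b c
    · refine .inr (.inl ⟨h, ?_⟩)
      simp only [not_or] at h1
      rcases h2 with h2 | h2 | h2
      exacts [.inl ⟨h2, h1.1⟩, .inr (.inl ⟨h2, h1.2.1⟩), .inr (.inr ⟨h2, h1.2.2⟩)]
    · exact .inr (.inr ⟨h, h1, h2⟩)
  have e6 := cnt3_or (fun a b c => E a b c ∧ ((lo a b ∧ ¬ R a b) ∨ (lo a c ∧ ¬ R a c) ∨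
      (lo b c ∧ ¬ R b c))) J'
  have e7 : cnt2 (fun a b => lo a b ∧ ¬ R a b) + cnt2 (fun a b => ¬ lo a b ∧ ¬ R a b) ≤
      cnt2 (fun a b => ¬ R a b) :=
    cnt2_add_le (fun a b h => h.2) (fun a b h => h.2) fun a b h h' => h'.1 h.1
  have e8 : cnt2 R + cnt2 (fun a b => ¬ R a b) ≤ cnt2 (fun _ _ : V => True) :=
    cnt2_add_le (fun a b h => trivial) (fun a b h => trivial) fun a b h h' => h' h
  have e9 := cnt2_le_sq fun _ _ : V => True
  rw [← hnn] at e9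
  have e10 : (ρ * n) ^ 2 ≤ cnt1 (fun b => ∃ c, RedLink E J K (η * n) a b c) ^ 2 :=
    pow_le_pow_left₀ (by positivity) hp.le 2
  have e11 : η * n ^ 2 ≤ σ * n ^ 2 := by gcongr
  have e12 : 12 * n ≤ 12 * σ * n ^ 2 := by nlinarith
  have hnpos : 0 < n := by
    rcases hn0.lt_or_eq with h | h
    · exact h
    · rw [← h] at hn; norm_num at hn
  have e13 : 38 * σ * n ^ 2 < 3 * ρ ^ 2 * n ^ 2 := by gcongr
  linarith

theorem exists_two_fan_bound {ε : ℝ} (hε : 0 < ε) :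
    ∃ ε₀ > 0, ∃ N : ℝ, ∀ (V : Type) [Fintype V] (E J : V → V → V → Prop),
      N ≤ (Fintype.card V : ℝ) → Sym3 E → FanFree E 2 →
      (6 - ε₀) * (Fintype.card V : ℝ) ^ 2 ≤ cnt3 E → Sym3 J → (∀ a b c, J a b c → E a b c) →
      (∀ a b c, J a b c → 3 ≤ (nb E a b).card) →
      cnt3 J ≤ 3 * cnt2 (fun a b => ∃ c, J a b c) + ε * (Fintype.card V : ℝ) ^ 2 := by
  set ρ : ℝ := min (ε / 24) 1 with hρ
  have hρ0 : 0 < ρ := lt_min (by positivity) one_pos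
  have hρ1 : ρ ≤ 1 := min_le_right _ _
  have hρε : ρ ≤ ε / 24 := min_le_left _ _
  set σ : ℝ := ρ ^ 2 / 100 with hσ
  have hσ0 : 0 < σ := by positivity
  set C := hitSize 2 + 5 with hC
  obtain ⟨η, hη0, hησ, N, hN⟩ := exists_ratio 2 C (κ := 6) (ε := σ) le_rfl (by norm_num) hσ0
  set D : ℝ := (peelDeg 2 : ℝ) with hD
  have hD0 : 0 ≤ D := Nat.cast_nonneg _
  refine ⟨σ, hσ0, max N (max (1 / σ) (9 * (4 * C + 10) * D / σ ^ 2)), ?_⟩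
  intro V _ E J hn hE hF hcnt hJ hsub hJd
  obtain ⟨hn1, hn2⟩ := max_le_iff.1 hn
  obtain ⟨hn2, hn3⟩ := max_le_iff.1 hn2
  rw [div_le_iff₀ (by positivity)] at hn2 hn3
  set n : ℝ := (Fintype.card V : ℝ) with hnn
  have hnpos : 0 < n := by
    by_contra! h
    nlinarith
  choose K hKc hK using hF.exists_hitSet hE
  set U : V → Prop := fun u => σ * n ^ 2 ≤ cnt2 (E u) with hU
  set J0 : V → V → V → Prop := fun a b c => J a b c ∧ ¬ (U a ∨ U b ∨ U c) with hJ0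
  have hJ0s : Sym3 J0 :=
    ⟨fun h => ⟨hJ.swap12 h.1, fun h' => h.2 (by tauto)⟩,
      fun h => ⟨hJ.swap23 h.1, fun h' => h.2 (by tauto)⟩, fun h => hJ.ne12 h.1⟩
  set J1 : V → V → V → Prop := fun a b c => J0 a b c ∧ Extends J0 a b c with hJ1
  have hJ1s : Sym3 J1 :=
    ⟨fun h => ⟨hJ0s.swap12 h.1, h.2.swap12 hJ0s⟩,
      fun h => ⟨hJ0s.swap23 h.1, h.2.swap23 hJ0s⟩, fun h => hJ0s.ne12 h.1⟩
  have hJ0E : ∀ {a b c}, J0 a b c → E a b c := fun h => hsub _ _ _ h.1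
  have hQ : ∀ a, ∃ Q : Finset V, Q.card ≤ 5 ∧ ∀ b c, J1 a b c → IsCPetal E a Q ∧
      ∀ v ∈ insert a Q, cnt2 (E v) ≤ σ * n ^ 2 := by
    intro a
    by_cases h : ∃ b c, J1 a b c
    · obtain ⟨b, c, h, x, y, z, h1, h2, h3, h4, h5, h6, h7, h8, h9⟩ := h
      refine ⟨{b, c, z, y, x}, card_le_five, fun _ _ _ => ⟨isCPetal_mk hE (hJ0E h) (hJ0E h1)
        (hJ0E h2) (hJ0E h3) h4 h5 h9.symm h8 h7 h6, ?_⟩⟩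
      intro v hv
      have : ¬ U v := by
        simp only [mem_insert, mem_singleton] at hv
        have u0 := h.2
        have u1 := h1.2
        have u2 := h2.2
        have u3 := h3.2
        simp only [not_or] at u0 u1 u2 u3
        rcases hv with rfl | rfl | rfl | rfl | rfl | rfl
        exacts [u0.1, u0.2.1, u0.2.2, u1.2.2, u2.2.2, u3.2.2]
      exact (not_le.1 this).le
    · push Not at h
      exact ⟨∅, by simp, fun b c hbc => absurd hbc (h b c)⟩
  choose Q hQc hQ using hQ
  set K' : V → Finset V := fun a => K a ∪ Q a with hK'
  have hK'h : ∀ a, HitSet E 2 a (K' a) := fun a => (hK a).mono subset_union_left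
  have hK'c : ∀ a, (K' a).card ≤ C := fun a =>
    (card_union_le _ _).trans (Nat.add_le_add (hKc a) (hQc a))
  have hratio := fun J' hJ' h1 h2 => hN V E J' K' hn1 hE hF hK'h hK'c hJ' h1 h2
  have hP := hF.cnt1_redLink_le (J := J1) (Q := Q) (K := K') (η := η) (σ := σ) (ρ := ρ) hE hJ1s
    (fun a b c h => hJ0E h.1) (by nlinarith) hη0.le hησ (by rw [hσ]; nlinarith [sq_nonneg ρ, pow_pos hρ0 2]) hρ0.le
    hcnt hratio hQc (fun a => subset_union_right) hQ
  have e1 := hratio J1 hJ1s (fun a b c h => hJ0E h.1) fun a b c h => hJd a b c h.1.1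
  have e2 : cnt2 (fun a b => ∃ c, RedLink E J1 K' (η * n) a b c) ≤ n * (ρ * n) := by
    calc _ ≤ ∑ _a : V, ρ * n := sum_le_sum fun a _ => hP a
      _ = _ := by simp [hnn]
  have e3 := cnt3_not_extends_le hJ0s
  have e4 : cnt2 (fun a b => ∃ c, J0 a b c) ≤ cnt2 (fun a b => ∃ c, J a b c) :=
    cnt2_mono fun a b ⟨c, hc⟩ => ⟨c, hc.1⟩
  have e5 : cnt3 J ≤ cnt3 (fun a b c => J a b c ∧ (U a ∨ U b ∨ U c)) +
      cnt3 (fun a b c => (J0 a b c ∧ ¬ Extends J0 a b c) ∨ J1 a b c) := by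
    refine cnt3_le_add fun a b c h => ?_
    by_cases h1 : U a ∨ U b ∨ U c
    · exact .inl ⟨h, h1⟩
    by_cases h2 : Extends J0 a b c
    · exact .inr (.inr ⟨⟨h, h1⟩, h2⟩)
    · exact .inr (.inl ⟨⟨h, h1⟩, h2⟩)
  have e6 := cnt3_or (fun a b c => (J0 a b c ∧ ¬ Extends J0 a b c)) J1
  have e7 : cnt3 (fun a b c => J a b c ∧ (U a ∨ U b ∨ U c)) ≤ σ * n ^ 2 := by
    have h1 := cnt3_vertex_le hJ (q := U)
    have h2 : cnt3 (fun a b c => J a b c ∧ U a) ≤ ((4 * C + 10) * n) * cnt1 U := by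
      refine cnt3_le_mul1 (fun a b c h => h.2) fun u _ => ?_
      refine (cnt2_mono (Q := J u) fun b c h => h.1).trans ?_
      refine (cnt2_link_le hE hK'h hK'c hJ hsub hJd u).trans_eq ?_
      push_cast; ring
    have h3 : σ * n ^ 2 * cnt1 U ≤ 3 * D * n ^ 2 := by
      have g1 : σ * n ^ 2 * cnt1 U ≤ cnt3 E := by
        rw [cnt1_eq_sum, mul_sum]
        refine sum_le_sum fun u _ => ?_
        by_cases hu : U u
        · rw [ind_true hu, mul_one]; exact hu
        · rw [ind_false hu, mul_zero]; exact cnt2_nonneg _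
      have g2 := hF.cnt3_le_shadow hE hE fun _ _ _ h => h
      have g3 := cnt2_le_sq fun a b => ∃ c, E a b c
      nlinarith
    have h4 : σ * cnt1 U ≤ 3 * D := by
      have : n ^ 2 * (σ * cnt1 U) ≤ n ^ 2 * (3 * D) := by linarith
      exact le_of_mul_le_mul_left this (by positivity)
    have h5 : σ * (3 * (((4 * C + 10) * n) * cnt1 U)) ≤ σ * (σ * n ^ 2) := by
      calc σ * (3 * (((4 * C + 10) * n) * cnt1 U)) = 3 * (4 * C + 10) * n * (σ * cnt1 U) := by ring
        _ ≤ 3 * (4 * C + 10) * n * (3 * D) := by gcongr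
        _ = (9 * (4 * C + 10) * D) * n := by ring
        _ ≤ (n * σ ^ 2) * n := by gcongr
        _ = _ := by ring
    have h6 := le_of_mul_le_mul_left h5 hσ0
    linarith
  have e8 : 2 * σ + 6 * ρ ≤ ε := by rw [hσ]; nlinarith
  have e9 : (2 * σ + 6 * ρ) * n ^ 2 ≤ ε * n ^ 2 := by gcongr
  nlinarith

end TwoFan

section Deficiency

theorem exists_core_bound {t : ℕ} (ht : 2 ≤ t) {ε : ℝ} (hε : 0 < ε) :
    ∃ ε₀ > 0, ∃ N : ℝ, ∀ (V : Type) [Fintype V] (E J : V → V → V → Prop),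
      N ≤ (Fintype.card V : ℝ) → Sym3 E → FanFree E t →
      (3 * t - ε₀) * (Fintype.card V : ℝ) ^ 2 ≤ cnt3 E → Sym3 J → (∀ a b c, J a b c → E a b c) →
      (∀ a b c, J a b c → t + 1 ≤ (nb E a b).card) →
      cnt3 J ≤ 3 * (t - 1) * cnt2 (fun a b => ∃ c, J a b c) + ε * (Fintype.card V : ℝ) ^ 2 := by
  rcases ht.lt_or_eq with ht | rfl
  · have ht' : (3 : ℝ) ≤ t := by exact_mod_cast ht
    obtain ⟨η, hη0, -, N, hN⟩ := exists_ratio t (hitSize t) (κ := 3 * (t - 1)) (ε := ε)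
      (by linarith) (by linarith) hε
    refine ⟨1, one_pos, N, ?_⟩
    intro V _ E J hn hE hF _ hJ hsub hJd
    choose K hKc hK using hF.exists_hitSet hE
    refine (hN V E J K hn hE hF hK hKc hJ hsub hJd).trans (add_le_add ?_ le_rfl)
    exact mul_le_mul_of_nonneg_left (cnt2_mono fun a b ⟨c, hc⟩ => ⟨c, hc.1⟩) (by linarith)
  · obtain ⟨ε₀, h0, N, hN⟩ := exists_two_fan_bound hε
    refine ⟨ε₀, h0, N, ?_⟩
    intro V _ E J hn hE hF hcnt hJ hsub hJd
    refine (hN V E J hn hE hF (le_of_eq_of_le ?_ hcnt) hJ hsub hJd).trans_eq ?_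
    · push_cast; ring
    · push_cast; ring

/-- In a nearly extremal hypergraph almost all pairs have codegree exactly `t`. -/
theorem exists_codegree_stability {t : ℕ} (ht : 2 ≤ t) {ε : ℝ} (hε : 0 < ε) :
    ∃ ε₀ > 0, ∃ N : ℝ, ∀ (V : Type) [Fintype V] (E : V → V → V → Prop),
      N ≤ (Fintype.card V : ℝ) → Sym3 E → FanFree E t →
      (3 * t - ε₀) * (Fintype.card V : ℝ) ^ 2 ≤ cnt3 E →
      cnt2 (fun a b => (nb E a b).card ≠ t) ≤ ε * (Fintype.card V : ℝ) ^ 2 ∧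
      cnt3 (fun a b c => E a b c ∧ Multi (fun a b => (nb E a b).card ≤ t) a b c) ≤
        ε * (Fintype.card V : ℝ) ^ 2 := by
  obtain ⟨ε₀, h0, N, hN⟩ := exists_core_bound ht (half_pos hε)
  refine ⟨min ε₀ (ε / 2), lt_min h0 (half_pos hε), N, ?_⟩
  intro V _ E hn hE hF hcnt
  set n : ℝ := (Fintype.card V : ℝ) with hnn
  have hm1 : min ε₀ (ε / 2) * n ^ 2 ≤ ε₀ * n ^ 2 := by gcongr; exact min_le_left _ _
  have hm2 : min ε₀ (ε / 2) * n ^ 2 ≤ ε / 2 * n ^ 2 := by gcongr; exact min_le_right _ _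
  set lo : V → V → Prop := fun a b => (nb E a b).card ≤ t with hlo
  have hlos : ∀ a b, lo a b → lo b a := fun a b h => by
    simp only [hlo] at h ⊢; rwa [hE.nb_comm]
  set J : V → V → V → Prop := fun a b c => E a b c ∧ ¬ (lo a b ∨ lo a c ∨ lo b c) with hJ
  have hJs : Sym3 J := by
    refine ⟨fun {a b c} h => ⟨hE.swap12 h.1, fun h' => h.2 ?_⟩,
      fun {a b c} h => ⟨hE.swap23 h.1, fun h' => h.2 ?_⟩, fun h => hE.ne12 h.1⟩
    · have := hlos b a; tauto
    · have := hlos c b; tauto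
  have e1 := hN V E J hn hE hF (by linarith) hJs (fun a b c h => h.1) fun a b c h => by
    by_contra hc; exact h.2 (.inl (by simp only [hlo]; omega))
  have e2 := cnt3_some_add_multi_le hE (R := lo)
  have e3 : cnt3 E ≤ cnt3 (fun a b c => E a b c ∧ (lo a b ∨ lo a c ∨ lo b c)) + cnt3 J := by
    refine cnt3_le_add fun a b c h => ?_
    by_cases h1 : lo a b ∨ lo a c ∨ lo b c
    exacts [.inl ⟨h, h1⟩, .inr ⟨h, h1⟩]
  set eq : V → V → Prop := fun a b => (nb E a b).card = t with heq
  set lt : V → V → Prop := fun a b => (nb E a b).card < t with hlt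
  set hi : V → V → Prop := fun a b => t < (nb E a b).card with hhi
  have e4 : cnt3 (fun a b c => E a b c ∧ lo a b) ≤ t * cnt2 eq + (t - 1) * cnt2 lt := by
    have g1 : cnt3 (fun a b c => E a b c ∧ lo a b) ≤
        cnt3 (fun a b c => E a b c ∧ eq a b) + cnt3 (fun a b c => E a b c ∧ lt a b) :=
      cnt3_le_add fun a b c h => (Nat.lt_or_eq_of_le h.2).elim (fun h' => .inr ⟨h.1, h'⟩)
        fun h' => .inl ⟨h.1, h'⟩
    refine g1.trans (add_le_add ?_ ?_)
    · refine cnt3_le_mul (fun a b c h => h.2) fun a b h => (cnt1_mono fun c h => h.1).trans ?_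
      rw [cnt1_eq_card_nb]; exact_mod_cast h.le
    · refine cnt3_le_mul (fun a b c h => h.2) fun a b h => (cnt1_mono fun c h => h.1).trans ?_
      rw [cnt1_eq_card_nb, le_sub_iff_add_le]; exact_mod_cast h
  have e5 : cnt2 (fun a b => ∃ c, J a b c) ≤ cnt2 hi :=
    cnt2_mono fun a b ⟨c, hc⟩ => not_le.1 fun h => hc.2 (.inl h)
  have e6 : cnt2 lt + cnt2 hi ≤ cnt2 (fun a b => ¬ eq a b) :=
    cnt2_add_le (fun a b h => h.ne) (fun a b h => h.ne') fun a b h h' => lt_asymm h h'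
  have e6' : cnt2 (fun a b => ¬ eq a b) ≤ cnt2 lt + cnt2 hi :=
    cnt2_le_add fun a b h => lt_or_gt_of_ne h
  have e7 : cnt2 eq + cnt2 (fun a b => ¬ eq a b) ≤ cnt2 (fun _ _ : V => True) :=
    cnt2_add_le (fun a b h => trivial) (fun a b h => trivial) fun a b h h' => h' h
  have e8 := cnt2_le_sq fun _ _ : V => True
  rw [← hnn] at e8 e1
  have e9 := cnt3_nonneg (fun a b c => E a b c ∧ Multi lo a b c)
  have e10 := cnt2_nonneg (fun a b => ¬ eq a b)
  have ht' : (2 : ℝ) ≤ t := by exact_mod_cast ht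
  have e11 : 3 * ((t : ℝ) - 1) * cnt2 (fun a b => ∃ c, J a b c) ≤ 3 * (t - 1) * cnt2 hi :=
    mul_le_mul_of_nonneg_left e5 (by linarith)
  have e12 : 3 * (t : ℝ) * (cnt2 eq + cnt2 (fun a b => ¬ eq a b)) ≤ 3 * t * n ^ 2 :=
    mul_le_mul_of_nonneg_left (e7.trans e8) (by linarith)
  have e13 : 3 * ((t : ℝ) - 1) * (cnt2 lt + cnt2 hi) ≤ 3 * (t - 1) * cnt2 (fun a b => ¬ eq a b) :=
    mul_le_mul_of_nonneg_left e6 (by linarith)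
  have main : 3 * cnt2 (fun a b => ¬ eq a b) + cnt3 (fun a b c => E a b c ∧ Multi lo a b c) ≤
      ε * n ^ 2 := by linarith
  exact ⟨by linarith, by linarith⟩

end Deficiency

end FanTuran

namespace FanTuran

open Finset
open scoped Classical

section Cores

variable {V : Type} [Fintype V]

/-- The number of ordered edges inside a vertex set. -/
noncomputable def edgesIn (G : V → V → Prop) (W : Finset V) : ℝ :=
  cnt2 fun a b => G a b ∧ a ∈ W ∧ b ∈ W

theorem exists_dense_core {G : V → V → Prop} (hG : ∀ a b, G a b → G b a) (c : ℝ) :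
    ∃ W : Finset V, (∀ W', edgesIn G W' - c * #W' ≤ edgesIn G W - c * #W) ∧
      ∀ a ∈ W, c ≤ 2 * cnt1 fun b => G a b ∧ b ∈ W := by
  obtain ⟨W, -, hW⟩ := exists_max_image (univ : Finset (Finset V))
    (fun W => edgesIn G W - c * #W) univ_nonempty
  refine ⟨W, fun W' => hW W' (mem_univ _), fun a ha => ?_⟩
  have h1 := hW (W.erase a) (mem_univ _)
  have h2 : edgesIn G W ≤ edgesIn G (W.erase a) + cnt2 (fun x y => (x = a ∧ G a y ∧ y ∈ W) ∨
      (y = a ∧ G a x ∧ x ∈ W)) := by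
    refine cnt2_le_add fun x y ⟨h, hx, hy⟩ => ?_
    by_cases hxa : x = a
    · subst hxa; exact .inr (.inl ⟨rfl, h, hy⟩)
    by_cases hya : y = a
    · subst hya; exact .inr (.inr ⟨rfl, hG _ _ h, hx⟩)
    exact .inl ⟨h, mem_erase.2 ⟨hxa, hx⟩, mem_erase.2 ⟨hya, hy⟩⟩
  have h3 := cnt2_or (fun x y => x = a ∧ G a y ∧ y ∈ W) (fun x y => y = a ∧ G a x ∧ x ∈ W)
  have h4 : cnt2 (fun x y => x = a ∧ G a y ∧ y ∈ W) ≤ (cnt1 fun b => G a b ∧ b ∈ W) * 1 := by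
    rw [← cnt1_eq_one a]
    exact cnt2_le_mul (fun x y h => h.1) fun x _ => cnt1_mono fun y h => h.2
  have h5 := cnt2_swap (fun x y => x = a ∧ G a y ∧ y ∈ W)
  have h6 : (#(W.erase a) : ℝ) = #W - 1 := by
    rw [card_erase_of_mem ha, Nat.cast_sub (card_pos.2 ⟨a, ha⟩)]; simp
  rw [h6] at h1
  linarith

end Cores

section Sunflower

variable {V : Type} [Fintype V] {E : V → V → V → Prop} {t : ℕ}

theorem exists_petal_avoiding (hE : Sym3 E) {c a b z : V} {q : ℕ} {Q : Finset V}
    (h : E a b z) (hzc : z ≠ c) (ha : q + 4 ≤ #(nb E c a)) (hb : q + 4 ≤ #(nb E c b))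
    (hQ : #Q ≤ q) (haQ : a ∉ Q) (hbQ : b ∉ Q) (hzQ : z ∉ Q) :
    ∃ A, (IsPetal E c A ∧ (E c a b → IsCPetal E c A)) ∧ Disjoint A Q := by
  obtain ⟨x, hx, hxQ⟩ : ∃ x ∈ nb E c a, x ∉ Q ∪ {b, z} := by
    refine exists_mem_notMem (lt_of_le_of_lt (card_union_le _ _) ?_)
    have := card_le_two (a := b) (b := z); omega
  obtain ⟨y, hy, hyQ⟩ : ∃ y ∈ nb E c b, y ∉ Q ∪ {a, z, x} := by
    refine exists_mem_notMem (lt_of_le_of_lt (card_union_le _ _) ?_)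
    have := card_le_three (a := a) (b := z) (c := x); omega
  rw [mem_nb] at hx hy
  simp only [mem_union, mem_insert, mem_singleton, not_or] at hxQ hyQ
  have h1 : x ≠ y := fun h => hyQ.2.2.2 h.symm
  refine ⟨{a, b, x, y, z}, ⟨isPetal_mk hE hx hy h hxQ.2.1 hyQ.2.1 h1 (Ne.symm hxQ.2.2)
    (Ne.symm hyQ.2.2.1) hzc, fun h0 => isCPetal_mk hE h0 hx hy h hxQ.2.1 hyQ.2.1 h1
      (Ne.symm hxQ.2.2) (Ne.symm hyQ.2.2.1) hzc⟩, ?_⟩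
  simp [haQ, hbQ, hzQ, hxQ.1, hyQ.1]

omit [Fintype V] in
theorem IsPetal.card {c : V} {A : Finset V} (h : IsPetal E c A) : #A = 5 := by
  obtain ⟨_, _, _, _, _, _, h, _⟩ := h; exact h

theorem FanFree.not_cores (hE : Sym3 E) (hF : FanFree E t) (c : V) (a b z : Fin t → V)
    (hd : ∀ i j, i ≠ j → Disjoint ({a i, b i, z i} : Finset V) {a j, b j, z j})
    (h : ∀ j, E (a j) (b j) (z j)) (hz : ∀ j, z j ≠ c)
    (ha : ∀ j, 10 * t + 4 ≤ #(nb E c (a j))) (hb : ∀ j, 10 * t + 4 ≤ #(nb E c (b j)))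
    (hc : ∀ j : Fin t, j.val + 1 < t → E c (a j) (b j)) : False := by
  obtain ⟨A, hA, hAd⟩ := exists_disjoint_completion (fun j => {a j, b j, z j})
    (fun j A => IsPetal E c A ∧ (E c (a j) (b j) → IsCPetal E c A)) hd
    (fun j => card_le_three.trans (by norm_num)) (fun j A h => h.1.card.le) (by
      intro j Q hQ hdis
      simp only [disjoint_insert_left, disjoint_singleton_left] at hdis
      exact exists_petal_avoiding hE (h j) (hz j) (ha j) (hb j) hQ hdis.1 hdis.2.1 hdis.2.2)
  exact hF ⟨c, A, hAd, fun j => (hA j).1, fun j hj => (hA j).2 (hc j hj)⟩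

omit [Fintype V] in
theorem exists_enumeration {S : Finset V} {s : V} (hS : #S = t - 1) (hs : s ∉ S) :
    ∃ e : Fin t → V, Function.Injective e ∧ ∀ j : Fin t, j.val + 1 < t → e j ∈ S := by
  obtain ⟨f⟩ : Nonempty (Fin (t - 1) ≃ S) :=
    ⟨Fintype.equivOfCardEq (by simp only [Fintype.card_fin, Fintype.card_coe, hS])⟩
  refine ⟨fun j => if h : j.val + 1 < t then f ⟨j, by omega⟩ else s, ?_, ?_⟩
  · intro i j hij
    simp only at hij
    have hfs : ∀ k, (f k : V) ≠ s := fun k h => hs (h ▸ (f k).2)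
    split_ifs at hij with h1 h2 h2
    · have := f.injective (Subtype.ext hij)
      exact Fin.ext (by simpa using this)
    · exact absurd hij (hfs _)
    · exact absurd hij.symm (hfs _)
    · exact Fin.ext (by omega)
  · intro j hj
    simp only [hj, dif_pos]; exact (f _).2

/-- The degree threshold for link cores. -/
def coreDeg (t : ℕ) : ℕ := 2 * ((t + 3) * (2 * t + 1)) + 20 * t + 20 + hitSize t

theorem FanFree.exists_kernel (hE : Sym3 E) (hF : FanFree E t) (ht : 2 ≤ t) (s : V)
    (W : Finset V) (hW : W.Nonempty)
    (hdeg : ∀ a ∈ W, coreDeg t ≤ #(univ.filter fun b => b ∈ W ∧ E s a b ∧ #(nb E a b) = t)) :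
    ∃ S : Finset V, #S = t ∧ s ∈ S ∧ ∀ x ∈ W, ∀ y ∈ W, nb E x y ⊆ S := by
  have hcd : 2 * ((t + 3) * (2 * t + 1)) + 20 * t + 20 ≤ coreDeg t := Nat.le_add_right _ _
  have hnbr : ∀ a ∈ W, ∀ Q : Finset V, #Q < coreDeg t →
      ∃ b ∈ W, b ∉ Q ∧ E s a b ∧ #(nb E a b) = t := by
    intro a ha Q hQ
    obtain ⟨b, hb, hbQ⟩ := exists_mem_notMem (hQ.trans_le (hdeg a ha))
    simp only [mem_filter, mem_univ, true_and] at hb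
    exact ⟨b, hb.1, hbQ, hb.2⟩
  have hds : ∀ a ∈ W, 10 * t + 4 ≤ #(nb E s a) := by
    intro a ha
    refine le_trans ?_ (card_le_card (s := univ.filter fun b => b ∈ W ∧ E s a b ∧ #(nb E a b) = t)
      fun b hb => mem_nb.2 (mem_filter.1 hb).2.2.1)
    have := hdeg a ha; omega
  -- a conflict-free matching
  obtain ⟨a, b, hab, hR, hd, hcf⟩ : ∃ a b : Fin (t + 3) → V,
      (∀ j, a j ∈ W ∧ b j ∈ W ∧ E s (a j) (b j)) ∧ (∀ j, #(nb E (a j) (b j)) = t) ∧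
      (∀ i j, i ≠ j → Disjoint ({a i, b i} : Finset V) {a j, b j}) ∧
      ∀ i j, Disjoint (nb E (a i) (b i)) ({a j, b j} : Finset V) := by
    rcases exists_disjoint_or_hitting
      (fun A : Finset V => ∃ a b, A = {a, b} ∧ (a ∈ W ∧ b ∈ W ∧ E s a b) ∧ #(nb E a b) = t)
      2 ((t + 3) * (2 * t + 1)) (by rintro A ⟨a, b, rfl, -⟩; exact card_le_two)
      with ⟨A, hA, hd⟩ | ⟨K, hK, hh⟩
    · choose a b hA hab hR using hA
      obtain ⟨g, hg, hgd⟩ := exists_conflict_free A (fun j => nb E (a j) (b j)) hd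
        (fun i => (hR i).le) le_rfl
      refine ⟨fun j => a (g j), fun j => b (g j), fun j => hab _, fun j => hR _, ?_, ?_⟩
      · intro i j hij
        rw [← hA, ← hA]; exact hd _ _ fun h => hij (hg h)
      · intro i j
        by_cases hij : i = j
        · subst hij
          simp only [disjoint_insert_right, disjoint_singleton_right, mem_nb]
          exact ⟨fun h => hE.ne13 h rfl, fun h => hE.ne23 h rfl⟩
        · have := hgd i j hij
          rwa [hA] at this
    · exfalso
      obtain ⟨a, ha⟩ := hW
      obtain ⟨b, hb, hbK, -⟩ := hnbr a ha K (by omega)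
      obtain ⟨b', hb', hbK', h1, h2⟩ := hnbr b hb K (by omega)
      refine hh _ ⟨b, b', rfl, ⟨hb, hb', h1⟩, h2⟩ ?_
      simp [hbK, hbK']
  have hsR : ∀ j, s ∈ nb E (a j) (b j) := fun j => mem_nb.2 (hE.rot (hab j).2.2)
  -- all common links coincide
  have heq : ∀ i j, nb E (a i) (b i) = nb E (a j) (b j) := by
    by_contra! hne
    obtain ⟨i, j, hij⟩ := hne
    have hij' : i ≠ j := by rintro rfl; exact hij rfl
    obtain ⟨u, hu, -, huc⟩ := exists_subsuperset_card_eq (n := t) (subset_univ ({i, j} : Finset (Fin (t + 3))))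
      (by rw [card_pair hij']; exact ht) (by simp)
    set g := u.orderEmbOfFin huc with hg
    have hr : ∀ k ∈ u, ∃ l, g l = k := fun k hk => by
      have := range_orderEmbOfFin u huc
      rw [Set.ext_iff] at this
      exact (this k).2 (by simpa using hk)
    obtain ⟨i', hi'⟩ := hr i (hu (by simp))
    obtain ⟨j', hj'⟩ := hr j (hu (by simp))
    obtain ⟨z, hz, hzR⟩ := exists_distinct_representatives_of_ne
      (fun l => (nb E (a (g l)) (b (g l))).erase s) (i := i') (j := j')
      (fun l => by rw [card_erase_of_mem (hsR _), hR]) (by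
        intro h
        simp only [hi', hj'] at h
        apply hij
        rw [← insert_erase (hsR i), h, insert_erase (hsR j)])
    have hzR' : ∀ l, z l ≠ s ∧ z l ∈ nb E (a (g l)) (b (g l)) := fun l => mem_erase.1 (hzR l)
    refine hF.not_cores hE s (fun l => a (g l)) (fun l => b (g l)) z ?_
      (fun l => mem_nb.1 (hzR' l).2) (fun l => (hzR' l).1) (fun l => hds _ (hab _).1)
      (fun l => hds _ (hab _).2.1) fun l _ => (hab _).2.2
    intro k l hkl
    have h1 := hd (g k) (g l) fun h => hkl (g.injective h)
    have h2 := disjoint_left.1 (hcf (g k) (g l)) (hzR' k).2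
    have h3 := disjoint_left.1 (hcf (g l) (g k)) (hzR' l).2
    have h4 : z k ≠ z l := fun h => hkl (hz h)
    simp only [disjoint_insert_left, disjoint_singleton_left, mem_insert, mem_singleton,
      not_or] at h1 h2 h3 ⊢
    exact ⟨⟨h1.1.1, h1.1.2, Ne.symm h3.1⟩, ⟨h1.2.1, h1.2.2, Ne.symm h3.2⟩, h2.1, h2.2, h4⟩
  set S := nb E (a 0) (b 0) with hS
  have hSc : #S = t := hR 0
  -- common links outside the kernel
  have hsub : ∀ x ∈ W, ∀ y ∈ W, x ∉ S → y ∉ S → nb E x y ⊆ S := by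
    intro x hx y hy hxS hyS z hz
    rw [mem_nb] at hz
    by_contra hzS
    obtain ⟨u, hu, huc⟩ : ∃ u ⊆ univ.filter fun j => Disjoint ({a j, b j} : Finset V) {x, y, z},
        #u = t := by
      refine exists_subset_card_eq ?_
      have h1 : #(univ.filter fun j => ¬ Disjoint ({a j, b j} : Finset V) {x, y, z}) ≤ 3 := by
        refine le_trans ?_ (card_le_three (a := x) (b := y) (c := z))
        have : ∀ j ∈ univ.filter fun j => ¬ Disjoint ({a j, b j} : Finset V) {x, y, z},
            ∃ v, v ∈ ({a j, b j} : Finset V) ∧ v ∈ ({x, y, z} : Finset V) := fun j hj =>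
          not_disjoint_iff.1 (mem_filter.1 hj).2
        have hne : Nonempty V := ⟨s⟩
        choose! f hf using this
        refine card_le_card_of_injOn f (fun j hj => (hf j hj).2) ?_
        intro i hi j hj hij
        by_contra hne
        exact disjoint_left.1 (hd i j hne) (hf i hi).1 (hij ▸ (hf j hj).1)
      have h2 := card_filter_add_card_filter_not (s := (univ : Finset (Fin (t + 3))))
        (fun j => Disjoint ({a j, b j} : Finset V) {x, y, z})
      rw [card_univ, Fintype.card_fin] at h2
      omega
    set g := u.orderEmbOfFin huc with hg
    have hgu : ∀ l, Disjoint ({a (g l), b (g l)} : Finset V) {x, y, z} := fun l =>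
      (mem_filter.1 (hu (orderEmbOfFin_mem u huc l))).2
    obtain ⟨e, he⟩ := exists_enumeration (S := S.erase s) (t := t)
      (by rw [card_erase_of_mem (hsR 0), hSc]) (notMem_erase s S)
    have hgS : ∀ l, nb E (a (g l)) (b (g l)) = S := fun l => heq _ _
    have hSx : ∀ v ∈ S, v ≠ x ∧ v ≠ y ∧ v ≠ z := fun v hv =>
      ⟨fun h => hxS (h ▸ hv), fun h => hyS (h ▸ hv), fun h => hzS (h ▸ hv)⟩
    have hSp : ∀ v ∈ S, ∀ l, v ≠ a (g l) ∧ v ≠ b (g l) := by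
      intro v hv l
      have := disjoint_left.1 (hcf (g l) (g l)) ((hgS l).symm ▸ hv)
      simpa using this
    have he' : ∀ j : Fin t, j.val + 1 < t → e j ∈ S ∧ e j ≠ s := fun j hj =>
      ⟨(mem_erase.1 (he.2 j hj)).2, (mem_erase.1 (he.2 j hj)).1⟩
    have hzs : z ≠ s := fun h => hzS (h ▸ hsR 0)
    refine hF.not_cores hE s (fun l => if l.val + 1 < t then a (g l) else x)
      (fun l => if l.val + 1 < t then b (g l) else y) (fun l => if l.val + 1 < t then e l else z)
      ?_ ?_ ?_ ?_ ?_ ?_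
    · intro i j hij
      have h1 := hd (g i) (g j) fun h => hij (g.injective h)
      have h2 : e i ≠ e j := fun h => hij (he.1 h)
      have h3 := hgu i
      have h4 := hgu j
      simp only [disjoint_insert_left, disjoint_singleton_left, mem_insert, mem_singleton,
        not_or] at h1 h3 h4
      by_cases hi : i.val + 1 < t <;> by_cases hj : j.val + 1 < t <;>
        simp only [hi, hj, if_true, if_false, disjoint_insert_left, disjoint_singleton_left,
          mem_insert, mem_singleton, not_or]
      · have h5 := hSp _ (he' i hi).1 j
        have h6 := hSp _ (he' j hj).1 i
        exact ⟨⟨h1.1.1, h1.1.2, Ne.symm h6.1⟩, ⟨h1.2.1, h1.2.2, Ne.symm h6.2⟩, h5.1, h5.2, h2⟩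
      · exact ⟨h3.1, h3.2, hSx _ (he' i hi).1⟩
      · have h5 := hSx _ (he' j hj).1
        exact ⟨⟨Ne.symm h4.1.1, Ne.symm h4.2.1, Ne.symm h5.1⟩,
          ⟨Ne.symm h4.1.2.1, Ne.symm h4.2.2.1, Ne.symm h5.2.1⟩,
          Ne.symm h4.1.2.2, Ne.symm h4.2.2.2, Ne.symm h5.2.2⟩
      · exact absurd (Fin.ext (by omega)) hij
    · intro l
      by_cases hl : l.val + 1 < t <;> simp only [hl, if_true, if_false]
      · exact mem_nb.1 ((hgS l).symm ▸ (he' l hl).1)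
      · exact hz
    · intro l
      by_cases hl : l.val + 1 < t <;> simp only [hl, if_true, if_false]
      · exact (he' l hl).2
      · exact hzs
    · intro l
      by_cases hl : l.val + 1 < t <;> simp only [hl, if_true, if_false]
      · exact hds _ (hab _).1
      · exact hds _ hx
    · intro l
      by_cases hl : l.val + 1 < t <;> simp only [hl, if_true, if_false]
      · exact hds _ (hab _).2.1
      · exact hds _ hy
    · intro l hl
      simp only [hl, if_true]; exact (hab _).2.2
  have heqS : ∀ x ∈ W, ∀ y ∈ W, x ∉ S → y ∉ S → #(nb E x y) = t → nb E x y = S :=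
    fun x hx y hy hxS hyS hc => eq_of_subset_of_card_le (hsub x hx y hy hxS hyS) (by rw [hc, hSc])
  -- the kernel avoids the core
  have hWS : ∀ x ∈ W, x ∉ S := by
    intro x hx hxS
    obtain ⟨y, hy, hyS, -, hxy⟩ := hnbr x hx S (by omega)
    obtain ⟨R, hR', hRc⟩ : ∃ R ⊆ nb E y x, #R = t := exists_subset_card_eq (by rw [hE.nb_comm, hxy])
    obtain ⟨w, hw, hwS, -, hyw⟩ := hnbr y hy (S ∪ R)
      (lt_of_le_of_lt (card_union_le _ _) (by omega))
    simp only [mem_union, not_or] at hwS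
    have h1 := heqS y hy w hw hyS hwS.1 hyw
    have h2 : w ∈ nb E y x := mem_nb.2 (hE.swap23 (mem_nb.1 (h1.symm ▸ hxS)))
    have h3 : R = nb E y x := eq_of_subset_of_card_le hR' (by rw [hRc, hE.nb_comm, hxy])
    exact hwS.2 (h3 ▸ h2)
  exact ⟨S, hSc, hsR 0, fun x hx y hy => hsub x hx y hy (hWS x hx) (hWS y hy)⟩

end Sunflower

end FanTuran

namespace FanTuran

open Finset
open scoped Classical

section CommonLink

variable {V : Type} [Fintype V] {E : V → V → V → Prop} {t : ℕ}

theorem cnt2_exists_le (P : V → V → V → Prop) : cnt2 (fun a b => ∃ s, P s a b) ≤ cnt3 P := by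
  have h1 : 1 * cnt2 (fun a b => ∃ s, P s a b) ≤ cnt3 (fun a b s => P s a b) := by
    refine mul_cnt2_le_cnt3 fun a b ⟨s, hs⟩ => ?_
    rw [← cnt1_eq_one s]
    exact cnt1_mono fun x hx => hx ▸ hs
  have h2 : cnt3 (fun a b s => P s a b) = cnt3 P := by
    rw [← cnt3_swap12 P]
    exact cnt3_swap23 (fun a s b => P s a b)
  linarith

/-- A pair lying in the cores of all the links through it. -/
def FullPair (E : V → V → V → Prop) (t : ℕ) (W : V → Finset V) (a b : V) : Prop :=
  #(nb E a b) = t ∧ ∀ s ∈ nb E a b, a ∈ W s ∧ b ∈ W s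

theorem FullPair.symm (hE : Sym3 E) {W : V → Finset V} {a b : V} (h : FullPair E t W a b) :
    FullPair E t W b a := by
  unfold FullPair at h ⊢
  rw [hE.nb_comm b a]
  exact ⟨h.1, fun s hs => (h.2 s hs).symm⟩

theorem exists_link_cores (hE : Sym3 E) (m : ℕ) :
    ∃ W : V → Finset V,
      (∀ s, ∀ a ∈ W s, m ≤ #(univ.filter fun b => b ∈ W s ∧ E s a b ∧ #(nb E a b) = t)) ∧
      cnt2 (fun a b => ¬ FullPair E t W a b) ≤
        (1 + 2 * m) * cnt2 (fun a b => #(nb E a b) ≠ t) +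
          cnt3 (fun a b c => E a b c ∧ Multi (fun a b => #(nb E a b) ≤ t) a b c) := by
  set good : V → V → Prop := fun a b => #(nb E a b) = t ∧
    ∀ s ∈ nb E a b, t < #(nb E a s) ∧ t < #(nb E b s) with hgood
  have hgs : ∀ a b, good a b → good b a := fun a b h => by
    simp only [hgood] at h ⊢
    rw [hE.nb_comm b a]; exact ⟨h.1, fun s hs => (h.2 s hs).symm⟩
  set G : V → V → V → Prop := fun s a b => good a b ∧ E s a b with hG
  have hGs : ∀ s a b, G s a b → G s b a := fun s a b h => ⟨hgs _ _ h.1, hE.swap23 h.2⟩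
  choose W hW hWd using fun s => exists_dense_core (hGs s) (2 * m : ℝ)
  refine ⟨W, fun s a ha => ?_, ?_⟩
  · have h1 : (m : ℝ) ≤ cnt1 fun b => G s a b ∧ b ∈ W s := by have := hWd s a ha; linarith
    have h2 : (cnt1 fun b => G s a b ∧ b ∈ W s) ≤
        cnt1 fun b => b ∈ W s ∧ E s a b ∧ #(nb E a b) = t :=
      cnt1_mono fun b hb => ⟨hb.2, hb.1.2, hb.1.1.1⟩
    have h3 := h1.trans h2
    unfold cnt1 at h3
    refine le_of_le_of_eq (by exact_mod_cast h3) ?_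
    congr
  · have e1 : cnt2 (fun a b => ¬ FullPair E t W a b) ≤ cnt2 (fun a b => ¬ good a b) +
        cnt2 (fun a b => ∃ s, G s a b ∧ ¬ (a ∈ W s ∧ b ∈ W s)) := by
      refine cnt2_le_add fun a b h => ?_
      by_cases hg : good a b
      · right
        by_contra! hc
        exact h ⟨hg.1, fun s hs => hc s ⟨hg, hE.rot' (mem_nb.1 hs)⟩⟩
      · exact .inl hg
    have e2 : cnt2 (fun a b => ¬ good a b) ≤ cnt2 (fun a b => #(nb E a b) ≠ t) +
        cnt2 (fun a b => ∃ s, E s a b ∧ Multi (fun a b => #(nb E a b) ≤ t) s a b) := by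
      refine cnt2_le_add fun a b h => ?_
      by_cases hd : #(nb E a b) = t
      · right
        by_contra! hc
        refine h ⟨hd, fun s hs => ?_⟩
        have hs' := hE.rot' (mem_nb.1 hs)
        have := hc s hs'
        unfold Multi at this
        rw [hE.nb_comm a s, hE.nb_comm b s]
        push Not at this
        constructor
        · by_contra! h'
          have := this.2.1 h'; omega
        · by_contra! h'
          have := this.2.2 h'; omega
      · exact .inl hd
    have e3 := cnt2_exists_le fun s a b => E s a b ∧ Multi (fun a b => #(nb E a b) ≤ t) s a b
    have e4 := cnt2_exists_le fun s a b => G s a b ∧ ¬ (a ∈ W s ∧ b ∈ W s)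
    set V0 : V → Finset V := fun s => univ.filter fun a => ∃ b, G s a b with hV0
    have e5 : ∀ s, cnt2 (fun a b => G s a b ∧ ¬ (a ∈ W s ∧ b ∈ W s)) ≤ 2 * m * #(V0 s) := by
      intro s
      have h1 : cnt2 (fun a b => G s a b ∧ ¬ (a ∈ W s ∧ b ∈ W s)) + edgesIn (G s) (W s) ≤
          edgesIn (G s) (V0 s) := by
        refine cnt2_add_le (fun a b h => ⟨h.1, ?_, ?_⟩) (fun a b h => ⟨h.1, ?_, ?_⟩)
          fun a b h h' => h.2 h'.2
        exacts [by simpa [hV0] using ⟨b, h.1⟩, by simpa [hV0] using ⟨a, hGs _ _ _ h.1⟩,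
          by simpa [hV0] using ⟨b, h.1⟩, by simpa [hV0] using ⟨a, hGs _ _ _ h.1⟩]
      have h2 := hW s (V0 s)
      have h3 : (0 : ℝ) ≤ 2 * m * #(W s) := by positivity
      linarith
    have e6 : cnt3 (fun s a b => G s a b ∧ ¬ (a ∈ W s ∧ b ∈ W s)) ≤
        2 * m * cnt2 (fun s a => a ∈ V0 s) := by
      unfold cnt3
      rw [cnt2, mul_sum]
      exact sum_le_sum fun s _ => (e5 s).trans (by rw [cnt1_mem])
    have e7 : cnt2 (fun s a => a ∈ V0 s) ≤ cnt2 (fun a b => #(nb E a b) ≠ t) := by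
      refine cnt2_mono fun s a h => ?_
      simp only [hV0, mem_filter, mem_univ, true_and] at h
      obtain ⟨b, hb, hs⟩ := h
      have := (hb.2 s (mem_nb.2 (hE.rot hs))).1
      rw [hE.nb_comm] at this; omega
    have e8 : 2 * (m : ℝ) * cnt2 (fun s a => a ∈ V0 s) ≤
        2 * m * cnt2 (fun a b => #(nb E a b) ≠ t) := mul_le_mul_of_nonneg_left e7 (by positivity)
    linarith

/-- A full pair avoiding the hitting sets of its endpoints. -/
def FreePair (E : V → V → V → Prop) (t : ℕ) (W K : V → Finset V) (a b : V) : Prop :=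
  FullPair E t W a b ∧ b ∉ K a ∧ a ∉ K b

theorem FreePair.symm (hE : Sym3 E) {W K : V → Finset V} {a b : V} (h : FreePair E t W K a b) :
    FreePair E t W K b a := ⟨h.1.symm hE, h.2.2, h.2.1⟩

theorem FreePair.exists_mem (hE : Sym3 E) (ht : 2 ≤ t) {W K : V → Finset V}
    (hK : ∀ a, HitSet E t a (K a)) (hKc : ∀ a, #(K a) ≤ hitSize t)
    (hW : ∀ s, ∀ a ∈ W s, hitSize t + t + 3 ≤ #(nb E s a)) {a b : V} (h : FreePair E t W K a b) :
    ∃ s ∈ nb E a b, s ∈ K a := by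
  by_contra! hc
  obtain ⟨s, hs, s', hs', hne⟩ := one_lt_card.1 (by rw [h.1.1]; omega : 1 < #(nb E a b))
  have hws := h.1.2 s hs
  have hsb := hW s b hws.2
  have hsa := hW s a hws.1
  rw [hE.nb_comm] at hsa
  obtain ⟨x, hx, hxQ⟩ : ∃ x ∈ nb E a s, x ∉ K a ∪ {b, s'} := by
    refine exists_mem_notMem (lt_of_le_of_lt (card_union_le _ _) ?_)
    have := card_le_two (a := b) (b := s')
    have := hKc a
    omega
  simp only [mem_union, mem_insert, mem_singleton, not_or] at hxQ
  have h1 : t ≤ #(nb E s b \ {a, x, s'}) := by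
    have := le_card_sdiff ({a, x, s'} : Finset V) (nb E s b)
    have := card_le_three (a := a) (b := x) (c := s')
    omega
  rcases hK a s b x s' ⟨hE.swap23 (mem_nb.1 hs), mem_nb.1 hx, mem_nb.1 hs', hxQ.2.1, hne.symm,
    hxQ.2.2, h1⟩ with h2 | h2 | h2 | h2
  exacts [hc s hs h2, h.2.1 h2, hxQ.1 h2, hc s' hs' h2]

theorem FanFree.exists_common_link_of_cores (hE : Sym3 E) (hF : FanFree E t) (ht : 2 ≤ t)
    {W : V → Finset V}
    (hW : ∀ s, ∀ a ∈ W s, coreDeg t ≤ #(univ.filter fun b => b ∈ W s ∧ E s a b ∧ #(nb E a b) = t))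
    {δ ε : ℝ} (hδ : 0 ≤ δ) (hδC : 4 * hitSize t ^ 2 * δ ≤ 1)
    (hlow : cnt2 (fun a b => #(nb E a b) ≠ t) ≤ (δ * Fintype.card V) ^ 2)
    (hε : ε ≤ 1 / 4) (hV : 0 < Fintype.card V)
    (hfull : cnt2 (fun a b => ¬ FullPair E t W a b) + 2 * hitSize t * Fintype.card V ≤
      ε * Fintype.card V ^ 2) :
    ∃ T : Finset V, #T = t ∧
      cnt2 (fun a b => ¬ T ⊆ nb E a b) ≤ (8 * hitSize t + 1) * ε * Fintype.card V ^ 2 := by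
  set n : ℝ := (Fintype.card V : ℝ) with hn
  have hn0 : 0 < n := by rw [hn]; exact_mod_cast hV
  set C : ℝ := (hitSize t : ℝ) with hC
  have hC1 : 1 ≤ C := by
    rw [hC]; unfold hitSize
    exact_mod_cast Nat.one_le_iff_ne_zero.2 (by positivity)
  choose K hKc hK using fun a => hF.exists_hitSet hE a
  have hWn : ∀ s, ∀ a ∈ W s, hitSize t + t + 3 ≤ #(nb E s a) := by
    intro s a ha
    refine le_trans ?_ (card_le_card (s := univ.filter fun b => b ∈ W s ∧ E s a b ∧
      #(nb E a b) = t) fun b hb => mem_nb.2 (mem_filter.1 hb).2.2.1)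
    have := hW s a ha
    unfold coreDeg at this
    omega
  have hker : ∀ s, ∃ S : Finset V, (W s).Nonempty →
      #S = t ∧ s ∈ S ∧ ∀ x ∈ W s, ∀ y ∈ W s, nb E x y ⊆ S := fun s => by
    by_cases h : (W s).Nonempty
    · obtain ⟨S, hS⟩ := hF.exists_kernel hE ht s (W s) h (hW s)
      exact ⟨S, fun _ => hS⟩
    · exact ⟨∅, fun h' => absurd h' h⟩
  choose S hS using hker
  set EF := FreePair E t W K with hEF
  have hEFs : ∀ a b, EF a b → EF b a := fun a b h => h.symm hE
  have hEFc : cnt2 (fun a b => ¬ EF a b) ≤ ε * n ^ 2 := by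
    have h1 : cnt2 (fun a b => ¬ EF a b) ≤ cnt2 (fun a b => ¬ FullPair E t W a b) +
        cnt2 (fun a b => b ∈ K a ∨ a ∈ K b) := by
      refine cnt2_le_add fun a b h => ?_
      by_contra! hc
      exact h ⟨hc.1, hc.2⟩
    have h2 := cnt2_or (fun a b => b ∈ K a) (fun a b => a ∈ K b)
    have h3 : cnt2 (fun a b => b ∈ K a) ≤ n * C :=
      cnt2_le_of_mem (fun a => by rw [hC]; exact_mod_cast hKc a) fun a b h => h
    have h4 := cnt2_swap fun a b => b ∈ K a
    linarith
  have hEFn : n ^ 2 - ε * n ^ 2 ≤ cnt2 EF := by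
    have h1 : cnt2 (fun _ _ : V => True) ≤ cnt2 EF + cnt2 (fun a b => ¬ EF a b) :=
      cnt2_le_add fun a b _ => em _
    have h2 : cnt2 (fun _ _ : V => True) = n ^ 2 := by simp [cnt2_eq_sum, ind, hn, sq]
    linarith
  have hmem : ∀ a b, EF a b → ∃ s ∈ nb E a b, s ∈ K a := fun a b h => h.exists_mem hE ht hK hKc hWn
  set U : V → V → Prop := fun s a => ∃ b, EF a b ∧ s ∈ nb E a b with hU
  have hUW : ∀ s a, U s a → a ∈ W s := fun s a ⟨b, hb, hs⟩ => (hb.1.2 s hs).1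
  have hUW2 : ∀ a b s, EF a b → s ∈ nb E a b → nb E a b = S s := by
    intro a b s h hs
    have h1 := h.1.2 s hs
    obtain ⟨h2, -, h3⟩ := hS s ⟨a, h1.1⟩
    exact eq_of_subset_of_card_le (h3 a h1.1 b h1.2) (by rw [h2, h.1.1])
  obtain ⟨s0, hs0⟩ : ∃ s0, n ≤ 2 * C * cnt1 (U s0) := by
    by_contra! hc
    have h1 : cnt2 EF ≤ cnt3 (fun a s b => s ∈ K a ∧ U s b) := by
      refine le_trans (cnt2_mono (Q := fun a b => ∃ s, s ∈ K a ∧ U s b) fun a b h => ?_) ?_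
      · obtain ⟨s, hs, hsK⟩ := hmem a b h
        exact ⟨s, hsK, a, hEFs _ _ h, by rwa [hE.nb_comm]⟩
      · rw [← cnt3_swap12]
        exact cnt2_exists_le fun s a b => s ∈ K a ∧ U s b
    have h2 : cnt3 (fun a s b => s ∈ K a ∧ U s b) ≤ n / (2 * C) * cnt2 (fun a s => s ∈ K a) := by
      refine cnt3_le_mul (fun a s b h => h.1) fun a s _ => ?_
      rw [le_div_iff₀ (by linarith)]
      have := hc s
      have h3 : cnt1 (fun b => s ∈ K a ∧ U s b) ≤ cnt1 (U s) := cnt1_mono fun b hb => hb.2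
      nlinarith
    have h3 : cnt2 (fun a s => s ∈ K a) ≤ n * C :=
      cnt2_le_of_mem (fun a => by rw [hC]; exact_mod_cast hKc a) fun a b h => h
    have h4 : n / (2 * C) * cnt2 (fun a s => s ∈ K a) ≤ n / (2 * C) * (n * C) :=
      mul_le_mul_of_nonneg_left h3 (by positivity)
    have h5 : n / (2 * C) * (n * C) = n ^ 2 / 2 := by field_simp
    have h6 : ε * n ^ 2 ≤ 1 / 4 * n ^ 2 := by gcongr
    nlinarith [sq_pos_of_pos hn0]
  have hne : (W s0).Nonempty := by
    by_contra! h
    have h1 : cnt1 (U s0) ≤ 0 := cnt1_le_zero fun a ha => by simpa [h] using hUW s0 a ha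
    nlinarith
  obtain ⟨hTc, hsT, hT⟩ := hS s0 hne
  set T := S s0 with hTdef
  -- a vertex outside the large part has few free neighbours inside
  have hout : ∀ b, ¬ U s0 b → cnt1 (fun x => EF b x ∧ U s0 x) ≤ n / (4 * C) := by
    intro b hb
    have h1 : ∀ s, S s ≠ T → cnt1 (fun x => U s x ∧ U s0 x) ≤ δ * n := by
      intro s hs
      refine abs_le_of_sq_le_sq' ?_ (by positivity) |>.2
      refine le_trans ?_ hlow
      have : cnt1 (fun x => U s x ∧ U s0 x) * cnt1 (fun x => U s x ∧ U s0 x) ≤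
          cnt2 fun x y => (U s x ∧ U s0 x) ∧ (U s y ∧ U s0 y) :=
        mul_cnt1_le_cnt2 fun x hx => cnt1_mono fun y hy => ⟨hx, hy⟩
      rw [sq]
      refine this.trans (cnt2_mono fun x y ⟨hx, hy⟩ hc => hs ?_)
      have g1 := hS s ⟨x, hUW _ _ hx.1⟩
      have g2 := g1.2.2 x (hUW _ _ hx.1) y (hUW _ _ hy.1)
      have g3 := hT x (hUW _ _ hx.2) y (hUW _ _ hy.2)
      rw [← eq_of_subset_of_card_le g2 (by rw [g1.1, hc]),
        eq_of_subset_of_card_le g3 (by rw [hTc, hc])]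
    have h2 : cnt1 (fun x => EF b x ∧ U s0 x) ≤
        ∑ s ∈ K b, cnt1 (fun x => S s ≠ T ∧ U s x ∧ U s0 x) := by
      simp only [cnt1_eq_sum]
      rw [sum_comm]
      refine sum_le_sum fun x _ => ?_
      by_cases hx : EF b x ∧ U s0 x
      · obtain ⟨s, hs, hsK⟩ := hmem b x hx.1
        have h3 := hUW2 b x s hx.1 hs
        refine (ind_le_one _).trans (le_trans (le_of_eq (ind_true ?_).symm)
          (single_le_sum (f := fun s => ind (S s ≠ T ∧ U s x ∧ U s0 x))
            (fun s _ => ind_nonneg _) hsK))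
        refine ⟨fun hST => hb ⟨x, hx.1, ?_⟩, ⟨b, hEFs _ _ hx.1, by rwa [hE.nb_comm]⟩, hx.2⟩
        rw [h3, hST]; exact hsT
      · rw [ind_false hx]; exact sum_nonneg fun s _ => ind_nonneg _
    have h3 : ∑ s ∈ K b, cnt1 (fun x => S s ≠ T ∧ U s x ∧ U s0 x) ≤ ∑ _s ∈ K b, δ * n := by
      refine sum_le_sum fun s _ => ?_
      by_cases hs : S s = T
      · exact (cnt1_le_zero fun x hx => hx.1 hs).trans (by positivity)
      · exact (cnt1_mono fun x hx => hx.2).trans (h1 s hs)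
    rw [sum_const, nsmul_eq_mul] at h3
    have h4 : (#(K b) : ℝ) * (δ * n) ≤ C * (δ * n) := by
      have : (#(K b) : ℝ) ≤ C := by rw [hC]; exact_mod_cast hKc b
      gcongr
    refine h2.trans (h3.trans (h4.trans ?_))
    rw [le_div_iff₀ (by linarith)]
    nlinarith
  -- there are few vertices outside
  have hY : cnt1 (fun b => ¬ U s0 b) ≤ 4 * C * ε * n := by
    have h1 : n / (4 * C) * cnt1 (fun b => ¬ U s0 b) ≤ cnt2 fun b x => ¬ EF b x := by
      refine mul_cnt1_le_cnt2 fun b hb => ?_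
      have h2 : cnt1 (U s0) ≤ cnt1 (fun x => EF b x ∧ U s0 x) + cnt1 fun x => ¬ EF b x :=
        cnt1_le_add fun x hx => by
          by_cases h : EF b x
          exacts [.inl ⟨h, hx⟩, .inr h]
      have h3 : n / (2 * C) ≤ cnt1 (U s0) := by
        rw [div_le_iff₀ (by linarith)]; linarith
      have h4 : n / (2 * C) = n / (4 * C) + n / (4 * C) := by field_simp; norm_num
      linarith [hout b hb]
    have h2 := h1.trans hEFc
    rw [div_mul_eq_mul_div, div_le_iff₀ (by linarith)] at h2
    have : n * cnt1 (fun b => ¬ U s0 b) ≤ n * (4 * C * ε * n) := by linarith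
    exact le_of_mul_le_mul_left this hn0
  refine ⟨T, hTc, ?_⟩
  have h1 : cnt2 (fun a b => ¬ T ⊆ nb E a b) ≤ cnt2 (fun a b => ¬ U s0 a ∨ ¬ U s0 b) +
      cnt2 (fun a b => ¬ EF a b) := by
    refine cnt2_le_add fun a b h => ?_
    by_contra! hc
    have h2 := hT a (hUW _ _ hc.1.1) b (hUW _ _ hc.1.2)
    exact h (eq_of_subset_of_card_le h2 (by rw [hTc, hc.2.1.1])).ge
  have h2 := cnt2_or (fun a _ : V => ¬ U s0 a) (fun _ b : V => ¬ U s0 b)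
  have h3 : cnt2 (fun a _ : V => ¬ U s0 a) ≤ n * cnt1 (fun b => ¬ U s0 b) :=
    cnt2_le_mul (fun a b h => h) fun a _ => cnt1_le_card _
  have h4 := cnt2_swap (fun a _ : V => ¬ U s0 a)
  have h5 : n * cnt1 (fun b => ¬ U s0 b) ≤ n * (4 * C * ε * n) :=
    mul_le_mul_of_nonneg_left hY hn0.le
  linarith

/-- Stability: a nearly extremal fan-free hypergraph has a `t`-set contained in almost all common
links. -/
theorem exists_common_link (ht : 2 ≤ t) {ε : ℝ} (hε : 0 < ε) :
    ∃ ε₀ > 0, ∃ N : ℝ, ∀ (V : Type) [Fintype V] (E : V → V → V → Prop),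
      N ≤ Fintype.card V → Sym3 E → FanFree E t →
      (3 * t - ε₀) * (Fintype.card V : ℝ) ^ 2 ≤ cnt3 E →
      ∃ T : Finset V, #T = t ∧
        cnt2 (fun a b => ¬ T ⊆ nb E a b) ≤ ε * (Fintype.card V : ℝ) ^ 2 := by
  set C : ℝ := (hitSize t : ℝ) with hC
  have hC0 : 0 ≤ C := Nat.cast_nonneg _
  set m : ℝ := (coreDeg t : ℝ) with hm
  have hm0 : 0 ≤ m := Nat.cast_nonneg _
  obtain ⟨δ, hδ0, hδ1, hδ2, hδ3⟩ : ∃ δ : ℝ, 0 < δ ∧ 4 * C ^ 2 * δ ≤ 1 ∧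
      (3 + 2 * m) * δ ^ 2 ≤ 1 / 4 ∧ (8 * C + 1) * ((3 + 2 * m) * δ ^ 2) ≤ ε := by
    set M : ℝ := 1 + 4 * C ^ 2 + 4 * (3 + 2 * m) + (8 * C + 1) * (3 + 2 * m) / ε with hM
    have hM1 : 1 ≤ M := by
      rw [hM]
      have : 0 ≤ (8 * C + 1) * (3 + 2 * m) / ε := by positivity
      nlinarith
    have hM0 : 0 < M := by linarith
    have e1 : 4 * C ^ 2 ≤ M := by
      have : 0 ≤ (8 * C + 1) * (3 + 2 * m) / ε := by positivity
      linarith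
    have e2 : 4 * (3 + 2 * m) ≤ M := by
      have : 0 ≤ (8 * C + 1) * (3 + 2 * m) / ε := by positivity
      nlinarith
    have e3 : (8 * C + 1) * (3 + 2 * m) / ε ≤ M := by nlinarith
    have e4 : (M⁻¹) ^ 2 ≤ M⁻¹ := by
      rw [sq]; exact mul_le_of_le_one_left (by positivity) (inv_le_one_of_one_le₀ hM1)
    have e5 : M * M⁻¹ = 1 := mul_inv_cancel₀ hM0.ne'
    have e6 : 0 < M⁻¹ := inv_pos.2 hM0
    refine ⟨M⁻¹, e6, ?_, ?_, ?_⟩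
    · rw [← e5]; gcongr
    · nlinarith
    · rw [div_le_iff₀ hε] at e3
      calc (8 * C + 1) * ((3 + 2 * m) * M⁻¹ ^ 2) = (8 * C + 1) * (3 + 2 * m) * M⁻¹ ^ 2 := by ring
        _ ≤ (M * ε) * M⁻¹ := by gcongr
        _ = ε := by rw [mul_right_comm, e5, one_mul]
  obtain ⟨ε₀, h0, N, hN⟩ := exists_codegree_stability ht (ε := δ ^ 2) (by positivity)
  refine ⟨ε₀, h0, max N (max 1 (2 * C / δ ^ 2)), ?_⟩
  intro V _ E hn hE hF hcnt
  set n : ℝ := (Fintype.card V : ℝ) with hnn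
  obtain ⟨h1, h2⟩ := hN V E ((le_max_left _ _).trans hn) hE hF hcnt
  have hn1 : 1 ≤ n := ((le_max_left _ _).trans (le_max_right _ _)).trans hn
  have hn2 : 2 * C / δ ^ 2 ≤ n := ((le_max_right _ _).trans (le_max_right _ _)).trans hn
  rw [div_le_iff₀ (by positivity)] at hn2
  obtain ⟨W, hW, hWc⟩ := exists_link_cores (t := t) hE (coreDeg t)
  have h3 : (1 + 2 * m) * cnt2 (fun a b => #(nb E a b) ≠ t) ≤ (1 + 2 * m) * (δ ^ 2 * n ^ 2) :=
    mul_le_mul_of_nonneg_left h1 (by positivity)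
  have h4 : 2 * C * n ≤ δ ^ 2 * n ^ 2 := by nlinarith
  obtain ⟨T, hT, hTc⟩ := hF.exists_common_link_of_cores hE ht hW hδ0.le hδ1
    (by rw [mul_pow]; exact h1) hδ2 (by have : (0 : ℝ) < n := by linarith
                                        rw [hnn] at this; exact_mod_cast this) (by
      rw [← hnn, ← hC]; linarith)
  refine ⟨T, hT, hTc.trans ?_⟩
  rw [← hC, ← hnn]
  gcongr

end CommonLink

end FanTuran

namespace FanTuran

open Finset
open scoped Classical

section Paths

variable {V : Type} {H : V → V → Prop}

/-- A path whose endpoints have many neighbours on it can be closed up to a cycle. -/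
theorem exists_cycle_of_path (hH : ∀ a b, H a b → H b a) (hirr : ∀ a, ¬ H a a) {t : ℕ}
    {l : List V} (hl : l.Nodup) (hc : l.IsChain H) (hlen : l.length ≤ 2 * t) {x y : V}
    (hx : x ∈ l.head?) (hy : y ∈ l.getLast?)
    (hdx : t ≤ #(l.toFinset.filter (H x))) (hdy : t ≤ #(l.toFinset.filter (H y))) :
    ∃ c : List V, c.Perm l ∧ c.IsChain H ∧ ∀ u ∈ c.head?, ∀ v ∈ c.getLast?, H v u := by
  have hl0 : 0 < l.length := by
    rcases l with _ | ⟨a, l⟩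
    · simp at hx
    · simp
  have hx' : l[0] = x := by
    rw [List.head?_eq_getElem?] at hx
    rw [List.getElem?_eq_getElem hl0] at hx
    simpa using hx
  have hy' : l[l.length - 1] = y := by
    rw [List.getLast?_eq_getElem?, List.getElem?_eq_getElem (by omega)] at hy
    simpa using hy
  set g : ℕ → V := fun i => (l[i]?).getD x with hg
  have hgi : ∀ i (h : i < l.length), g i = l[i] := fun i h => by
    simp [hg, List.getElem?_eq_getElem h]
  set A := (range (l.length - 1)).filter fun i => H x (g (i + 1)) with hA
  set B := (range (l.length - 1)).filter fun i => H y (g i) with hB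
  have hAc : t ≤ #A := by
    refine hdx.trans (le_trans (card_le_card (t := A.image fun i => g (i + 1)) ?_) card_image_le)
    intro v hv
    simp only [mem_filter, List.mem_toFinset] at hv
    obtain ⟨i, hi, rfl⟩ := List.getElem_of_mem hv.1
    rcases i with _ | i
    · rw [hx'] at hv; exact absurd hv.2 (hirr x)
    · refine mem_image.2 ⟨i, mem_filter.2 ⟨mem_range.2 (by omega), ?_⟩, hgi _ hi⟩
      rw [hgi _ hi]; exact hv.2
  have hBc : t ≤ #B := by
    refine hdy.trans (le_trans (card_le_card (t := B.image g) ?_) card_image_le)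
    intro v hv
    simp only [mem_filter, List.mem_toFinset] at hv
    obtain ⟨i, hi, rfl⟩ := List.getElem_of_mem hv.1
    by_cases hil : i = l.length - 1
    · subst hil; rw [hy'] at hv; exact absurd hv.2 (hirr y)
    · refine mem_image.2 ⟨i, mem_filter.2 ⟨mem_range.2 (by omega), ?_⟩, hgi _ hi⟩
      rw [hgi _ hi]; exact hv.2
  obtain ⟨i, hiA, hiB⟩ : ∃ i ∈ A, i ∈ B := by
    by_contra! hc
    have h1 : Disjoint A B := disjoint_left.2 hc
    have h2 : #(A ∪ B) ≤ l.length - 1 := by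
      simpa using card_le_card (union_subset (filter_subset _ _) (filter_subset _ _) :
        A ∪ B ⊆ range (l.length - 1))
    rw [card_union_of_disjoint h1] at h2
    omega
  rw [hA, mem_filter, mem_range] at hiA
  rw [hB, mem_filter] at hiB
  have hi1 : i + 1 < l.length := by omega
  have hxi := hiA.2
  have hyi := hiB.2
  rw [hgi _ hi1] at hxi
  rw [hgi _ (by omega)] at hyi
  have hsplit := List.take_append_drop (i + 1) l
  have hc' := hc
  rw [← hsplit, List.isChain_append] at hc'
  have e1 : (l.take (i + 1)).getLast? = some l[i] := by
    rw [List.getLast?_eq_getElem?, List.length_take, min_eq_left (by omega)]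
    simp
  have e2 : (l.drop (i + 1)).getLast? = some y := by
    rw [List.getLast?_drop, if_neg (by omega)]; exact hy
  have e3 : (l.take (i + 1)).head? = some x := by
    rw [List.head?_take]; simpa using hx
  have e4 : (l.drop (i + 1)).head? = some l[i + 1] := by
    rw [List.head?_drop, List.getElem?_eq_getElem hi1]
  refine ⟨l.take (i + 1) ++ (l.drop (i + 1)).reverse, ?_, ?_, ?_⟩
  · refine List.Perm.trans (List.Perm.append_left _ (List.reverse_perm _)) ?_
    rw [hsplit]
  · rw [List.isChain_append]
    refine ⟨hc'.1, ?_, ?_⟩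
    · rw [List.isChain_reverse]
      exact hc'.2.1.imp fun a b h => hH _ _ h
    · intro u hu v hv
      rw [e1] at hu
      rw [List.head?_reverse, e2] at hv
      simp only [Option.mem_def, Option.some.injEq] at hu hv
      subst hu hv
      exact hH _ _ hyi
  · intro u hu v hv
    rw [List.head?_append, e3] at hu
    rw [List.getLast?_append, List.getLast?_reverse, e4] at hv
    simp only [Option.mem_def, Option.some.injEq, Option.some_or] at hu hv
    subst hu hv
    exact hH _ _ hxi

/-- A cycle with a neighbour outside it gives a longer path. -/
theorem exists_path_of_cycle {c : List V} (hc : c.IsChain H) (hn : c.Nodup)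
    (hcl : ∀ u ∈ c.head?, ∀ v ∈ c.getLast?, H v u) {u w : V} (hu : u ∈ c) (hw : w ∉ c)
    (h : H w u) : ∃ l : List V, l.Nodup ∧ l.IsChain H ∧ l.length = c.length + 1 ∧
      ∀ v ∈ l, v = w ∨ v ∈ c := by
  obtain ⟨c1, c2, rfl⟩ := List.append_of_mem hu
  rw [List.isChain_append] at hc
  refine ⟨w :: ((u :: c2) ++ c1), ?_, ?_, ?_, ?_⟩
  · rw [List.nodup_cons]
    exact ⟨fun h' => hw (List.perm_append_comm.mem_iff.1 h'), List.perm_append_comm.nodup hn⟩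
  · rw [List.cons_append, List.isChain_cons_cons, ← List.cons_append]
    refine ⟨h, List.isChain_append.2 ⟨hc.2.1, hc.1, fun x hx y hy => hcl y ?_ x ?_⟩⟩
    · rw [List.head?_append]
      rw [Option.mem_def] at hy
      simp [hy]
    · rw [List.getLast?_append]
      rw [Option.mem_def] at hx
      simp [hx]
  · simp; omega
  · intro v hv
    rw [List.mem_cons] at hv
    exact hv.imp_right fun h' => List.perm_append_comm.mem_iff.1 h'

variable [Fintype V]

/-- The Erdős–Gallai theorem for paths. -/
theorem exists_path_of_card_lt {G : V → V → Prop} (hG : ∀ a b, G a b → G b a)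
    (hirr : ∀ a, ¬ G a a) {t : ℕ} {W₀ : Finset V}
    (h : (2 * t - 1 : ℝ) * #W₀ < edgesIn G W₀) :
    ∃ v : ℕ → V, (∀ i j, i ≤ 2 * t → j ≤ 2 * t → v i = v j → i = j) ∧
      ∀ i < 2 * t, G (v i) (v (i + 1)) := by
  obtain ⟨δ, hδ, hδc⟩ : ∃ δ > (0 : ℝ), (2 * t - 1 + δ) * #W₀ < edgesIn G W₀ := by
    refine ⟨(edgesIn G W₀ - (2 * t - 1) * #W₀) / (#W₀ + 1), by apply div_pos <;> [linarith; positivity], ?_⟩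
    set x := edgesIn G W₀ - (2 * t - 1) * #W₀ with hx
    have h1 : x / (#W₀ + 1) * #W₀ < x := by
      rw [div_mul_eq_mul_div, div_lt_iff₀ (by positivity)]
      nlinarith
    linarith
  obtain ⟨W, hW, hWd⟩ := exists_dense_core hG (2 * t - 1 + δ)
  obtain ⟨H, hHG⟩ : ∃ H : V → V → Prop, ∀ {a b}, H a b ↔ G a b ∧ a ∈ W ∧ b ∈ W :=
    ⟨fun a b => G a b ∧ a ∈ W ∧ b ∈ W, Iff.rfl⟩
  have hH : ∀ a b, H a b → H b a := fun a b h =>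
    hHG.2 ⟨hG _ _ (hHG.1 h).1, (hHG.1 h).2.2, (hHG.1 h).2.1⟩
  have hHirr : ∀ a, ¬ H a a := fun a h => hirr a (hHG.1 h).1
  have hdeg : ∀ a ∈ W, t ≤ #(univ.filter (H a)) := by
    intro a ha
    have h1 := hWd a ha
    have h2 : (cnt1 fun b => G a b ∧ b ∈ W) ≤ cnt1 (H a) :=
      cnt1_mono fun b hb => hHG.2 ⟨hb.1, ha, hb.2⟩
    have h3 : (2 * t - 1 : ℝ) < 2 * cnt1 (H a) := by linarith
    unfold cnt1 at h3
    have h4 : (2 * t : ℝ) < ((2 * #(univ.filter (H a)) + 1 : ℕ) : ℝ) := by push_cast; linarith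
    have h5 : 2 * t < 2 * #(univ.filter (H a)) + 1 := by exact_mod_cast h4
    omega
  have hout : ∀ U ⊆ W, U.Nonempty → #U ≤ 2 * t → ∃ u ∈ U, ∃ w, w ∉ U ∧ H w u := by
    intro U hUW hU hUc
    by_contra! hc
    have h1 := hW (W \ U)
    have h2 : edgesIn G W ≤ edgesIn G (W \ U) + edgesIn G U := by
      refine cnt2_le_add fun a b hab => ?_
      by_cases ha : a ∈ U <;> by_cases hb : b ∈ U
      · exact .inr ⟨hab.1, ha, hb⟩
      · exact absurd (hH _ _ (hHG.2 hab)) (hc a ha b hb)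
      · exact absurd (hHG.2 hab) (hc b hb a ha)
      · exact .inl ⟨hab.1, mem_sdiff.2 ⟨hab.2.1, ha⟩, mem_sdiff.2 ⟨hab.2.2, hb⟩⟩
    have h3 : edgesIn G U ≤ (2 * t - 1) * #U := by
      rw [← cnt1_mem]
      refine cnt2_le_mul (fun a b h => h.2.1) fun a ha => ?_
      refine (cnt1_le_of_mem (K := U.erase a) fun b hb => mem_erase.2 ⟨?_, hb.2.2⟩).trans ?_
      · rintro rfl; exact hirr _ hb.1
      · rw [card_erase_of_mem ha, Nat.cast_sub (card_pos.2 hU)]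
        have : (#U : ℝ) ≤ 2 * t := by exact_mod_cast hUc
        push_cast; linarith
    have h4 : (#(W \ U) : ℝ) = #W - #U := by
      rw [card_sdiff_of_subset hUW, Nat.cast_sub (card_le_card hUW)]
    have h5 : (0 : ℝ) < #U := by exact_mod_cast card_pos.2 hU
    rw [h4] at h1
    nlinarith
  have hWne : W.Nonempty := by
    by_contra! hne
    have h1 := hW W₀
    have h2 : edgesIn G W ≤ 0 := by
      rw [edgesIn, cnt2_eq_sum]
      refine sum_nonpos fun a _ => sum_nonpos fun b _ => le_of_eq (ind_false fun h => ?_)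
      simp [hne] at h
    simp [hne] at h1
    rw [← hne] at h1
    linarith
  obtain ⟨l, ⟨hln, hlc, hlW⟩, hlmax⟩ : ∃ l : List V, (l.Nodup ∧ l.IsChain H ∧ ∀ v ∈ l, v ∈ W) ∧
      ∀ l' : List V, (l'.Nodup ∧ l'.IsChain H ∧ ∀ v ∈ l', v ∈ W) → l'.length ≤ l.length := by
    set P : ℕ → Prop := fun k => ∃ l : List V,
      (l.Nodup ∧ l.IsChain H ∧ ∀ v ∈ l, v ∈ W) ∧ l.length = k with hP
    obtain ⟨l, hl, hk⟩ : P (Nat.findGreatest P (Fintype.card V)) :=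
      Nat.findGreatest_spec (Nat.zero_le _) ⟨[], by simp, rfl⟩
    refine ⟨l, hl, fun l' hl' => hk ▸ Nat.le_findGreatest ?_ ⟨l', hl', rfl⟩⟩
    rw [← List.toFinset_card_of_nodup hl'.1]
    exact card_le_univ _
  by_cases hlen : 2 * t + 1 ≤ l.length
  · obtain ⟨a, ha⟩ := hWne
    refine ⟨fun i => (l[i]?).getD a, fun i j hi hj hij => ?_, fun i hi => ?_⟩
    · simp only [List.getElem?_eq_getElem (show i < l.length by omega),
        List.getElem?_eq_getElem (show j < l.length by omega), Option.getD_some] at hij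
      exact (hln.getElem_inj_iff).1 hij
    · simp only [List.getElem?_eq_getElem (show i < l.length by omega),
        List.getElem?_eq_getElem (show i + 1 < l.length by omega), Option.getD_some]
      exact (hHG.1 (List.isChain_iff_getElem.1 hlc i (by omega))).1
  exfalso
  have hl0 : l ≠ [] := by
    rintro rfl
    obtain ⟨a, ha⟩ := hWne
    have := hlmax [a] ⟨by simp, by simp, by simpa using ha⟩
    simp at this
  have hend : ∀ l' : List V, l'.Perm l → l'.IsChain H → ∀ x ∈ l'.head?,
      t ≤ #(l.toFinset.filter (H x)) := by
    intro l' hp hc' x hx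
    have hxl : x ∈ l := hp.mem_iff.1 (List.mem_of_mem_head? hx)
    refine (hdeg x (hlW x hxl)).trans (card_le_card fun w hw => ?_)
    have hw' : H x w := (mem_filter.1 hw).2
    refine mem_filter.2 ⟨?_, hw'⟩
    by_contra hwl
    rw [List.mem_toFinset] at hwl
    have := hlmax (w :: l') ⟨?_, ?_, ?_⟩
    · rw [List.length_cons, hp.length_eq] at this; omega
    · exact List.nodup_cons.2 ⟨fun h => hwl (hp.mem_iff.1 h), hp.nodup_iff.2 hln⟩
    · rcases l' with _ | ⟨y, l'⟩
      · simp at hx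
      · simp only [List.head?_cons, Option.mem_def, Option.some.injEq] at hx
        subst hx
        exact List.isChain_cons_cons.2 ⟨hH _ _ hw', hc'⟩
    · intro v hv
      rcases List.mem_cons.1 hv with rfl | hv
      exacts [(hHG.1 hw').2.2, hlW _ (hp.mem_iff.1 hv)]
  obtain ⟨c, hcp, hcc, hcl⟩ := exists_cycle_of_path (t := t) hH hHirr hln hlc (by omega)
    (x := l.head hl0) (y := l.getLast hl0) (List.head_mem_head? hl0)
    (List.getLast_mem_getLast? hl0) (hend l (List.Perm.refl l) hlc _ (List.head_mem_head? hl0))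
    (hend l.reverse (List.reverse_perm l)
      (List.isChain_reverse.2 (hlc.imp fun a b h => hH _ _ h)) _
      (by rw [List.head?_reverse]; exact List.getLast_mem_getLast? hl0))
  obtain ⟨u, hu, w, hw, hwu⟩ := hout l.toFinset (fun v hv => hlW v (List.mem_toFinset.1 hv))
    ⟨l.head hl0, List.mem_toFinset.2 (List.head_mem hl0)⟩
    ((List.toFinset_card_le l).trans (by omega))
  rw [List.mem_toFinset] at hu hw
  obtain ⟨l', h1, h2, h3, h4⟩ := exists_path_of_cycle hcc (hcp.nodup_iff.2 hln) hcl
    (hcp.mem_iff.2 hu) (fun h => hw (hcp.mem_iff.1 h)) hwu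
  have := hlmax l' ⟨h1, h2, fun v hv => ?_⟩
  · rw [h3, hcp.length_eq] at this; omega
  · rcases h4 v hv with rfl | hv
    exacts [(hHG.1 hwu).2.1, hlW _ (hcp.mem_iff.1 hv)]

end Paths

end FanTuran

namespace FanTuran

open Finset
open scoped Classical

section Embedding

variable {V : Type} [Fintype V] {E : V → V → V → Prop} {t : ℕ} {T Z : Finset V}

/-- Every vertex of `Z` has many neighbours in `Z` whose common link with it contains `T`. -/
def Rich (E : V → V → V → Prop) (t : ℕ) (T Z : Finset V) : Prop :=
  ∀ z ∈ Z, ∀ Q : Finset V, #Q ≤ 10 * t + 10 → ∃ z' ∈ Z, z' ∉ Q ∧ T ⊆ nb E z z'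

theorem Rich.le_card_nb (hE : Sym3 E) (h : Rich E t T Z) {z τ : V} (hz : z ∈ Z) (hτ : τ ∈ T) :
    10 * t + 4 ≤ #(nb E τ z) := by
  by_contra! hc
  obtain ⟨z', -, hQ, hT⟩ := h z hz (nb E τ z) (by omega)
  exact hQ (mem_nb.2 (hE.rot' (mem_nb.1 (hT hτ))))

theorem Rich.notMem (hE : Sym3 E) (h : Rich E t T Z) {z : V} (hz : z ∈ Z) : z ∉ T := by
  intro hzT
  obtain ⟨z', -, -, hT⟩ := h z hz ∅ (by simp)
  exact hE.ne13 (mem_nb.1 (hT hzT)) rfl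

theorem FanFree.card_nb_lt_or (hE : Sym3 E) (hF : FanFree E t) (hT : #T = t) (hR : Rich E t T Z)
    (hZ : Z.Nonempty) {a b c τ : V} (h : E a b c) (ha : a ∉ T) (hb : b ∉ T) (hc : c ∉ T)
    (hτ : τ ∈ T) : #(nb E τ a) < 10 * t + 4 ∨ #(nb E τ b) < 10 * t + 4 := by
  by_contra! hd
  obtain ⟨e, he, heT⟩ := exists_enumeration (S := T.erase τ) (t := t)
    (by rw [card_erase_of_mem hτ, hT]) (notMem_erase τ T)
  have heT' : ∀ j : Fin t, j.val + 1 < t → e j ≠ τ ∧ e j ∈ T := fun j hj => mem_erase.1 (heT j hj)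
  have heabc : ∀ j : Fin t, j.val + 1 < t → e j ≠ a ∧ e j ≠ b ∧ e j ≠ c := fun j hj =>
    have := (heT' j hj).2
    ⟨fun h => ha (h ▸ this), fun h => hb (h ▸ this), fun h => hc (h ▸ this)⟩
  obtain ⟨A, hA, hAd⟩ := exists_disjoint_completion
    (fun j : Fin t => if j.val + 1 < t then {e j} else {a, b, c})
    (fun j A => IsPetal E τ A ∧ (j.val + 1 < t → IsCPetal E τ A)) (by
      intro i j hij
      by_cases hi : i.val + 1 < t <;> by_cases hj : j.val + 1 < t <;>
        simp only [hi, hj, if_true, if_false]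
      · simpa using fun h => hij (he h)
      · simpa using heabc i hi
      · have := heabc j hj
        simp only [disjoint_singleton_right, mem_insert, mem_singleton, not_or]
        exact this
      · exact absurd (Fin.ext (by omega)) hij)
    (fun j => by
      split_ifs
      · simp
      · exact card_le_three.trans (by norm_num))
    (fun j A h => h.1.card.le) (by
      intro j Q hQ hdis
      by_cases hj : j.val + 1 < t
      · simp only [hj, if_true, disjoint_singleton_left] at hdis
        obtain ⟨z, hz⟩ := hZ
        obtain ⟨a', ha', haQ, -⟩ := hR z hz Q (by omega)
        obtain ⟨b', hb', hbQ, hab⟩ := hR a' ha' Q (by omega)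
        obtain ⟨B, hB, hBQ⟩ := exists_petal_avoiding hE (mem_nb.1 (hab (heT' j hj).2))
          (heT' j hj).1 (hR.le_card_nb hE ha' hτ) (hR.le_card_nb hE hb' hτ) hQ haQ hbQ hdis
        exact ⟨B, ⟨hB.1, fun _ => hB.2 (hE.rot' (mem_nb.1 (hab hτ)))⟩, hBQ⟩
      · simp only [hj, if_false, disjoint_insert_left, disjoint_singleton_left] at hdis
        obtain ⟨B, hB, hBQ⟩ := exists_petal_avoiding hE h (fun h => hc (h ▸ hτ)) hd.1 hd.2 hQ
          hdis.1 hdis.2.1 hdis.2.2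
        exact ⟨B, ⟨hB.1, fun h' => absurd h' hj⟩, hBQ⟩)
  exact hF ⟨τ, A, hAd, fun j => (hA j).1, fun j hj => (hA j).2 hj⟩

/-- The positions of the `T`-vertices in the core of the `j`-th petal. -/
def coreT (t j : ℕ) : Finset ℕ :=
  if j < t / 2 then {2 * j, 2 * j + 1} else if j < 2 * (t / 2) then ∅ else {2 * (t / 2)}

/-- The positions of the path vertices in the core of the `j`-th petal. -/
def coreV (t j : ℕ) : Finset ℕ :=
  if j < t / 2 then ∅ else if j < 2 * (t / 2) then
    {4 * (j - t / 2), 4 * (j - t / 2) + 1, 4 * (j - t / 2) + 2, 4 * (j - t / 2) + 3}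
  else {4 * (t / 2), 4 * (t / 2) + 1, 4 * (t / 2) + 2}

theorem mem_coreT {t j x : ℕ} (hj : j < t) (h : x ∈ coreT t j) : x < t ∧
    ((j < t / 2 ∧ x / 2 = j) ∨ (j = 2 * (t / 2) ∧ x = 2 * (t / 2))) := by
  unfold coreT at h
  split_ifs at h <;> simp only [mem_insert, mem_singleton, notMem_empty] at h <;> omega

theorem mem_coreV {t j x : ℕ} (hj : j < t) (h : x ∈ coreV t j) : x ≤ 2 * t ∧
    t / 2 ≤ j ∧ x / 4 + t / 2 = j := by
  unfold coreV at h
  split_ifs at h <;> simp only [mem_insert, mem_singleton, notMem_empty] at h <;> omega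

theorem FanFree.no_path (hE : Sym3 E) (hF : FanFree E t) (hT : #T = t) (hR : Rich E t T Z)
    {z : V} (hz : z ∈ Z) (v : ℕ → V)
    (hv : ∀ i j, i ≤ 2 * t → j ≤ 2 * t → v i = v j → i = j)
    (hvT : ∀ i ≤ 2 * t, v i ∉ T) (hvZ : ∀ i ≤ 2 * t, v i ∉ Z)
    (hvE : ∀ i < 2 * t, E z (v i) (v (i + 1)))
    (hmany : ∀ i < 2 * t, ∀ Q : Finset V, #Q ≤ 10 * t + 10 →
      ∃ z' ∈ Z, z' ∉ Q ∧ E (v i) (v (i + 1)) z')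
    (hlast : ∀ i, i + 2 ≤ 2 * t → ∀ Q : Finset V, #Q ≤ 10 * t + 10 →
      ∃ z' ∈ Z, z' ∉ Q ∧ T ⊆ nb E z z' ∧ ∃ h ∈ ({v i, v (i + 1), v (i + 2)} : Finset V),
        ∃ w ∈ ({v i, v (i + 1), v (i + 2)} : Finset V), ∃ w',
          (w' ∈ ({v i, v (i + 1), v (i + 2)} : Finset V) ∨ w' ∉ Q) ∧ w' ∉ T ∧ w' ∉ Z ∧ w' ≠ w ∧
            E z h w ∧ E z' h w') : False := by
  have hZT : ∀ z ∈ Z, z ∉ T := fun z hz => hR.notMem hE hz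
  obtain ⟨τ, hτ, hτT⟩ : ∃ τ : ℕ → V, (∀ i j, i < t → j < t → τ i = τ j → i = j) ∧
      ∀ i < t, τ i ∈ T := by
    obtain ⟨f⟩ : Nonempty (Fin t ≃ T) :=
      ⟨Fintype.equivOfCardEq (by simp only [Fintype.card_fin, Fintype.card_coe, hT])⟩
    refine ⟨fun i => if h : i < t then f ⟨i, h⟩ else z, fun i j hi hj hij => ?_, fun i hi => ?_⟩
    · simp only [hi, hj, dif_pos] at hij
      simpa using f.injective (Subtype.ext hij)
    · simp only [hi, dif_pos]; exact (f _).2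
  have hcoreτ : ∀ i ∈ Z, ∀ τ ∈ T, i ≠ τ := fun i hi τ hτ h => hZT i hi (h ▸ hτ)
  refine Exists.elim (exists_disjoint_completion
    (fun j : Fin t => (coreT t j).image τ ∪ (coreV t j).image v)
    (fun j A => IsPetal E z A ∧ (j.val + 1 < t → IsCPetal E z A)) ?_ ?_ (fun j A h => h.1.card.le)
    ?_) fun A hA => hF ⟨z, A, hA.2, fun j => (hA.1 j).1, fun j hj => (hA.1 j).2 hj⟩
  · intro i j hij
    rw [disjoint_left]
    intro x hx hx'
    simp only [mem_union, mem_image] at hx hx'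
    have hij' : i.val ≠ j.val := fun h => hij (Fin.ext h)
    rcases hx with ⟨p, hp, rfl⟩ | ⟨p, hp, rfl⟩ <;> rcases hx' with ⟨q, hq, hpq⟩ | ⟨q, hq, hpq⟩
    · have h1 := mem_coreT i.2 hp
      have h2 := mem_coreT j.2 hq
      have := hτ _ _ h2.1 h1.1 hpq
      omega
    · exact hvT q (mem_coreV j.2 hq).1 (hpq ▸ hτT p (mem_coreT i.2 hp).1)
    · exact hvT p (mem_coreV i.2 hp).1 (hpq ▸ hτT q (mem_coreT j.2 hq).1)
    · have h1 := mem_coreV i.2 hp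
      have h2 := mem_coreV j.2 hq
      have := hv _ _ h2.1 h1.1 hpq
      omega
  · intro j
    refine (card_union_le _ _).trans ((add_le_add card_image_le card_image_le).trans ?_)
    unfold coreT coreV
    split_ifs
    · exact (add_le_add card_le_two (by simp : _ ≤ 0)).trans (by norm_num)
    · exact (add_le_add (by simp : _ ≤ 0) card_le_four).trans (by norm_num)
    · exact (add_le_add (by simp : _ ≤ 1) card_le_three).trans (by norm_num)
  · intro j Q hQ hdis
    have hjt := j.2
    by_cases hj1 : j.val < t / 2
    · -- two vertices of `T`
      simp only [coreT, coreV, hj1, if_true, image_insert, image_singleton, image_empty, union_empty,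
        disjoint_insert_left, disjoint_singleton_left] at hdis
      have ht1 := hτT (2 * j) (by omega)
      have ht2 := hτT (2 * j + 1) (by omega)
      obtain ⟨a, ha, haQ, hza⟩ := hR z hz Q (by omega)
      obtain ⟨y, hy, hyQ, hzy⟩ := hR z hz (insert a Q) ((card_insert_le _ _).trans (by omega))
      obtain ⟨w, hw, hwQ, haw⟩ := hR a ha (insert z (insert y Q))
        ((card_insert_le _ _).trans (by have := card_insert_le y Q; omega))
      simp only [mem_insert, not_or] at hyQ hwQ
      have hne : τ (2 * j) ≠ τ (2 * j + 1) := fun h => by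
        have := hτ _ _ (by omega) (by omega) h; omega
      have hp := isCPetal_mk hE (mem_nb.1 (hza ht2)) (mem_nb.1 (hza ht1))
        (hE.swap23 (mem_nb.1 (hzy ht2))) (hE.swap23 (mem_nb.1 (haw ht2))) hne hyQ.1
        (hcoreτ y hy _ ht1).symm (hcoreτ w hw _ ht1) hwQ.2.1 hwQ.1
      refine ⟨_, ⟨hp.isPetal, fun _ => hp⟩, ?_⟩
      simp [haQ, hyQ.2, hwQ.2.2, hdis]
    by_cases hj2 : j.val < 2 * (t / 2)
    · -- four path vertices
      set k := 4 * (j.val - t / 2) with hk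
      have hk3 : k + 3 ≤ 2 * t := by omega
      simp only [coreT, coreV, hj1, hj2, if_true, if_false, image_insert, image_singleton,
        image_empty, empty_union, disjoint_insert_left, disjoint_singleton_left, ← hk] at hdis
      obtain ⟨w, hw, hwQ, hE'⟩ := hmany (k + 1) (by omega) (insert z Q)
        ((card_insert_le _ _).trans (by omega))
      simp only [mem_insert, not_or] at hwQ
      have hne : ∀ a b, a ≤ 2 * t → b ≤ 2 * t → a ≠ b → v a ≠ v b := fun a b ha hb hab h =>
        hab (hv a b ha hb h)
      have hwv : ∀ a ≤ 2 * t, w ≠ v a := fun a ha h => hvZ a ha (h ▸ hw)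
      have hp := isCPetal_mk hE (hvE (k + 1) (by omega)) (hE.swap23 (hvE k (by omega)))
        (hvE (k + 2) (by omega)) hE' (hne _ _ (by omega) (by omega) (by omega))
        (hne _ _ (by omega) (by omega) (by omega)) (hne _ _ (by omega) (by omega) (by omega))
        (hwv _ (by omega)) (hwv _ (by omega)) hwQ.1
      refine ⟨_, ⟨hp.isPetal, fun _ => hp⟩, ?_⟩
      simp [hwQ.2, hdis]
    · -- one vertex of `T` and three path vertices
      set k := 4 * (t / 2) with hk
      have ht1 := hτT (2 * (t / 2)) (by omega)
      simp only [coreT, coreV, hj1, hj2, if_false, disjoint_union_left, image_singleton,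
        disjoint_singleton_left, ← hk] at hdis
      obtain ⟨z', hz', hzQ, hzz, h, hh, w, hw, w', hw', hwT, hwZ, hww, e1, e2⟩ :=
        hlast k (by omega) Q (by omega)
      have himg : (({k, k + 1, k + 2} : Finset ℕ).image v) = {v k, v (k + 1), v (k + 2)} := by
        simp [image_insert]
      rw [himg] at hdis
      have hq : ∀ u ∈ ({v k, v (k + 1), v (k + 2)} : Finset V), u ∉ Q ∧ u ∉ T ∧ u ∉ Z := by
        intro u hu
        refine ⟨disjoint_left.1 hdis.2 hu, ?_⟩
        simp only [mem_insert, mem_singleton] at hu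
        rcases hu with rfl | rfl | rfl
        exacts [⟨hvT _ (by omega), hvZ _ (by omega)⟩, ⟨hvT _ (by omega), hvZ _ (by omega)⟩,
          ⟨hvT _ (by omega), hvZ _ (by omega)⟩]
      have hw'Q : w' ∉ Q := hw'.elim (fun h => (hq _ h).1) id
      have hp := isPetal_mk hE (mem_nb.1 (hzz ht1)) e1 e2 (fun h' => (hq h hh).2.1 (h' ▸ ht1))
        (fun h' => (hq w hw).2.2 (h' ▸ hz')) (fun h' => (hq w hw).2.1 (h' ▸ ht1))
        (fun h' => hwT (h' ▸ ht1)) hww (fun h' => hwZ (h' ▸ hz))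
      refine ⟨_, ⟨hp, fun h' => by omega⟩, ?_⟩
      simp [hzQ, (hq h hh).1, (hq w hw).1, hdis.1, hw'Q]

end Embedding

end FanTuran

namespace FanTuran

open Finset
open scoped Classical

section NearExtremal

variable {V : Type} [Fintype V] {E : V → V → V → Prop} {t : ℕ} {T Z W : Finset V}

theorem cnt3_rot (P : V → V → V → Prop) : cnt3 (fun a b c => P b c a) = cnt3 P :=
  (cnt3_swap12 fun a b c => P a c b).trans (cnt3_swap23 P)

theorem cnt2_mem_le (W : Finset V) : cnt2 (fun a b => a ∈ W ∧ b ∈ W) ≤ (#W : ℝ) ^ 2 := by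
  have := cnt2_le_mul (P := fun a b => a ∈ W ∧ b ∈ W) (p := fun a => a ∈ W) (C := #W)
    (fun a b h => h.1) fun a _ => cnt1_le_of_mem fun b hb => hb.2
  rwa [cnt1_mem, ← sq] at this

/-- The vertices outside `T` and `Z` having small codegree with all of `T`. -/
noncomputable def lowVertices (E : V → V → V → Prop) (t : ℕ) (T Z : Finset V) : Finset V :=
  univ.filter fun w => w ∉ T ∧ w ∉ Z ∧ ∀ τ ∈ T, #(nb E τ w) < 10 * t + 4

theorem mem_lowVertices {w : V} : w ∈ lowVertices E t T Z ↔
    w ∉ T ∧ w ∉ Z ∧ ∀ τ ∈ T, #(nb E τ w) < 10 * t + 4 := by simp [lowVertices]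

theorem FanFree.mem_lowVertices_of_edge (ht : 1 ≤ t) (hE : Sym3 E) (hF : FanFree E t) (hT : #T = t)
    (hR : Rich E t T Z) {a b c : V} (h : E a b c) (ha : a ∈ Z) (hb : b ∉ T) (hc : c ∉ T) :
    b ∈ lowVertices E t T Z := by
  have key : ∀ τ ∈ T, #(nb E τ b) < 10 * t + 4 := fun τ hτ =>
    (hF.card_nb_lt_or hE hT hR ⟨a, ha⟩ h (hR.notMem hE ha) hb hc hτ).resolve_left
      (by have := hR.le_card_nb hE ha hτ; omega)
  obtain ⟨τ, hτ⟩ : T.Nonempty := card_pos.1 (by omega)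
  refine mem_lowVertices.2 ⟨hb, fun hbZ => ?_, key⟩
  have := key τ hτ
  have := hR.le_card_nb hE hbZ hτ
  omega

theorem FanFree.cnt3_avoid_le (ht : 1 ≤ t) (hE : Sym3 E) (hF : FanFree E t) (hT : #T = t)
    (hR : Rich E t T Z) :
    cnt3 (fun a b c => E a b c ∧ a ∉ T ∧ b ∉ T ∧ c ∉ T) ≤
      3 * cnt3 (fun a b c => a ∈ Z ∧ b ∈ lowVertices E t T Z ∧ c ∈ lowVertices E t T Z ∧ E a b c) +
        3 * peelDeg t * (#(univ.filter fun v => v ∉ T ∧ v ∉ Z) : ℝ) ^ 2 := by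
  set R := univ.filter fun v => v ∉ T ∧ v ∉ Z with hRdef
  have hB : Sym3 (fun a b c => E a b c ∧ a ∉ T ∧ b ∉ T ∧ c ∉ T) :=
    ⟨fun h => ⟨hE.swap12 h.1, h.2.2.1, h.2.1, h.2.2.2⟩,
      fun h => ⟨hE.swap23 h.1, h.2.1, h.2.2.2, h.2.2.1⟩, fun h => hE.ne12 h.1⟩
  have hB' : Sym3 (fun a b c => E a b c ∧ a ∈ R ∧ b ∈ R ∧ c ∈ R) :=
    ⟨fun h => ⟨hE.swap12 h.1, h.2.2.1, h.2.1, h.2.2.2⟩,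
      fun h => ⟨hE.swap23 h.1, h.2.1, h.2.2.2, h.2.2.1⟩, fun h => hE.ne12 h.1⟩
  have h1 := cnt3_le_add (P := fun a b c => E a b c ∧ a ∉ T ∧ b ∉ T ∧ c ∉ T)
    (Q := fun a b c => (E a b c ∧ a ∉ T ∧ b ∉ T ∧ c ∉ T) ∧ (a ∈ Z ∨ b ∈ Z ∨ c ∈ Z))
    (R := fun a b c => E a b c ∧ a ∈ R ∧ b ∈ R ∧ c ∈ R) (by
      intro a b c h
      by_cases hz : a ∈ Z ∨ b ∈ Z ∨ c ∈ Z
      · exact .inl ⟨h, hz⟩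
      · push Not at hz
        simp only [hRdef, mem_filter, mem_univ, true_and]
        exact .inr ⟨h.1, ⟨h.2.1, hz.1⟩, ⟨h.2.2.1, hz.2.1⟩, h.2.2.2, hz.2.2⟩)
  have h2 := cnt3_vertex_le hB (q := fun a => a ∈ Z)
  have h3 := cnt3_mono (P := fun a b c => (E a b c ∧ a ∉ T ∧ b ∉ T ∧ c ∉ T) ∧ a ∈ Z)
    (Q := fun a b c => a ∈ Z ∧ b ∈ lowVertices E t T Z ∧ c ∈ lowVertices E t T Z ∧ E a b c)
    fun a b c h => ⟨h.2, hF.mem_lowVertices_of_edge ht hE hT hR h.1.1 h.2 h.1.2.2.1 h.1.2.2.2,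
      hF.mem_lowVertices_of_edge ht hE hT hR (hE.swap23 h.1.1) h.2 h.1.2.2.2 h.1.2.2.1, h.1.1⟩
  have h4 := hF.cnt3_le_shadow hE hB' fun a b c h => h.1
  have h5 : cnt2 (fun a b => ∃ c, E a b c ∧ a ∈ R ∧ b ∈ R ∧ c ∈ R) ≤ (#R : ℝ) ^ 2 :=
    (cnt2_mono fun a b ⟨c, h⟩ => ⟨h.2.1, h.2.2.1⟩).trans (cnt2_mem_le R)
  have h6 : 3 * (peelDeg t : ℝ) * cnt2 (fun a b => ∃ c, E a b c ∧ a ∈ R ∧ b ∈ R ∧ c ∈ R) ≤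
      3 * peelDeg t * (#R : ℝ) ^ 2 := by gcongr
  linarith

theorem card_sub_le_cnt1 (Q : Finset V) (p : V → Prop) :
    cnt1 p - #Q ≤ cnt1 fun a => p a ∧ a ∉ Q := by
  have := cnt1_le_add (p := p) (q := fun a => p a ∧ a ∉ Q) (r := fun a => a ∈ Q)
    fun a h => by by_cases ha : a ∈ Q <;> simp [ha, h]
  rw [cnt1_mem] at this
  linarith

/-- The triples meeting `T` that are not edges. -/
def Missing (E : V → V → V → Prop) (T : Finset V) (a b c : V) : Prop :=
  (a ≠ b ∧ a ≠ c ∧ b ≠ c) ∧ (a ∈ T ∨ b ∈ T ∨ c ∈ T) ∧ ¬ E a b c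

theorem three_mul_le_cnt3_missing (hE : Sym3 E) :
    3 * cnt3 (fun a b c => Missing E T a b c ∧ a ∈ T ∧ b ∉ T ∧ c ∉ T) ≤ cnt3 (Missing E T) := by
  have h12 : ∀ {a b c}, Missing E T a b c → Missing E T b a c := fun h =>
    ⟨⟨h.1.1.symm, h.1.2.2, h.1.2.1⟩, by have := h.2.1; tauto, fun h' => h.2.2 (hE.swap12 h')⟩
  have h23 : ∀ {a b c}, Missing E T a b c → Missing E T a c b := fun h =>
    ⟨⟨h.1.2.1, h.1.1, h.1.2.2.symm⟩, by have := h.2.1; tauto, fun h' => h.2.2 (hE.swap23 h')⟩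
  have e1 : cnt3 (fun a b c => Missing E T a b c ∧ b ∈ T ∧ a ∉ T ∧ c ∉ T) =
      cnt3 (fun a b c => Missing E T a b c ∧ a ∈ T ∧ b ∉ T ∧ c ∉ T) := by
    rw [← cnt3_swap12]
    congr; ext a b c; exact and_congr_left fun _ => ⟨h12, h12⟩
  have e2 : cnt3 (fun a b c => Missing E T a b c ∧ c ∈ T ∧ a ∉ T ∧ b ∉ T) =
      cnt3 (fun a b c => Missing E T a b c ∧ b ∈ T ∧ a ∉ T ∧ c ∉ T) := by
    rw [← cnt3_swap23]
    congr; ext a b c; exact and_congr_left fun _ => ⟨h23, h23⟩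
  have s1 := cnt3_add_le (P := fun a b c => Missing E T a b c ∧ a ∈ T ∧ b ∉ T ∧ c ∉ T)
    (Q := fun a b c => Missing E T a b c ∧ b ∈ T ∧ a ∉ T ∧ c ∉ T)
    (R := fun a b c => Missing E T a b c ∧ c ∉ T)
    (fun a b c h => ⟨h.1, h.2.2.2⟩) (fun a b c h => ⟨h.1, h.2.2.2⟩)
    fun a b c h h' => h.2.2.1 h'.2.1
  have s2 := cnt3_add_le (P := fun a b c => Missing E T a b c ∧ c ∉ T)
    (Q := fun a b c => Missing E T a b c ∧ c ∈ T ∧ a ∉ T ∧ b ∉ T)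
    (R := Missing E T) (fun a b c h => h.1) (fun a b c h => h.1) fun a b c h h' => h.2 h'.2.1
  linarith

theorem le_cnt3_missing (hE : Sym3 E) (hZT : Disjoint Z T) {U : Finset V} (hWT : Disjoint W T)
    (hWZ : Disjoint W Z) (hUT : Disjoint U T) (hUZ : Disjoint U Z) (hUW : Disjoint U W)
    {d : ℕ} (hW : ∀ w ∈ W, ∀ τ ∈ T, #(nb E τ w) ≤ d) {g : ℝ}
    (hU : ∀ v ∈ U, g ≤ cnt1 (fun u => ¬ T ⊆ nb E v u)) :
    3 * (2 * (((#Z : ℝ) - d) * (#W * #T)) + (g - (1 + #T)) * #U) ≤ cnt3 (Missing E T) := by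
  refine le_trans (mul_le_mul_of_nonneg_left ?_ (by norm_num)) (three_mul_le_cnt3_missing hE)
  rw [disjoint_left] at *
  have a1 : ((#Z : ℝ) - d) * (#W * #T) ≤
      cnt3 (fun τ w z => τ ∈ T ∧ w ∈ W ∧ z ∈ Z ∧ ¬ E τ w z) := by
    by_cases hneg : (#Z : ℝ) - d ≤ 0
    · exact (mul_nonpos_of_nonpos_of_nonneg hneg (by positivity)).trans (cnt3_nonneg _)
    have h1 : (#W : ℝ) * #T ≤ cnt2 (fun τ w => τ ∈ T ∧ w ∈ W) := by
      rw [← cnt1_mem T]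
      exact mul_cnt1_le_cnt2 fun τ hτ => by
        rw [← cnt1_mem W]; exact cnt1_mono fun w hw => ⟨hτ, hw⟩
    refine (mul_le_mul_of_nonneg_left h1 (by linarith)).trans (mul_cnt2_le_cnt3 fun τ w h => ?_)
    have h2 := card_sub_le_cnt1 (nb E τ w) (fun z => z ∈ Z)
    rw [cnt1_mem] at h2
    have h3 : (#(nb E τ w) : ℝ) ≤ d := by exact_mod_cast hW w h.2 τ h.1
    have h4 := cnt1_mono (p := fun a => a ∈ Z ∧ a ∉ nb E τ w)
      (q := fun z => τ ∈ T ∧ w ∈ W ∧ z ∈ Z ∧ ¬ E τ w z)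
      fun z hz => ⟨h.1, h.2, hz.1, fun h' => hz.2 (mem_nb.2 h')⟩
    linarith
  have a2 : cnt3 (fun τ z w => τ ∈ T ∧ w ∈ W ∧ z ∈ Z ∧ ¬ E τ w z) =
      cnt3 (fun τ w z => τ ∈ T ∧ w ∈ W ∧ z ∈ Z ∧ ¬ E τ w z) :=
    cnt3_swap23 fun τ w z => τ ∈ T ∧ w ∈ W ∧ z ∈ Z ∧ ¬ E τ w z
  have a3 : (g - (1 + #T)) * #U ≤
      cnt3 (fun τ v u => τ ∈ T ∧ v ∈ U ∧ u ∉ T ∧ u ≠ v ∧ ¬ E τ v u) := by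
    refine le_trans ?_ (cnt2_exists_le _)
    rw [← cnt1_mem U]
    refine mul_cnt1_le_cnt2 fun v hv => ?_
    have h1 := card_sub_le_cnt1 (insert v T) (fun u => ¬ T ⊆ nb E v u)
    have h2 : (#(insert v T) : ℝ) ≤ 1 + #T := by
      have := card_insert_le v T
      exact_mod_cast (by omega : #(insert v T) ≤ 1 + #T)
    have h3 := cnt1_mono (p := fun u => ¬ T ⊆ nb E v u ∧ u ∉ insert v T)
      (q := fun u => ∃ τ, τ ∈ T ∧ v ∈ U ∧ u ∉ T ∧ u ≠ v ∧ ¬ E τ v u) (by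
        rintro u ⟨hu, hu'⟩
        obtain ⟨τ, hτ, hn⟩ := not_subset.1 hu
        simp only [mem_insert, not_or] at hu'
        exact ⟨τ, hτ, hv, hu'.2, hu'.1, fun h => hn (mem_nb.2 (hE.rot h))⟩)
    have := hU v hv
    linarith
  have s1 := cnt3_add_le (P := fun τ w z => τ ∈ T ∧ w ∈ W ∧ z ∈ Z ∧ ¬ E τ w z)
    (Q := fun τ z w => τ ∈ T ∧ w ∈ W ∧ z ∈ Z ∧ ¬ E τ w z)
    (R := fun a b c => (Missing E T a b c ∧ a ∈ T ∧ b ∉ T ∧ c ∉ T) ∧ b ∉ U)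
    (by
      rintro τ w z ⟨h1, h2, h3, h4⟩
      exact ⟨⟨⟨⟨fun h => hWT h2 (h ▸ h1), fun h => hZT h3 (h ▸ h1), fun h => hWZ h2 (h ▸ h3)⟩,
        .inl h1, h4⟩, h1, hWT h2, hZT h3⟩, fun h => hUW h h2⟩)
    (by
      rintro τ z w ⟨h1, h2, h3, h4⟩
      exact ⟨⟨⟨⟨fun h => hZT h3 (h ▸ h1), fun h => hWT h2 (h ▸ h1), fun h => hWZ h2 (h ▸ h3)⟩,
        .inl h1, fun h => h4 (hE.swap23 h)⟩, h1, hZT h3, hWT h2⟩, fun h => hUZ h h3⟩)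
    fun a b c h h' => hWZ h.2.1 h'.2.2.1
  have s2 := cnt3_add_le (P := fun a b c => (Missing E T a b c ∧ a ∈ T ∧ b ∉ T ∧ c ∉ T) ∧ b ∉ U)
    (Q := fun τ v u => τ ∈ T ∧ v ∈ U ∧ u ∉ T ∧ u ≠ v ∧ ¬ E τ v u)
    (R := fun a b c => Missing E T a b c ∧ a ∈ T ∧ b ∉ T ∧ c ∉ T) (fun a b c h => h.1)
    (by
      rintro τ v u ⟨h1, h2, h3, h4, h5⟩
      exact ⟨⟨⟨fun h => hUT h2 (h ▸ h1), fun h => h3 (h ▸ h1), h4.symm⟩, .inl h1, h5⟩,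
        h1, hUT h2, h3⟩)
    fun a b c h h' => h.2 h'.2.1
  linarith

end NearExtremal

end FanTuran

namespace FanTuran

open Finset
open scoped Classical

section LinkPaths

variable {V : Type} [Fintype V] {E : V → V → V → Prop} {t : ℕ} {T Z W : Finset V}

/-- The number of vertices of `Z` forming an edge with a given pair. -/
noncomputable def codegIn (E : V → V → V → Prop) (Z : Finset V) (a b : V) : ℝ :=
  cnt1 fun z => z ∈ Z ∧ E z a b

theorem codegIn_comm (hE : Sym3 E) (a b : V) : codegIn E Z a b = codegIn E Z b a :=
  le_antisymm (cnt1_mono fun _ h => ⟨h.1, hE.swap23 h.2⟩)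
    (cnt1_mono fun _ h => ⟨h.1, hE.swap23 h.2⟩)

/-- A pair in `W` whose number of common neighbours in `Z` is neither tiny nor above `g`. -/
def Poor (E : V → V → V → Prop) (t : ℕ) (Z W : Finset V) (g : ℝ) (a b : V) : Prop :=
  a ∈ W ∧ b ∈ W ∧ 10 * t + 11 ≤ codegIn E Z a b ∧ codegIn E Z a b ≤ g

theorem Poor.symm (hE : Sym3 E) {g : ℝ} {a b : V} (h : Poor E t Z W g a b) :
    Poor E t Z W g b a := by
  unfold Poor at *
  rw [codegIn_comm hE b a]
  exact ⟨h.2.1, h.1, h.2.2⟩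

/-- The poor pairs at `a` cover at most `l` vertices of `Z`. -/
def Low (E : V → V → V → Prop) (t : ℕ) (Z W : Finset V) (g l : ℝ) (a : V) : Prop :=
  cnt1 (fun z => z ∈ Z ∧ ∃ b, Poor E t Z W g a b ∧ E z a b) ≤ l

theorem FanFree.cnt3_low_le (hE : Sym3 E) (hF : FanFree E t) {g l : ℝ} (hl : 0 ≤ l) :
    cnt3 (fun z a b => z ∈ Z ∧ E z a b ∧ Poor E t Z W g a b ∧ Low E t Z W g l a ∧
      Low E t Z W g l b) ≤ 3 * peelDeg t * ((#W : ℝ) ^ 2 + 2 * (l * #W)) := by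
  set K : V → V → V → Prop := fun z a b => z ∈ Z ∧ Poor E t Z W g a b ∧ Low E t Z W g l a ∧
    Low E t Z W g l b with hK
  have hKs : ∀ {z a b}, K z a b → K z b a := fun h => ⟨h.1, h.2.1.symm hE, h.2.2.2, h.2.2.1⟩
  have hS : Sym3 (fun a b c => E a b c ∧ (K a b c ∨ K b a c ∨ K c a b)) :=
    ⟨fun h => ⟨hE.swap12 h.1, h.2.elim (fun h => .inr (.inl h))
        fun h => h.elim .inl fun h => .inr (.inr (hKs h))⟩,
      fun h => ⟨hE.swap23 h.1, h.2.elim (fun h => .inl (hKs h))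
        fun h => h.elim (fun h => .inr (.inr h)) fun h => .inr (.inl h)⟩,
      fun h => hE.ne12 h.1⟩
  have h1 := hF.cnt3_le_shadow hE hS fun a b c h => h.1
  have h2 : cnt2 (fun a b => ∃ c, E a b c ∧ (K a b c ∨ K b a c ∨ K c a b)) ≤
      (#W : ℝ) ^ 2 + 2 * (l * #W) := by
    have e1 : cnt2 (fun a z => a ∈ W ∧ Low E t Z W g l a ∧ z ∈ Z ∧
        ∃ b, Poor E t Z W g a b ∧ E z a b) ≤ l * #W := by
      have l0 : cnt1 (fun a => a ∈ W ∧ Low E t Z W g l a) ≤ #W :=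
        cnt1_le_of_mem fun a h => h.1
      exact (cnt2_le_mul (p := fun a => a ∈ W ∧ Low E t Z W g l a) (C := l)
        (fun a z h => ⟨h.1, h.2.1⟩) fun a h => (cnt1_mono fun z hz => hz.2.2).trans h.2).trans
        (mul_le_mul_of_nonneg_left l0 hl)
    have e2 := cnt2_swap fun a z => a ∈ W ∧ Low E t Z W g l a ∧ z ∈ Z ∧
        ∃ b, Poor E t Z W g a b ∧ E z a b
    have e3 := cnt2_le_add (P := fun a b => ∃ c, E a b c ∧ (K a b c ∨ K b a c ∨ K c a b))
      (Q := fun a b => a ∈ W ∧ b ∈ W)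
      (R := fun a b => (a ∈ W ∧ Low E t Z W g l a ∧ b ∈ Z ∧
        ∃ c, Poor E t Z W g a c ∧ E b a c) ∨ (b ∈ W ∧ Low E t Z W g l b ∧ a ∈ Z ∧
        ∃ c, Poor E t Z W g b c ∧ E a b c)) (by
        rintro a b ⟨c, h, h' | h' | h'⟩
        · exact .inr (.inr ⟨h'.2.1.1, h'.2.2.1, h'.1, c, h'.2.1, h⟩)
        · exact .inr (.inl ⟨h'.2.1.1, h'.2.2.1, h'.1, c, h'.2.1, hE.swap12 h⟩)
        · exact .inl ⟨h'.2.1.1, h'.2.1.2.1⟩)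
    have e4 := cnt2_or (fun a b => a ∈ W ∧ Low E t Z W g l a ∧ b ∈ Z ∧
        ∃ c, Poor E t Z W g a c ∧ E b a c) (fun a b => b ∈ W ∧ Low E t Z W g l b ∧ a ∈ Z ∧
        ∃ c, Poor E t Z W g b c ∧ E a b c)
    have e5 := cnt2_mem_le W
    linarith
  have h3 : cnt3 (fun z a b => z ∈ Z ∧ E z a b ∧ Poor E t Z W g a b ∧ Low E t Z W g l a ∧
      Low E t Z W g l b) ≤ cnt3 (fun a b c => E a b c ∧ (K a b c ∨ K b a c ∨ K c a b)) :=
    cnt3_mono fun a b c h => ⟨h.2.1, .inl ⟨h.1, h.2.2⟩⟩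
  have h4 : 3 * (peelDeg t : ℝ) * cnt2 (fun a b => ∃ c, E a b c ∧ (K a b c ∨ K b a c ∨ K c a b)) ≤
      3 * peelDeg t * ((#W : ℝ) ^ 2 + 2 * (l * #W)) := by gcongr
  linarith

theorem exists_of_card_lt_cnt1 {p : V → Prop} {Q : Finset V} (h : (#Q : ℝ) < cnt1 p) :
    ∃ a, p a ∧ a ∉ Q := by
  by_contra! hc
  exact absurd (cnt1_le_of_mem hc) (not_le.2 h)

/-- The link edges of `z` in `W` that can be used for building long paths. -/
def Useful (E : V → V → V → Prop) (t : ℕ) (Z W : Finset V) (g l : ℝ) (z a b : V) : Prop :=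
  E z a b ∧ a ∈ W ∧ b ∈ W ∧ 10 * t + 11 ≤ codegIn E Z a b ∧
    (g < codegIn E Z a b ∨ ¬ Low E t Z W g l a ∨ ¬ Low E t Z W g l b)

theorem Useful.symm (hE : Sym3 E) {g l : ℝ} {z a b : V} (h : Useful E t Z W g l z a b) :
    Useful E t Z W g l z b a := by
  unfold Useful at *
  rw [codegIn_comm hE b a]
  exact ⟨hE.swap23 h.1, h.2.2.1, h.2.1, h.2.2.2.1, h.2.2.2.2.imp_right Or.symm⟩

theorem exists_of_not_low {g d l : ℝ} {a z : V} (hd : cnt1 (fun z' => ¬ T ⊆ nb E z z') ≤ d)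
    (hg : 0 ≤ g) (hl : d + (10 * t + 10) + (10 * t + 11) * g ≤ l) (h : ¬ Low E t Z W g l a)
    {Q : Finset V} (hQ : #Q ≤ 10 * t + 10) (b : V) :
    ∃ z' ∈ Z, z' ∉ Q ∧ T ⊆ nb E z z' ∧ ∃ b', b' ∉ Q ∧ b' ∈ W ∧ b' ≠ b ∧ E z' a b' := by
  by_contra! hc
  apply h
  have h1 := cnt1_le_add (p := fun z => z ∈ Z ∧ ∃ b, Poor E t Z W g a b ∧ E z a b)
    (q := fun z' => ¬ T ⊆ nb E z z' ∨ z' ∈ Q)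
    (r := fun z' => ∃ b', b' ∈ insert b Q ∧ Poor E t Z W g a b' ∧ z' ∈ Z ∧ E z' a b') (by
      rintro z' ⟨hz', b', hb', he⟩
      by_contra! hn
      have hb : b' ∉ insert b Q := fun h => hn.2 b' h hb' hz' he
      simp only [mem_insert, not_or] at hb
      exact hc z' hz' hn.1.2 hn.1.1 b' hb.2 hb'.2.1 hb.1 he)
  have h2 := cnt1_or (fun z' => ¬ T ⊆ nb E z z') (fun z' => z' ∈ Q)
  rw [cnt1_mem] at h2
  have h3 : cnt1 (fun z' => ∃ b', b' ∈ insert b Q ∧ Poor E t Z W g a b' ∧ z' ∈ Z ∧ E z' a b') ≤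
      g * #(insert b Q) := by
    rw [← cnt1_mem (insert b Q)]
    refine le_trans ?_ (cnt2_le_mul (P := fun b' z' => b' ∈ insert b Q ∧ Poor E t Z W g a b' ∧
      z' ∈ Z ∧ E z' a b') (p := fun b' => b' ∈ insert b Q) (fun b' z' h => h.1) fun b' _ => ?_)
    · rw [← cnt2_swap]
      simpa using mul_cnt1_le_cnt2 (C := 1)
        (P := fun z' b' => b' ∈ insert b Q ∧ Poor E t Z W g a b' ∧ z' ∈ Z ∧ E z' a b')
        (p := fun z' => ∃ b', b' ∈ insert b Q ∧ Poor E t Z W g a b' ∧ z' ∈ Z ∧ E z' a b')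
        fun z' ⟨b', h⟩ => by
          rw [← cnt1_eq_one b']; exact cnt1_mono fun x hx => hx ▸ h
    · by_cases hp : Poor E t Z W g a b'
      · exact (cnt1_mono fun z' h => h.2.2).trans hp.2.2.2
      · exact (cnt1_le_zero fun z' h => hp h.2.1).trans hg
  have h4 : (#Q : ℝ) ≤ 10 * t + 10 := by exact_mod_cast hQ
  have h5 : (#(insert b Q) : ℝ) ≤ 10 * t + 11 := by
    have := card_insert_le b Q
    exact_mod_cast (by omega : #(insert b Q) ≤ 10 * t + 11)
  have h6 := mul_le_mul_of_nonneg_left h5 hg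
  exact h1.trans (by linarith)

theorem FanFree.edgesIn_useful_le (ht : 1 ≤ t) (hE : Sym3 E) (hF : FanFree E t) (hT : #T = t)
    (hR : Rich E t T Z) (hW : ∀ w ∈ W, w ∉ T ∧ w ∉ Z) {g d l : ℝ} {z : V} (hz : z ∈ Z)
    (hd : cnt1 (fun z' => ¬ T ⊆ nb E z z') ≤ d) (hg : d + (10 * t + 10) ≤ g)
    (hl : d + (10 * t + 10) + (10 * t + 11) * g ≤ l) :
    edgesIn (Useful E t Z W g l z) W ≤ (2 * t - 1) * #W := by
  by_contra! hc
  have hd0 := (cnt1_nonneg _).trans hd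
  have hg0 : 0 ≤ g := le_trans (by positivity) hg
  obtain ⟨v, hv, hvu⟩ := exists_path_of_card_lt (fun a b h => h.symm hE)
    (fun a h => hE.ne23 h.1 rfl) hc
  have hvW : ∀ i ≤ 2 * t, v i ∈ W := by
    intro i hi
    rcases hi.lt_or_eq with h | rfl
    · exact (hvu i h).2.1
    · have := (hvu (2 * t - 1) (by omega)).2.2.1
      rwa [Nat.sub_add_cancel (by omega)] at this
  refine hF.no_path hE hT hR hz v hv (fun i hi => (hW _ (hvW i hi)).1)
    (fun i hi => (hW _ (hvW i hi)).2) (fun i hi => (hvu i hi).1) (fun i hi Q hQ => ?_)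
    fun i hi Q hQ => ?_
  · have h1 : (#Q : ℝ) < codegIn E Z (v i) (v (i + 1)) :=
      lt_of_lt_of_le (by exact_mod_cast (by omega : #Q < 10 * t + 11)) (hvu i hi).2.2.2.1
    obtain ⟨z', hz', hQz⟩ := exists_of_card_lt_cnt1 h1
    exact ⟨z', hz'.1, hQz, hE.rot hz'.2⟩
  · have h0 := hvu i (by omega)
    have h1 := hvu (i + 1) (by omega)
    rw [show i + 1 + 1 = i + 2 from rfl] at h1
    have main : ∀ h ∈ ({v i, v (i + 1), v (i + 2)} : Finset V),
        ∀ w ∈ ({v i, v (i + 1), v (i + 2)} : Finset V), E z h w → ¬ Low E t Z W g l h →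
        ∃ z' ∈ Z, z' ∉ Q ∧ T ⊆ nb E z z' ∧ ∃ h ∈ ({v i, v (i + 1), v (i + 2)} : Finset V),
        ∃ w ∈ ({v i, v (i + 1), v (i + 2)} : Finset V), ∃ w',
          (w' ∈ ({v i, v (i + 1), v (i + 2)} : Finset V) ∨ w' ∉ Q) ∧ w' ∉ T ∧ w' ∉ Z ∧ w' ≠ w ∧
            E z h w ∧ E z' h w' := by
      intro h hh w hw he hlow
      obtain ⟨z', hz', hzQ, hzT, b', hbQ, hbW, hbw, hb⟩ := exists_of_not_low hd hg0 hl hlow hQ w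
      exact ⟨z', hz', hzQ, hzT, h, hh, w, hw, b', .inr hbQ, (hW _ hbW).1, (hW _ hbW).2, hbw, he, hb⟩
    rcases h1.2.2.2.2 with h | h | h
    · have h2 := cnt1_le_add (p := fun z' => z' ∈ Z ∧ E z' (v (i + 1)) (v (i + 2)))
        (q := fun z' => (z' ∈ Z ∧ E z' (v (i + 1)) (v (i + 2))) ∧ T ⊆ nb E z z')
        (r := fun z' => ¬ T ⊆ nb E z z') fun z' h => by
          by_cases hT : T ⊆ nb E z z' <;> simp [hT, h]
      have h3 : (#Q : ℝ) ≤ 10 * t + 10 := by exact_mod_cast hQ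
      obtain ⟨z', ⟨⟨hz', he⟩, hzT⟩, hQz⟩ := exists_of_card_lt_cnt1 (Q := Q)
        (p := fun z' => (z' ∈ Z ∧ E z' (v (i + 1)) (v (i + 2))) ∧ T ⊆ nb E z z')
        (by unfold codegIn at h; linarith)
      exact ⟨z', hz', hQz, hzT, v (i + 1), by simp, v i, by simp, v (i + 2), by simp,
        (hW _ (hvW _ hi)).1, (hW _ (hvW _ hi)).2,
        fun h => by have := hv _ _ hi (by omega) h; omega, hE.swap23 h0.1, he⟩
    · exact main _ (by simp) (v (i + 2)) (by simp) h1.1 h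
    · exact main _ (by simp) (v (i + 1)) (by simp) (hE.swap23 h1.1) h

theorem FanFree.cnt3_pairs_le (ht : 1 ≤ t) (hE : Sym3 E) (hF : FanFree E t) (hT : #T = t)
    (hR : Rich E t T Z) (hW : ∀ w ∈ W, w ∉ T ∧ w ∉ Z) {g d l : ℝ} (hl0 : 0 ≤ l)
    (hd : ∀ z ∈ Z, cnt1 (fun z' => ¬ T ⊆ nb E z z') ≤ d) (hg : d + (10 * t + 10) ≤ g)
    (hl : d + (10 * t + 10) + (10 * t + 11) * g ≤ l) :
    cnt3 (fun z a b => z ∈ Z ∧ a ∈ W ∧ b ∈ W ∧ E z a b) ≤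
      (10 * t + 11) * (#W : ℝ) ^ 2 + 3 * peelDeg t * ((#W : ℝ) ^ 2 + 2 * (l * #W)) +
        (2 * t - 1) * #W * #Z := by
  have h1 := cnt3_le_add (P := fun z a b => z ∈ Z ∧ a ∈ W ∧ b ∈ W ∧ E z a b)
    (Q := fun z a b => (a ∈ W ∧ b ∈ W ∧ codegIn E Z a b ≤ 10 * t + 11) ∧ z ∈ Z ∧ E z a b)
    (R := fun z a b => (z ∈ Z ∧ E z a b ∧ Poor E t Z W g a b ∧ Low E t Z W g l a ∧
      Low E t Z W g l b) ∨ z ∈ Z ∧ Useful E t Z W g l z a b) (by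
      rintro z a b ⟨hz, ha, hb, he⟩
      by_cases hc : codegIn E Z a b ≤ 10 * t + 11
      · exact .inl ⟨⟨ha, hb, hc⟩, hz, he⟩
      refine .inr ?_
      by_cases h : g < codegIn E Z a b ∨ ¬ Low E t Z W g l a ∨ ¬ Low E t Z W g l b
      · exact .inr ⟨hz, he, ha, hb, (not_le.1 hc).le, h⟩
      · push Not at h
        exact .inl ⟨hz, he, ⟨ha, hb, (not_le.1 hc).le, h.1⟩, h.2⟩)
  have h2 := cnt3_or (fun z a b => z ∈ Z ∧ E z a b ∧ Poor E t Z W g a b ∧ Low E t Z W g l a ∧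
      Low E t Z W g l b) (fun z a b => z ∈ Z ∧ Useful E t Z W g l z a b)
  have h3 := hF.cnt3_low_le hE (Z := Z) (W := W) (g := g) hl0
  have h4 : cnt3 (fun z a b => z ∈ Z ∧ Useful E t Z W g l z a b) ≤ (2 * t - 1) * #W * #Z := by
    rw [← cnt1_mem Z]
    refine cnt3_le_mul1 (fun z a b h => h.1) fun z hz => ?_
    refine le_trans (cnt2_mono ?_) (hF.edgesIn_useful_le ht hE hT hR hW hz (hd z hz) hg hl)
    exact fun a b h => ⟨h.2, h.2.2.1, h.2.2.2.1⟩
  have h5 : cnt3 (fun z a b => (a ∈ W ∧ b ∈ W ∧ codegIn E Z a b ≤ 10 * t + 11) ∧ z ∈ Z ∧ E z a b) ≤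
      (10 * t + 11) * (#W : ℝ) ^ 2 := by
    rw [cnt3_rot fun a b z => (a ∈ W ∧ b ∈ W ∧ codegIn E Z a b ≤ 10 * t + 11) ∧ z ∈ Z ∧ E z a b]
    refine (cnt3_le_mul (P := fun a b z => (a ∈ W ∧ b ∈ W ∧ codegIn E Z a b ≤ 10 * t + 11) ∧
      z ∈ Z ∧ E z a b) (Q := fun a b => a ∈ W ∧ b ∈ W ∧ codegIn E Z a b ≤ 10 * t + 11)
      (C := 10 * t + 11) (fun a b z h => h.1)
      fun a b h => (cnt1_mono fun z hz => hz.2).trans h.2.2).trans ?_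
    gcongr
    exact (cnt2_mono fun a b h => ⟨h.1, h.2.1⟩).trans (cnt2_mem_le W)
  linarith

end LinkPaths

end FanTuran

namespace FanTuran

open Finset
open scoped Classical

section NearExtremal

theorem edges_le_missing {t D c d n w r z γ η l β A B : ℝ} (hD : 0 ≤ D) (hc : 0 ≤ c)
    (hw : 0 ≤ w) (hr : 0 ≤ r) (hn : 0 ≤ n) (hwr : w + r ≤ η * n) (hz : n - η * n ≤ z)
    (hγ : γ ≤ 1 / 48) (hηD : D * η ≤ γ / 2) (hηc : c * η ≤ γ / 2) (hη : η ≤ 1 / 48)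
    (hγn : 1 + t ≤ γ * n / 2) (hdn : 2 * d * t ≤ n / 16) (hl : 6 * D * l ≤ n / 8)
    (hβ : β ≤ c * w ^ 2 + 3 * D * (w ^ 2 + 2 * (l * w)) + (2 * t - 1) * w * z)
    (hB : B ≤ 3 * β + 3 * D * (w + r) ^ 2)
    (hA : 3 * (2 * ((z - d) * (w * t)) + (γ * n - (1 + t)) * r) ≤ A) : B ≤ A := by
  have hwn : w ≤ η * n := by linarith
  have hnw : 0 ≤ n * w := by positivity
  have h1 : D * (w + r) ^ 2 ≤ γ / 2 * (n * (w + r)) :=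
    calc D * (w + r) ^ 2 = D * (w + r) * (w + r) := by ring
      _ ≤ D * (η * n) * (w + r) := by gcongr
      _ = D * η * (n * (w + r)) := by ring
      _ ≤ _ := by gcongr
  have h2 : D * w ^ 2 ≤ γ / 2 * (n * w) :=
    calc D * w ^ 2 = D * w * w := by ring
      _ ≤ D * (η * n) * w := by gcongr
      _ = D * η * (n * w) := by ring
      _ ≤ _ := by gcongr
  have h3 : c * w ^ 2 ≤ γ / 2 * (n * w) :=
    calc c * w ^ 2 = c * w * w := by ring
      _ ≤ c * (η * n) * w := by gcongr
      _ = c * η * (n * w) := by ring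
      _ ≤ _ := by gcongr
  have h4 : (1 + t) * r ≤ γ * n / 2 * r := by gcongr
  have h5 : 6 * D * l * w ≤ n / 8 * w := by gcongr
  have h6 : 2 * d * t * w ≤ n / 16 * w := by gcongr
  have h7 : (n - η * n) * w ≤ z * w := by gcongr
  have h8 : η * (n * w) ≤ 1 / 48 * (n * w) := by gcongr
  have h9 : γ * (n * w) ≤ 1 / 48 * (n * w) := by gcongr
  nlinarith

/-- A fan-free hypergraph in which almost all pairs have a common set `T` of `t` neighbours
has at most as many edges as there are triples meeting `T`. -/
theorem exists_cnt3_le {t : ℕ} (ht : 1 ≤ t) : ∃ ε > (0 : ℝ), ∃ N : ℝ, ∀ (V : Type) [Fintype V]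
    (E : V → V → V → Prop), N ≤ Fintype.card V → Sym3 E → FanFree E t → ∀ T : Finset V, #T = t →
    cnt2 (fun a b => ¬ T ⊆ nb E a b) ≤ ε * (Fintype.card V : ℝ) ^ 2 →
    cnt3 E ≤ cnt3 fun a b c => (a ≠ b ∧ a ≠ c ∧ b ≠ c) ∧ (a ∈ T ∨ b ∈ T ∨ c ∈ T) := by
  obtain ⟨D, hD⟩ : ∃ D : ℝ, D = peelDeg t := ⟨_, rfl⟩
  have hD1 : 1 ≤ D := by
    rw [hD]; exact_mod_cast (by unfold peelDeg; omega : 1 ≤ peelDeg t)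
  have ht0 : (0 : ℝ) ≤ t := by positivity
  obtain ⟨γ, hγ⟩ : ∃ γ : ℝ, γ = 1 / (48 * D * (20 * t + 30)) := ⟨_, rfl⟩
  have hγ0 : 0 < γ := by rw [hγ]; positivity
  have hγD : 48 * D * (20 * t + 30) * γ = 1 := by rw [hγ]; field_simp
  have hγ1 : γ ≤ 1 / 48 := by
    have : 48 * γ ≤ 48 * D * (20 * t + 30) * γ := by
      gcongr
      nlinarith
    linarith
  obtain ⟨S, hS⟩ : ∃ S : ℝ, S = D + (10 * t + 11) := ⟨_, rfl⟩
  have hS1 : 1 ≤ S := by linarith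
  obtain ⟨η, hη⟩ : ∃ η : ℝ, η = γ / (2 * S) := ⟨_, rfl⟩
  have hη0 : 0 < η := by rw [hη]; positivity
  have hηS : S * η = γ / 2 := by rw [hη]; field_simp
  have hηD : D * η ≤ γ / 2 := by rw [← hηS]; gcongr; linarith
  have hηc : (10 * t + 11) * η ≤ γ / 2 := by rw [← hηS]; gcongr; linarith
  have hη1 : η ≤ 1 / 48 := by nlinarith
  refine ⟨γ * η, by positivity, 2 * (10 * t + 11) / γ + 32 * (10 * t + 4) * t + 1,
    fun V _ E hN hE hF T hT hε => ?_⟩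
  obtain ⟨n, hn⟩ : ∃ n : ℝ, n = Fintype.card V := ⟨_, rfl⟩
  rw [← hn] at hN hε
  have hγn : 2 * (10 * t + 11) ≤ γ * n := by
    have h1 : 2 * (10 * t + 11) / γ ≤ n := le_trans (by linarith [show (0:ℝ) ≤ 32 * (10 * t + 4) * t by positivity]) hN
    rw [div_le_iff₀ hγ0] at h1
    linarith
  have hq : (0 : ℝ) ≤ 2 * (10 * t + 11) / γ := by positivity
  have hdn : 2 * (10 * t + 4) * t ≤ n / 16 := by linarith
  have hn0 : 0 < n := by
    have : (0 : ℝ) ≤ 32 * (10 * t + 4) * t := by positivity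
    linarith
  set Z : Finset V := univ.filter fun v => cnt1 (fun u => ¬ T ⊆ nb E v u) ≤ γ * n with hZ
  have hZm : ∀ v, v ∈ Z ↔ cnt1 (fun u => ¬ T ⊆ nb E v u) ≤ γ * n := fun v => by simp [hZ]
  have hZc : cnt1 (fun v => v ∉ Z) ≤ η * n := by
    have h1 := mul_cnt1_le_cnt2 (P := fun a b => ¬ T ⊆ nb E a b) (p := fun v => v ∉ Z)
      (C := γ * n) fun v hv => (not_le.1 fun h => hv ((hZm v).2 h)).le
    have h2 : γ * n * cnt1 (fun v => v ∉ Z) ≤ γ * n * (η * n) := h1.trans (hε.trans (by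
      apply le_of_eq; ring))
    exact le_of_mul_le_mul_left h2 (by positivity)
  have hZn : n - η * n ≤ #Z := by
    have h1 := cnt1_le_add (p := fun _ : V => True) (q := fun v => v ∈ Z) (r := fun v => v ∉ Z)
      fun v _ => by tauto
    have h2 : cnt1 (fun _ : V => True) = n := by simp [cnt1, hn]
    rw [cnt1_mem, h2] at h1
    linarith
  have hη2 : η * n ≤ 1 / 48 * n := by gcongr
  have hγ2 : γ * n ≤ 1 / 48 * n := by gcongr
  have hR : Rich E t T Z := by
    intro z hz Q hQ
    have h1 := cnt1_le_add (p := fun v => v ∈ Z) (q := fun v => v ∈ Z ∧ T ⊆ nb E z v)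
      (r := fun v => ¬ T ⊆ nb E z v) fun v h => by by_cases h' : T ⊆ nb E z v <;> simp [h, h']
    have h2 := (hZm z).1 hz
    rw [cnt1_mem] at h1
    have h3 : (#Q : ℝ) ≤ 10 * t + 10 := by exact_mod_cast hQ
    obtain ⟨z', h, hQ'⟩ := exists_of_card_lt_cnt1 (Q := Q)
      (p := fun v => v ∈ Z ∧ T ⊆ nb E z v) (by linarith)
    exact ⟨z', h.1, hQ', h.2⟩
  set W := lowVertices E t T Z with hW
  set R : Finset V := univ.filter fun v => v ∉ T ∧ v ∉ Z with hRdef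
  have hWR : W ⊆ R := fun w hw => by
    have := mem_lowVertices.1 hw
    simp [hRdef, this.1, this.2.1]
  have hRm : ∀ v, v ∈ R ↔ v ∉ T ∧ v ∉ Z := fun v => by simp [hRdef]
  have hRn : (#R : ℝ) ≤ η * n := by
    rw [← cnt1_mem R]
    exact (cnt1_mono fun v hv => ((hRm v).1 hv).2).trans hZc
  have hRs : (#R : ℝ) = #W + #(R \ W) := by
    rw [card_sdiff_of_subset hWR, Nat.cast_sub (card_le_card hWR)]; ring
  have hβ := hF.cnt3_pairs_le ht hE hT hR (W := W)
    (fun w hw => (hRm w).1 (hWR hw)) (d := γ * n) (g := 2 * (γ * n)) (l := (20 * t + 30) * (γ * n))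
    (by positivity) (fun z hz => (hZm z).1 hz) (by linarith) (by nlinarith)
  have hB := hF.cnt3_avoid_le ht hE hT hR
  rw [← hW, ← hRdef, hRs, ← hD] at hB
  rw [← hD] at hβ
  have hA := le_cnt3_missing hE (Z := Z) (T := T) (W := W) (U := R \ W)
    (disjoint_left.2 fun z hz => hR.notMem hE hz)
    (disjoint_left.2 fun w hw => ((hRm w).1 (hWR hw)).1)
    (disjoint_left.2 fun w hw => ((hRm w).1 (hWR hw)).2)
    (disjoint_left.2 fun w hw => ((hRm w).1 (sdiff_subset hw)).1)
    (disjoint_left.2 fun w hw => ((hRm w).1 (sdiff_subset hw)).2)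
    sdiff_disjoint (d := 10 * t + 4) (fun w hw τ hτ => ((mem_lowVertices.1 hw).2.2 τ hτ).le)
    (g := γ * n) fun v hv =>
      (not_le.1 fun h => ((hRm v).1 (sdiff_subset hv)).2 ((hZm v).2 h)).le
  rw [hT] at hA
  push_cast at hA
  have key := edges_le_missing (by linarith) (by positivity) (Nat.cast_nonneg _)
    (Nat.cast_nonneg _) hn0.le (hRs ▸ hRn) hZn hγ1 hηD hηc hη1 (by linarith) hdn
    (by have : 6 * D * ((20 * t + 30) * (γ * n)) = 48 * D * (20 * t + 30) * γ * n / 8 := by ring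
        rw [this, hγD, one_mul]) hβ hB hA
  have s1 := cnt3_le_add (P := E) (Q := fun a b c => E a b c ∧ a ∉ T ∧ b ∉ T ∧ c ∉ T)
    (R := fun a b c => E a b c ∧ (a ∈ T ∨ b ∈ T ∨ c ∈ T)) fun a b c h => by tauto
  have s2 := cnt3_add_le (P := Missing E T) (Q := fun a b c => E a b c ∧ (a ∈ T ∨ b ∈ T ∨ c ∈ T))
    (R := fun a b c => (a ≠ b ∧ a ≠ c ∧ b ≠ c) ∧ (a ∈ T ∨ b ∈ T ∨ c ∈ T))
    (fun a b c h => ⟨h.1, h.2.1⟩)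
    (fun a b c h => ⟨⟨hE.ne12 h.1, hE.ne13 h.1, hE.ne23 h.1⟩, h.2⟩) fun a b c h h' => h.2.2 h'.1
  linarith

end NearExtremal

end FanTuran

namespace FanTuran

open Finset

section Turan

variable {V : Type} [DecidableEq V] {t i : ℕ}

/-- The ordered version of a family of triples. -/
def IsEdge (H : Finset (Finset V)) (a b c : V) : Prop :=
  (a ≠ b ∧ a ≠ c ∧ b ≠ c) ∧ {a, b, c} ∈ H

theorem sym3_isEdge (H : Finset (Finset V)) : Sym3 (IsEdge H) where
  swap12 h := ⟨⟨h.1.1.symm, h.1.2.2, h.1.2.1⟩, by rw [Finset.insert_comm]; exact h.2⟩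
  swap23 h := ⟨⟨h.1.2.1, h.1.1, h.1.2.2.symm⟩, by rw [Finset.pair_comm]; exact h.2⟩
  ne12 h := h.1.1

theorem cnt3_isEdge [Fintype V] {H : Finset (Finset V)} (hH : ∀ e ∈ H, #e = 3) :
    cnt3 (IsEdge H) = 6 * #H := by
  classical
  have hfib : ∀ e ∈ H, #(univ.filter fun p : V × V × V =>
      (p.1 ≠ p.2.1 ∧ p.1 ≠ p.2.2 ∧ p.2.1 ≠ p.2.2) ∧ ({p.1, p.2.1, p.2.2} : Finset V) = e) = 6 := by
    intro e he
    obtain ⟨x, y, z, hxy, hxz, hyz, rfl⟩ := card_eq_three.1 (hH e he)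
    have : (univ.filter fun p : V × V × V =>
        (p.1 ≠ p.2.1 ∧ p.1 ≠ p.2.2 ∧ p.2.1 ≠ p.2.2) ∧
          ({p.1, p.2.1, p.2.2} : Finset V) = {x, y, z}) =
        {(x, y, z), (x, z, y), (y, x, z), (y, z, x), (z, x, y), (z, y, x)} := by
      ext ⟨a, b, c⟩
      simp only [mem_filter, mem_univ, true_and, mem_insert, mem_singleton, Prod.mk.injEq]
      constructor
      · rintro ⟨⟨h1, h2, h3⟩, h⟩
        have ha : a ∈ ({x, y, z} : Finset V) := h ▸ by simp
        have hb : b ∈ ({x, y, z} : Finset V) := h ▸ by simp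
        have hc : c ∈ ({x, y, z} : Finset V) := h ▸ by simp
        simp only [mem_insert, mem_singleton] at ha hb hc
        grind
      · rintro (⟨rfl, rfl, rfl⟩ | ⟨rfl, rfl, rfl⟩ | ⟨rfl, rfl, rfl⟩ | ⟨rfl, rfl, rfl⟩ |
          ⟨rfl, rfl, rfl⟩ | ⟨rfl, rfl, rfl⟩) <;> refine ⟨by tauto, ?_⟩ <;> ext <;> simp <;> tauto
    rw [this]
    simp [hxy, hxz, hyz, hxy.symm, hxz.symm, hyz.symm]
  have h1 : cnt3 (IsEdge H) = #(univ.filter fun p : V × V × V => IsEdge H p.1 p.2.1 p.2.2) := by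
    simp only [cnt3_eq_sum, ind, card_filter, Nat.cast_sum, Fintype.sum_prod_type]
    simp
  have h2 := card_eq_sum_card_fiberwise (s := univ.filter fun p : V × V × V =>
    IsEdge H p.1 p.2.1 p.2.2) (f := fun p => ({p.1, p.2.1, p.2.2} : Finset V)) (t := H)
    fun p hp => (mem_filter.1 (mem_coe.1 hp)).2.2
  rw [h1, h2, sum_congr rfl (g := fun _ => 6)]
  · simp [mul_comm]
  · intro e he
    rw [← hfib e he, filter_filter]
    congr 1
    ext p
    simp only [mem_filter, mem_univ, true_and]
    exact ⟨fun h => ⟨h.1.1, h.2⟩, fun h => ⟨⟨h.1, h.2 ▸ he⟩, h.2⟩⟩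

theorem fanFree_isEdge (hi : i < t) {H : Finset (Finset V)} (hH : ¬ ContainsFanExpTri t i H) :
    FanFree (IsEdge H) t := by
  rintro ⟨c, A, hAd, hA, hA'⟩
  apply hH
  have hex : ∀ j, ∃ a b x y z, A j = univ.image ![a, b, x, y, z] ∧ #(A j) = 5 ∧ c ∉ A j ∧
      IsEdge H c a x ∧ IsEdge H c b y ∧ IsEdge H a b z ∧ (j.val + 1 < t → IsEdge H c a b) := by
    intro j
    have himg : ∀ a b x y z : V, (univ.image ![a, b, x, y, z]) = {a, b, x, y, z} := by
      intro a b x y z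
      ext v
      simp [Fin.exists_fin_succ, eq_comm]
    by_cases hj : j.val + 1 < t
    · obtain ⟨a, b, x, y, z, h1, h2, h3, h4, h5, h6, h7⟩ := hA' j hj
      refine ⟨a, b, x, y, z, ?_, h2, h3, h4, h5, h6, fun _ => h7⟩
      rw [h1, himg]; congr!
    · obtain ⟨a, b, x, y, z, h1, h2, h3, h4, h5, h6⟩ := hA j
      refine ⟨a, b, x, y, z, ?_, h2, h3, h4, h5, h6, fun h => absurd h hj⟩
      rw [h1, himg]; congr!
  choose a b x y z h1 h2 h3 h4 h5 h6 h7 using hex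
  have hmem : ∀ j k, ![a j, b j, x j, y j, z j] k ∈ A j := fun j k => by
    rw [h1 j]; exact mem_image_of_mem _ (mem_univ k)
  have hinj : ∀ j, Function.Injective ![a j, b j, x j, y j, z j] := fun j => by
    have := card_image_iff.1 ((h1 j ▸ h2 j).trans (card_fin 5).symm)
    rwa [coe_univ, Set.injOn_univ] at this
  refine ⟨Sum.elim (fun _ => c) fun p => ![a p.2, b p.2, x p.2, y p.2, z p.2] p.1, ?_,
    fun j => ⟨(h4 j).2, (h5 j).2, (h6 j).2⟩, fun j hj => (h7 j (by omega)).2⟩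
  rintro (u | ⟨k, j⟩) (u' | ⟨k', j'⟩) h
  · rfl
  · exact absurd (hmem j' k') (by simp only [Sum.elim_inl, Sum.elim_inr] at h; exact h ▸ h3 j')
  · exact absurd (hmem j k) (by simp only [Sum.elim_inl, Sum.elim_inr] at h; exact h ▸ h3 j)
  · simp only [Sum.elim_inr] at h
    by_cases hj : j = j'
    · subst hj
      rw [hinj j h]
    · exact absurd h (disjoint_left.1 (hAd j j' hj) (hmem j k) |> fun hn h => hn (h ▸ hmem j' k'))

/-- The triples meeting a given set. -/
def triplesMeeting [Fintype V] (T : Finset V) : Finset (Finset V) :=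
  powersetCard 3 univ \ powersetCard 3 (univ \ T)

theorem mem_triplesMeeting [Fintype V] {T e : Finset V} : e ∈ triplesMeeting T ↔ #e = 3 ∧ ∃ v ∈ e, v ∈ T := by
  simp only [triplesMeeting, mem_sdiff, mem_powersetCard, subset_univ, true_and, not_and, subset_sdiff,
    disjoint_left]
  constructor
  · rintro ⟨h1, h2⟩
    refine ⟨h1, ?_⟩
    by_contra! hc
    exact h2 hc h1
  · rintro ⟨h1, v, h2, h3⟩
    exact ⟨h1, fun h => absurd h3 (h h2)⟩

theorem card_triplesMeeting [Fintype V] (T : Finset V) :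
    #(triplesMeeting T) = (Fintype.card V).choose 3 - (Fintype.card V - #T).choose 3 := by
  rw [triplesMeeting, card_sdiff_of_subset (powersetCard_mono (subset_univ _)), card_powersetCard,
    card_powersetCard, card_sdiff_of_subset (subset_univ _), card_univ]

theorem isEdge_triplesMeeting [Fintype V] {T : Finset V} {a b c : V} : IsEdge (triplesMeeting T) a b c ↔
    (a ≠ b ∧ a ≠ c ∧ b ≠ c) ∧ (a ∈ T ∨ b ∈ T ∨ c ∈ T) := by
  unfold IsEdge
  rw [mem_triplesMeeting]
  refine and_congr_right fun h => ?_
  rw [card_eq_three.2 ⟨a, b, c, h.1, h.2.1, h.2.2, rfl⟩]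
  simp

theorem not_containsFanExpTri_triplesMeeting [Fintype V] {T : Finset V} (hT : #T = t) (ht : 0 < t) :
    ¬ ContainsFanExpTri t i (triplesMeeting T) := by
  rintro ⟨f, hf, hedge, -⟩
  simp only [mem_triplesMeeting, mem_insert, mem_singleton, exists_eq_or_imp, exists_eq_left] at hedge
  have key : ∀ k : Fin t → Fin 5, (∀ j, f (Sum.inr (k j, j)) ∈ T) → ∀ s, f s ∈ T →
      ∃ j, s = Sum.inr (k j, j) := by
    intro k hk s hs
    have himg : univ.image (fun j => f (Sum.inr (k j, j))) = T := by
      refine eq_of_subset_of_card_le (by simpa [image_subset_iff] using hk) ?_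
      rw [card_image_of_injective, card_univ, Fintype.card_fin, hT]
      intro j j' h
      simpa using (Prod.ext_iff.1 (Sum.inr_injective (hf h))).2
    rw [← himg] at hs
    obtain ⟨j, -, hj⟩ := mem_image.1 hs
    exact ⟨j, (hf hj).symm⟩
  by_cases hc : f (Sum.inl ()) ∈ T
  · have h : ∀ j, ∃ k : Fin 5, f (Sum.inr (k, j)) ∈ T := fun j => by
      rcases (hedge j).2.2.2 with h | h | h
      exacts [⟨_, h⟩, ⟨_, h⟩, ⟨_, h⟩]
    choose k hk using h
    obtain ⟨j, hj⟩ := key k hk _ hc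
    simp at hj
  · have h : ∀ j, ∃ k : Fin 5, (k = 0 ∨ k = 2) ∧ f (Sum.inr (k, j)) ∈ T := fun j => by
      rcases (hedge j).1.2 with h | h | h
      exacts [absurd h hc, ⟨0, by simp, h⟩, ⟨2, by simp, h⟩]
    choose k hk hkT using h
    have hq : ∃ q : Fin 5, (q = 1 ∨ q = 3) ∧ f (Sum.inr (q, (⟨0, ht⟩ : Fin t))) ∈ T := by
      rcases (hedge ⟨0, ht⟩).2.1.2 with h | h | h
      exacts [absurd h hc, ⟨1, by simp, h⟩, ⟨3, by simp, h⟩]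
    obtain ⟨q, hq, hqT⟩ := hq
    obtain ⟨j, hj⟩ := key k hkT _ hqT
    have := (Prod.ext_iff.1 (Sum.inr_injective hj)).1
    simp only at this
    rcases hk j with h | h <;> rcases hq with h' | h' <;> rw [h, h'] at this <;>
      exact absurd this (by decide)

theorem le_cnt3_triplesMeeting [Fintype V] (T : Finset V) :
    3 * ((Fintype.card V - #T - 1 : ℝ) * ((Fintype.card V - #T) * #T)) ≤
      cnt3 (IsEdge (triplesMeeting T)) := by
  have h0 := three_mul_le_cnt3_missing (E := fun _ _ _ : V => False) (T := T)
    ⟨False.elim, False.elim, False.elim⟩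
  have h1 : cnt3 (Missing (fun _ _ _ => False) T) ≤ cnt3 (IsEdge (triplesMeeting T)) :=
    cnt3_mono fun a b c h => isEdge_triplesMeeting.2 ⟨h.1, h.2.1⟩
  have hn : cnt1 (fun v => v ∉ T) = Fintype.card V - #T := by
    rw [show (fun v => v ∉ T) = fun v => v ∈ univ \ T by ext; simp, cnt1_mem,
      card_sdiff_of_subset (subset_univ _), card_univ, Nat.cast_sub (card_le_univ _)]
  have hn0 := cnt1_nonneg fun v => v ∉ T
  refine (mul_le_mul_of_nonneg_left ?_ (by norm_num)).trans (h0.trans h1)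
  by_cases hneg : (Fintype.card V - #T - 1 : ℝ) ≤ 0
  · exact (mul_nonpos_of_nonpos_of_nonneg hneg (mul_nonneg (hn ▸ hn0) (by positivity))).trans
      (cnt3_nonneg _)
  have h2 : (Fintype.card V - #T : ℝ) * #T ≤ cnt2 fun a b => a ∈ T ∧ b ∉ T := by
    rw [← hn, ← cnt1_mem T]
    exact mul_cnt1_le_cnt2 fun a ha => cnt1_mono fun b hb => ⟨ha, hb⟩
  refine (mul_le_mul_of_nonneg_left h2 (by linarith)).trans (mul_cnt2_le_cnt3 fun a b h => ?_)
  have h3 := card_sub_le_cnt1 {b} fun v => v ∉ T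
  rw [hn, card_singleton, Nat.cast_one] at h3
  refine h3.trans (cnt1_mono fun c hc => ?_)
  have hne : ∀ v ∉ T, a ≠ v := fun v hv hav => hv (hav ▸ h.1)
  exact ⟨⟨⟨hne b h.2, hne c hc.1, fun h' => hc.2 (by simp [h'])⟩, .inl h.1, id⟩, h.1, h.2, hc.1⟩

end Turan

end FanTuran

theorem turan_fan_expansion_with_triangles (t i : ℕ) (ht : 1 < t) (hi : i < t) :
    ∃ N : ℕ, ∀ n ≥ N, exFan3Tri t i n = n.choose 3 - (n - t).choose 3 := by
  open Finset FanTuran in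
  obtain ⟨ε, hε, N₁, h₁⟩ := exists_cnt3_le ht.le
  obtain ⟨ε₀, hε₀, N₂, h₂⟩ := exists_common_link ht hε
  obtain ⟨N, hN⟩ := exists_nat_ge (max (max N₁ N₂) (3 * t * (2 * t + 1) / ε₀))
  refine ⟨max N t, fun n hn => ?_⟩
  have hnN : (N : ℝ) ≤ n := by exact_mod_cast (le_max_left _ _).trans hn
  have hn1 : N₁ ≤ Fintype.card (Fin n) := by
    rw [Fintype.card_fin]; exact (le_max_left _ _).trans ((le_max_left _ _).trans (hN.trans hnN))
  have hn2 : N₂ ≤ Fintype.card (Fin n) := by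
    rw [Fintype.card_fin]; exact (le_max_right _ _).trans ((le_max_left _ _).trans (hN.trans hnN))
  have hn3 : 3 * t * (2 * t + 1) ≤ n * ε₀ :=
    (div_le_iff₀ hε₀).1 ((le_max_right _ _).trans (hN.trans hnN))
  have hstar : ∀ T : Finset (Fin n), #T = t → #(triplesMeeting T) = n.choose 3 - (n - t).choose 3 :=
    fun T hT => by rw [card_triplesMeeting, hT, Fintype.card_fin]
  have hstar3 : ∀ T : Finset (Fin n), ∀ e ∈ triplesMeeting T, #e = 3 := fun T e he => (mem_triplesMeeting.1 he).1
  obtain ⟨T₀, -, hT₀⟩ := exists_subset_card_eq (s := (univ : Finset (Fin n))) (n := t)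
    (by rw [card_fin]; exact (le_max_right _ _).trans hn)
  have hupper : n.choose 3 - (n - t).choose 3 ∈ upperBounds {m | ∃ H : Finset (Finset (Fin n)),
      (∀ e ∈ H, e.card = 3) ∧ ¬ ContainsFanExpTri t i H ∧ H.card = m} := by
    rintro _ ⟨H, hH, hF, rfl⟩
    by_contra! hlt
    have hcard : cnt3 (IsEdge (triplesMeeting T₀)) ≤ cnt3 (IsEdge H) := by
      rw [cnt3_isEdge hH, cnt3_isEdge (hstar3 T₀), hstar T₀ hT₀]
      gcongr
    have hdense := (le_cnt3_triplesMeeting T₀).trans hcard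
    rw [hT₀, Fintype.card_fin] at hdense
    obtain ⟨T, hT, hlink⟩ := h₂ (Fin n) (IsEdge H) hn2 (sym3_isEdge H) (fanFree_isEdge hi hF) (by
      rw [Fintype.card_fin]
      have h1 : 0 ≤ (3 : ℝ) * t * (t * (t + 1)) := by positivity
      nlinarith [mul_le_mul_of_nonneg_right hn3 (Nat.cast_nonneg (α := ℝ) n)])
    have hle := (h₁ (Fin n) (IsEdge H) hn1 (sym3_isEdge H) (fanFree_isEdge hi hF) T hT hlink).trans
      (cnt3_mono fun a b c => isEdge_triplesMeeting.2)
    rw [cnt3_isEdge hH, cnt3_isEdge (hstar3 T), hstar T hT] at hle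
    have : (#H : ℝ) ≤ (n.choose 3 - (n - t).choose 3 : ℕ) := by linarith
    exact absurd (by exact_mod_cast this) (not_le.2 hlt)
  exact le_antisymm (csSup_le' hupper) (le_csSup ⟨_, hupper⟩ ⟨triplesMeeting T₀, hstar3 T₀,
    not_containsFanExpTri_triplesMeeting hT₀ (by omega), hstar T₀ hT₀⟩)
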